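/- Let K belong to the class R₁ (the members of R with exactly one singular vertex) and let t be its singular vertex, so that |lk(t,K)| is a closed connected surface with h handles for some h ≥ 1 (a connected sum of h tori or of h Klein bottles). Then f₁(K) ≥ 4·f₀(K) + (6h − 10) + f₀(lk(t,K)). -/

import Mathlib

/-- An abstract simplicial complex on vertex set `ℕ`: a finite, downward closed
collection of nonempty finite sets of vertices. -/
structure SComplex where
  faces : Finset (Finset ℕ)
  not_empty_mem : ∅ ∉ faces
  down_closed : ∀ s ∈ faces, ∀ t ⊆ s, t ≠ ∅ → t ∈ faces

namespace SComplex

/-- The set of vertices of the complex. -/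
def vertexSet (K : SComplex) : Finset ℕ := K.faces.sup id

/-- `fnum K i` is the number of `i`-dimensional faces of `K`. -/
def fnum (K : SComplex) (i : ℕ) : ℕ := (K.faces.filter fun s => s.card = i + 1).card

/-- `g₂` for a 3-dimensional complex: `f₁ - 4 f₀ + 10`. -/
def g2 (K : SComplex) : ℤ := (K.fnum 1 : ℤ) - 4 * (K.fnum 0 : ℤ) + 10

/-- `g₂` for a 2-dimensional complex: `f₁ - 3 f₀ + 6`. -/
def g2surf (K : SComplex) : ℤ := (K.fnum 1 : ℤ) - 3 * (K.fnum 0 : ℤ) + 6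

/-- Euler characteristic of a (2-dimensional) complex. -/
def euler (K : SComplex) : ℤ := (K.fnum 0 : ℤ) - (K.fnum 1 : ℤ) + (K.fnum 2 : ℤ)

/-- The link of a face `σ`. -/
def lk (K : SComplex) (σ : Finset ℕ) : SComplex where
  faces := K.faces.filter fun γ => γ ∩ σ = ∅ ∧ γ ∪ σ ∈ K.faces
  not_empty_mem := fun h => K.not_empty_mem (Finset.mem_filter.mp h).1
  down_closed := by
    intro s hs t hts ht
    rw [Finset.mem_filter] at hs ⊢
    refine ⟨K.down_closed s hs.1 t hts ht, ?_, ?_⟩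
    · have h1 : t ∩ σ ⊆ s ∩ σ := Finset.inter_subset_inter hts (Finset.Subset.refl σ)
      rw [hs.2.1] at h1
      exact Finset.subset_empty.mp h1
    · refine K.down_closed (s ∪ σ) hs.2.2 (t ∪ σ)
        (Finset.union_subset_union hts (Finset.Subset.refl σ)) ?_
      intro hc
      exact ht (Finset.union_eq_empty.mp hc).1

/-- The (closed) star of a face `σ`. -/
def st (K : SComplex) (σ : Finset ℕ) : SComplex where
  faces := K.faces.filter fun α => α ∪ σ ∈ K.faces
  not_empty_mem := fun h => K.not_empty_mem (Finset.mem_filter.mp h).1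
  down_closed := by
    intro s hs t hts ht
    rw [Finset.mem_filter] at hs ⊢
    refine ⟨K.down_closed s hs.1 t hts ht, ?_⟩
    refine K.down_closed (s ∪ σ) hs.2 (t ∪ σ)
      (Finset.union_subset_union hts (Finset.Subset.refl σ)) ?_
    intro hc
    exact ht (Finset.union_eq_empty.mp hc).1

/-- A facet is a maximal face. -/
def IsFacet (K : SComplex) (s : Finset ℕ) : Prop :=
  s ∈ K.faces ∧ ∀ t ∈ K.faces, s ⊆ t → s = t

/-- A pure `d`-dimensional complex: all facets have `d+1` vertices. -/
def IsPure (K : SComplex) (d : ℕ) : Prop :=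
  K.faces.Nonempty ∧ ∀ s, K.IsFacet s → s.card = d + 1

/-- Two facets are adjacent if they share a codimension-one face. -/
def FacetAdj (K : SComplex) (s t : Finset ℕ) : Prop :=
  K.IsFacet s ∧ K.IsFacet t ∧ (s ∩ t).card + 1 = s.card

/-- Strong connectedness: any two facets are joined by a chain of facets, consecutive
ones sharing a codimension-one face. -/
def StronglyConnected (K : SComplex) : Prop :=
  ∀ s t, K.IsFacet s → K.IsFacet t → Relation.ReflTransGen K.FacetAdj s t

/-- Two vertices are adjacent if they span an edge. -/
def VertAdj (K : SComplex) (u v : ℕ) : Prop := ({u, v} : Finset ℕ) ∈ K.faces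

/-- Connectedness of a complex (via its 1-skeleton). -/
def Conn (K : SComplex) : Prop :=
  K.faces.Nonempty ∧
    ∀ u v, {u} ∈ K.faces → {v} ∈ K.faces → Relation.ReflTransGen K.VertAdj u v

/-- A normal `d`-pseudomanifold: pure, strongly connected, every `(d-1)`-face is in
exactly two facets, and links of faces of dimension at most `d-2` are connected. -/
def IsNormalPseudomanifold (K : SComplex) (d : ℕ) : Prop :=
  K.IsPure d ∧ K.StronglyConnected ∧
    (∀ s ∈ K.faces, s.card = d →
      (K.faces.filter fun F => F.card = d + 1 ∧ s ⊆ F).card = 2) ∧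
    (∀ s ∈ K.faces, s.card ≤ d - 1 → (K.lk s).Conn)

/-- The geometric realization `|K|`, as a subspace of `ℕ → ℝ`. -/
def realSpace (K : SComplex) : Set (ℕ → ℝ) :=
  {w | (∀ v, 0 ≤ w v) ∧ ∃ s ∈ K.faces, (∀ v, w v ≠ 0 → v ∈ s) ∧ ∑ v ∈ s, w v = 1}

/-- The link of the vertex `v` triangulates the `(d-1)`-sphere. -/
def HasSphereLink (K : SComplex) (d : ℕ) (v : ℕ) : Prop :=
  Nonempty (↥((K.lk {v}).realSpace) ≃ₜ
    ↥(Metric.sphere (0 : EuclideanSpace ℝ (Fin d)) 1))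

/-- A singular vertex of a normal 3-pseudomanifold: its link is not a 2-sphere. -/
def IsSingular (K : SComplex) (v : ℕ) : Prop :=
  {v} ∈ K.faces ∧ ¬ K.HasSphereLink 3 v

/-- `d(σ)`: the number of vertices of the link of `σ`. -/
def deg (K : SComplex) (σ : Finset ℕ) : ℕ := (K.lk σ).fnum 0

/-- The boundary complex of the simplex on vertex set `s`: all nonempty proper subsets. -/
def properFaces (s : Finset ℕ) : Finset (Finset ℕ) :=
  s.powerset.filter fun t => t ≠ ∅ ∧ t ≠ s

/-- All nonempty faces of the simplex on vertex set `s`. -/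
def simplexFaces (s : Finset ℕ) : Finset (Finset ℕ) :=
  s.powerset.filter fun t => t ≠ ∅

/-- Operation (A): a bistellar 2-move on an edge `uv` with `lk(uv) = ∂(abc)`, `abc ∉ K`. -/
def BistellarTwoMove (K K' : SComplex) : Prop :=
  ∃ u v a b c : ℕ,
    ({u, v} : Finset ℕ) ∈ K.faces ∧ u ≠ v ∧
    ({a, b, c} : Finset ℕ).card = 3 ∧
    u ∉ ({a, b, c} : Finset ℕ) ∧ v ∉ ({a, b, c} : Finset ℕ) ∧
    (K.lk {u, v}).faces = properFaces {a, b, c} ∧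
    ({a, b, c} : Finset ℕ) ∉ K.faces ∧
    K'.faces = ((K.faces.filter fun α => ¬ ({u, v} : Finset ℕ) ⊆ α) ∪
      simplexFaces (insert u {a, b, c})) ∪ simplexFaces (insert v {a, b, c})

/-- The faces of the boundary complex of a pure `d`-dimensional complex with face set `F`:
faces contained in some `(d-1)`-face lying in exactly one facet. -/
def bdryFaces (F : Finset (Finset ℕ)) (d : ℕ) : Finset (Finset ℕ) :=
  F.filter fun s => ∃ r ∈ F, s ⊆ r ∧ r.card = d ∧
    (F.filter fun t => t.card = d + 1 ∧ r ⊆ t).card = 1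

/-- The faces of the cone with apex `w` over the complex with face set `F`. -/
def coneFaces (w : ℕ) (F : Finset (Finset ℕ)) : Finset (Finset ℕ) :=
  (F ∪ F.image (insert w)) ∪ {{w}}

/-- `K₁` is obtained from the normal `d`-pseudomanifold `K` by contracting the
edge `uv` (satisfying the link condition): delete all faces containing `u` or `v`
and cone off the boundary of the result with a new vertex `w`. -/
def EdgeContractionAt (d : ℕ) (K : SComplex) (u v : ℕ) (K₁ : SComplex) : Prop :=
  ({u, v} : Finset ℕ) ∈ K.faces ∧ u ≠ v ∧
  (K.lk {u}).faces ∩ (K.lk {v}).faces = (K.lk {u, v}).faces ∧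
  ∃ w, w ∉ K.vertexSet ∧
    K₁.faces = (K.faces.filter fun α => u ∉ α ∧ v ∉ α) ∪
      coneFaces w (bdryFaces (K.faces.filter fun α => u ∉ α ∧ v ∉ α) d)

/-- Operation (B): an edge contraction in a 3-dimensional complex. -/
def EdgeContraction (K K₁ : SComplex) : Prop := ∃ u v, EdgeContractionAt 3 K u v K₁

/-- The class `R`: normal 3-pseudomanifolds with one or two singular vertices such that
(i) if `K` contains the boundary of a 3-simplex then it contains the 3-simplex and
(ii) no normal 3-pseudomanifold with smaller `g₂` is obtained from `K` by a
bistellar 2-move, an edge contraction, an edge expansion followed by a bistellar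
2-move, or an edge expansion followed by an edge contraction. -/
def InClassR (K : SComplex) : Prop :=
  K.IsNormalPseudomanifold 3 ∧
  1 ≤ {v | K.IsSingular v}.ncard ∧ {v | K.IsSingular v}.ncard ≤ 2 ∧
  (∀ s : Finset ℕ, s.card = 4 → (∀ t ∈ properFaces s, t ∈ K.faces) → s ∈ K.faces) ∧
  (∀ K' : SComplex, K'.IsNormalPseudomanifold 3 →
    (BistellarTwoMove K K' ∨ EdgeContraction K K' ∨
      (∃ M, EdgeContraction M K ∧ BistellarTwoMove M K') ∨
      (∃ M, EdgeContraction M K ∧ EdgeContraction M K')) →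
    K.g2 ≤ K'.g2)



end SComplex

open scoped Classical in
/-- Combinatorial data extracted from the complex, for the discharging argument. -/
structure DisData where
  V : Finset ℕ
  N : ℕ → ℕ → Prop
  R : ℕ → ℕ → ℕ → Prop
  Q : ℕ → ℕ → ℕ → ℕ → Prop
  t : ℕ
  Nsymm : ∀ {x y}, N x y → N y x
  Nne : ∀ {x y}, N x y → x ≠ y
  Nmem : ∀ {x y}, N x y → y ∈ V
  R12 : ∀ {x y z}, R x y z → R y x z
  R23 : ∀ {x y z}, R x y z → R x z y
  RN : ∀ {x y z}, R x y z → N x y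
  Q12 : ∀ {x y z w}, Q x y z w → Q y x z w
  Q23 : ∀ {x y z w}, Q x y z w → Q x z y w
  Q34 : ∀ {x y z w}, Q x y z w → Q x y w z
  QR : ∀ {x y z w}, Q x y z w → R x y z
  two : ∀ {x y z}, R x y z → (V.filter (Q x y z)).card = 2
  c1 : ∀ (x : ℕ) (S : ℕ → Prop), (∀ a b, R x a b → S a → S b) →
    ∀ a b, N x a → N x b → S a → S b
  c2 : ∀ (x y : ℕ) (S : ℕ → Prop), (∀ a b, Q x y a b → S a → S b) →
    ∀ a b, R x y a → R x y b → S a → S b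
  A : ∀ {x y}, N x y → 4 ≤ (V.filter (R x y)).card
  B : ∀ {x y}, N x y → ∃ z, N x z ∧ N y z ∧ ¬ R x y z
  T : ∀ {x a b c}, x ≠ t → R x a b → R x b c → R x a c → Q x a b c
  div : ∀ x, 3 ∣ ∑ y ∈ V.filter (N x), (V.filter (R x y)).card
  nbr : ∀ x ∈ V, ∃ y, N x y

namespace DisData

open scoped Classical in
/-- neighbours -/
noncomputable def nb (D : DisData) (x : ℕ) : Finset ℕ := D.V.filter (D.N x)

open scoped Classical in
/-- vertices of the link of an edge -/
noncomputable def l2 (D : DisData) (x y : ℕ) : Finset ℕ := D.V.filter (D.R x y)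

variable (D : DisData)

theorem mem_nb {x y : ℕ} : y ∈ D.nb x ↔ D.N x y := by
  simp only [nb, Finset.mem_filter]
  exact ⟨fun h => h.2, fun h => ⟨D.Nmem h, h⟩⟩

theorem RN13 {x y z : ℕ} (h : D.R x y z) : D.N x z := D.RN (D.R23 h)
theorem RN23 {x y z : ℕ} (h : D.R x y z) : D.N y z := D.RN (D.R23 (D.R12 h))
theorem Rne {x y z : ℕ} (h : D.R x y z) : x ≠ y ∧ x ≠ z ∧ y ≠ z :=
  ⟨D.Nne (D.RN h), D.Nne (D.RN13 h), D.Nne (D.RN23 h)⟩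
theorem rotr {x y z : ℕ} (h : D.R x y z) : D.R z x y := D.R12 (D.R23 h)
theorem rotl {x y z : ℕ} (h : D.R x y z) : D.R y z x := D.R23 (D.R12 h)
theorem R13 {x y z : ℕ} (h : D.R x y z) : D.R z y x := D.R12 (D.R23 (D.R12 h))

theorem mem_l2 {x y z : ℕ} : z ∈ D.l2 x y ↔ D.R x y z := by
  simp only [l2, Finset.mem_filter]
  exact ⟨fun h => h.2, fun h => ⟨D.Nmem (D.RN13 h), h⟩⟩

theorem l2_comm (x y : ℕ) : D.l2 x y = D.l2 y x := by
  ext z; rw [mem_l2, mem_l2]; exact ⟨D.R12, D.R12⟩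

/-- all four triangles -/
theorem QRs {x y z w : ℕ} (h : D.Q x y z w) : D.R x y z ∧ D.R x y w ∧ D.R x z w ∧ D.R y z w :=
  ⟨D.QR h, D.QR (D.Q34 h), D.QR (D.Q34 (D.Q23 h)), D.QR (D.Q34 (D.Q23 (D.Q12 h)))⟩

theorem two_ex {x y z : ℕ} (h : D.R x y z) :
    ∃ a b, a ≠ b ∧ D.Q x y z a ∧ D.Q x y z b ∧ ∀ c, D.Q x y z c → c = a ∨ c = b := by
  classical
  have h2 := D.two h
  obtain ⟨a, b, hab, he⟩ := Finset.card_eq_two.mp h2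
  have hm : ∀ c, D.Q x y z c ↔ c = a ∨ c = b := by
    intro c
    have : c ∈ ({a, b} : Finset ℕ) ↔ c = a ∨ c = b := by simp
    rw [← this, ← he, Finset.mem_filter]
    constructor
    · intro hc
      refine ⟨D.Nmem (D.RN13 (D.QR (D.Q34 hc))), ?_⟩
      convert hc
    · intro hc; convert hc.2
  exact ⟨a, b, hab, (hm a).2 (Or.inl rfl), (hm b).2 (Or.inr rfl), fun c hc => (hm c).1 hc⟩

theorem two_other {x y z a : ℕ} (h : D.Q x y z a) : ∃ b, b ≠ a ∧ D.Q x y z b := by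
  obtain ⟨p, q, hpq, hp, hq, -⟩ := D.two_ex (D.QR h)
  by_cases hpa : p = a
  · exact ⟨q, fun h => hpq (hpa.trans h.symm), hq⟩
  · exact ⟨p, hpa, hp⟩

theorem two_only {x y z a b c : ℕ} (ha : D.Q x y z a) (hb : D.Q x y z b) (hab : a ≠ b)
    (hc : D.Q x y z c) : c = a ∨ c = b := by
  obtain ⟨p, q, hpq, hp, hq, hall⟩ := D.two_ex (D.QR ha)
  have := hall a ha; have := hall b hb; have := hall c hc
  grind

theorem l2_A {x y : ℕ} (h : D.N x y) : 4 ≤ (D.l2 x y).card := D.A h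

theorem tri_closed {u x c c' y : ℕ} (h1 : D.Q u x c c') (h2 : D.Q u x c y) (h3 : D.Q u x c' y)
    (hy : c' ≠ y) : False := by
  have hcc' : c ≠ c' := (D.Rne (D.QRs h1).2.2.2).2.2
  have hcy : c ≠ y := (D.Rne (D.QRs h2).2.2.2).2.2
  have hcl := D.c2 u x (fun z => z = c ∨ z = c' ∨ z = y) (by
    intro a b hab hS
    rcases hS with rfl | rfl | rfl
    · rcases D.two_only h1 h2 hy hab with h | h <;> simp [h]
    · rcases D.two_only (D.Q34 h1) h3 hcy hab with h | h <;> simp [h]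
    · rcases D.two_only (D.Q34 h2) (D.Q34 h3) hcc' hab with h | h <;> simp [h]) c
  have hsub : D.l2 u x ⊆ {c, c', y} := by
    intro z hz
    have := hcl z (D.QR h1) (D.mem_l2.1 hz) (Or.inl rfl)
    simpa using this
  have := Finset.card_le_card hsub
  have h4 := D.l2_A (D.RN (D.QR h1))
  have := Finset.card_le_three (a := c) (b := c') (c := y)
  omega

/-- link of `u` is a suspension with apices `x`, `w` -/
def Susp (u x w : ℕ) : Prop := u ≠ D.t ∧ D.N u x ∧ D.N u w ∧ x ≠ w ∧ ¬ D.R u x w ∧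
  ∀ y, D.N u y → y = x ∨ y = w ∨ D.R u x y

variable {D}

theorem Susp.cc {u x w c : ℕ} (h : D.Susp u x w) (hc : D.R u x c) : D.R u w c := by
  obtain ⟨hut, hux, huw, hxw, hn, hall⟩ := h
  obtain ⟨c', -, -, hQ, -, -⟩ := D.two_ex hc
  obtain ⟨r1, r2, r3, r4⟩ := D.QRs hQ
  -- apex on the other side of the triangle
  have hQ' : D.Q u c c' x := D.Q34 (D.Q23 hQ)
  obtain ⟨y, hyx, hy⟩ := D.two_other hQ'
  obtain ⟨s1, s2, s3, s4⟩ := D.QRs hy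
  rcases hall y (D.RN13 s2) with h | h | h
  · exact absurd h hyx
  · subst h; exact D.R23 s2
  · exfalso
    have q1 : D.Q u x c y := D.T hut r1 s2 h
    have q2 : D.Q u x c' y := D.T hut r2 s3 h
    exact D.tri_closed hQ q1 q2 (D.Rne s3).2.2

theorem Susp.symm {u x w : ℕ} (h : D.Susp u x w) : D.Susp u w x := by
  have h0 := h
  obtain ⟨hut, hux, huw, hxw, hn, hall⟩ := h
  refine ⟨hut, huw, hux, hxw.symm, fun hh => hn (D.R23 hh), fun y hy => ?_⟩
  rcases hall y hy with h | h | h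
  · exact Or.inr (Or.inl h)
  · exact Or.inl h
  · exact Or.inr (Or.inr (h0.cc h))

theorem Susp.nb_eq {u x w : ℕ} (h : D.Susp u x w) : D.nb u = insert x (insert w (D.l2 u x)) := by
  ext y
  simp only [Finset.mem_insert, D.mem_nb, D.mem_l2]
  constructor
  · exact h.2.2.2.2.2 y
  · rintro (rfl | rfl | hr)
    · exact h.2.1
    · exact h.2.2.1
    · exact D.RN13 hr

theorem Susp.card {u x w : ℕ} (h : D.Susp u x w) : (D.nb u).card = (D.l2 u x).card + 2 := by
  rw [h.nb_eq, Finset.card_insert_of_notMem, Finset.card_insert_of_notMem]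
  · rw [D.mem_l2]; exact h.2.2.2.2.1
  · simp only [Finset.mem_insert, D.mem_l2, not_or]
    exact ⟨h.2.2.2.1, fun hr => (D.Rne hr).2.2 rfl⟩

theorem Susp.N {u x w : ℕ} (h : D.Susp u x w) : D.N x w := by
  obtain ⟨z, h1, h2, h3⟩ := D.B h.2.1
  rcases h.2.2.2.2.2 z h1 with rfl | rfl | h4
  · exact absurd rfl (D.Nne h2)
  · exact h2
  · exact absurd h4 h3

theorem Susp.P {u x w c : ℕ} (h : D.Susp u x w) (hc : D.R u x c) (hct : c ≠ D.t) :
    ¬ D.R x w c := by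
  intro hr
  have h1 := h.cc hc
  have : D.Q c u x w := D.T hct (D.rotr hc) (D.rotr hr) (D.rotr h1)
  exact h.2.2.2.2.1 (D.QRs this).2.2.2

theorem Susp.same {u₁ u₂ x w₁ w₂ : ℕ} (h₁ : D.Susp u₁ x w₁) (h₂ : D.Susp u₂ x w₂)
    (hr : D.R x u₁ u₂) : w₁ = w₂ := by
  have a1 : D.R u₁ w₁ u₂ := h₁.cc (D.R12 hr)
  rcases h₂.2.2.2.2.2 w₁ (D.RN13 (D.rotr a1)) with h | h | h
  · exact absurd h.symm h₁.2.2.2.1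
  · exact h
  · exfalso
    have : D.Q u₂ u₁ x w₁ := D.T h₂.1 (D.R13 hr) h (D.rotr a1)
    exact h₁.2.2.2.2.1 (D.QRs this).2.2.2

variable (D)

theorem Cl {x w p : ℕ} (P : ℕ → Prop) (O : Finset ℕ) (hp : D.N x p) (hP : P p)
    (hcl : ∀ a b, P a → D.R x a b → P b ∨ b ∈ O) (hw : D.N x w) (hwP : ¬ P w) (hwO : w ∉ O) :
    2 ≤ O.card := by
  by_contra hlt
  have : O.card ≤ 1 := by omega
  by_cases hex : ∃ a b, P a ∧ D.R x a b ∧ ¬ P b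
  · obtain ⟨a, o, ha, hr, ho⟩ := hex
    have hoO : o ∈ O := (hcl a o ha hr).resolve_left ho
    have hO : ∀ b ∈ O, b = o := fun b hb => Finset.card_le_one.mp this b hb o hoO
    have hlk : ∀ b, D.R x o b → P b := fun b hb =>
      D.c2 x o P (by
        intro c d hQ hc
        have hr := (D.QRs hQ).2.2.1
        rcases hcl c d hc hr with h | h
        · exact h
        · exact absurd (hO d h).symm (D.Rne (D.QRs hQ).2.1).2.2) a b (D.R23 hr) hb ha
    have := D.c1 x (fun b => P b ∨ b = o) (by
      intro c d hr2 hc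
      rcases hc with hc | hc
      · rcases hcl c d hc hr2 with h | h
        · exact Or.inl h
        · exact Or.inr (hO d h)
      · exact Or.inl (hlk d (hc ▸ hr2))) p w hp hw (Or.inl hP)
    rcases this with h | h
    · exact hwP h
    · exact hwO (h ▸ hoO)
  · push Not at hex
    exact hwP (D.c1 x P (fun a b hr ha => hex a b ha hr) p w hp hw hP)

theorem l2_sub {x y : ℕ} : insert y (D.l2 x y) ⊆ insert y (D.nb x) := by
  apply Finset.insert_subset_insert
  intro z hz
  exact D.mem_nb.2 (D.RN13 (D.mem_l2.1 hz))

/-- B-vertex is outside the link -/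
theorem d2_le {x y : ℕ} (h : D.N x y) : (D.l2 x y).card + 2 ≤ (D.nb x).card := by
  obtain ⟨z, h1, h2, h3⟩ := D.B h
  have : insert y (insert z (D.l2 x y)) ⊆ D.nb x := by
    intro a ha
    simp only [Finset.mem_insert, D.mem_l2] at ha
    rw [D.mem_nb]
    rcases ha with rfl | rfl | ha
    · exact h
    · exact h1
    · exact D.RN13 ha
  have hc := Finset.card_le_card this
  rw [Finset.card_insert_of_notMem, Finset.card_insert_of_notMem] at hc
  · exact hc
  · rwa [D.mem_l2]
  · simp only [Finset.mem_insert, D.mem_l2, not_or]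
    exact ⟨D.Nne h2, fun hr => (D.Rne hr).2.2 rfl⟩

theorem six_le {x : ℕ} (hx : x ∈ D.V) : 6 ≤ (D.nb x).card := by
  obtain ⟨y, hy⟩ := D.nbr x hx
  have := D.d2_le hy
  have := D.l2_A hy
  omega

theorem susp_of {u x : ℕ} (hu : u ≠ D.t) (h : D.N u x) (hc : (D.nb u).card ≤ (D.l2 u x).card + 2) :
    ∃ w, D.Susp u x w := by
  obtain ⟨z, h1, h2, h3⟩ := D.B h
  have hsub : insert x (insert z (D.l2 u x)) ⊆ D.nb u := by
    intro a ha
    simp only [Finset.mem_insert, D.mem_l2] at ha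
    rw [D.mem_nb]
    rcases ha with rfl | rfl | ha
    · exact h
    · exact h1
    · exact D.RN13 ha
  have hcard : (insert x (insert z (D.l2 u x))).card = (D.l2 u x).card + 2 := by
    rw [Finset.card_insert_of_notMem, Finset.card_insert_of_notMem]
    · rwa [D.mem_l2]
    · simp only [Finset.mem_insert, D.mem_l2, not_or]
      exact ⟨D.Nne h2, fun hr => (D.Rne hr).2.2 rfl⟩
  have heq := Finset.eq_of_subset_of_card_le hsub (by omega)
  refine ⟨z, hu, h, h1, D.Nne h2, h3, fun y hy => ?_⟩
  have : y ∈ D.nb u := D.mem_nb.2 hy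
  rw [← heq] at this
  simpa only [Finset.mem_insert, D.mem_l2] using this

/-- outer vertex -/
def Out (u : ℕ) : Prop := u ≠ D.t ∧ ¬ D.N D.t u

variable {D}

/-- out vertex with suspension: neighbourhoods disjoint -/
theorem Susp.big {u x w : ℕ} (h : D.Susp u x w) (ho : D.Out u) :
    Disjoint (insert u (D.l2 x u)) (insert w (D.l2 x w)) ∧
    insert u (D.l2 x u) ⊆ D.nb x ∧ insert w (D.l2 x w) ⊆ D.nb x := by
  refine ⟨?_, ?_, ?_⟩
  · rw [Finset.disjoint_left]
    intro a ha hb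
    simp only [Finset.mem_insert, D.mem_l2] at ha hb
    have huw : u ≠ w := D.Nne h.2.2.1
    rcases ha with rfl | ha
    · rcases hb with hb | hb
      · exact huw hb
      · exact h.2.2.2.2.1 (D.rotr hb)
    · rcases hb with rfl | hb
      · exact h.2.2.2.2.1 (D.R12 ha)
      · refine h.P (D.R12 ha) ?_ hb
        rintro rfl
        exact ho.2 (D.Nsymm (D.RN23 ha))
  · intro a ha
    simp only [Finset.mem_insert, D.mem_l2] at ha
    rcases ha with rfl | ha
    · exact D.mem_nb.2 (D.Nsymm h.2.1)
    · exact D.mem_nb.2 (D.RN13 ha)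
  · intro a ha
    simp only [Finset.mem_insert, D.mem_l2] at ha
    rcases ha with rfl | ha
    · exact D.mem_nb.2 h.N
    · exact D.mem_nb.2 (D.RN13 ha)

theorem card_ins (D : DisData) (x u : ℕ) : (insert u (D.l2 x u)).card = (D.l2 x u).card + 1 := by
  rw [Finset.card_insert_of_notMem]
  rw [D.mem_l2]
  exact fun hr => (D.Rne hr).2.2 rfl

theorem Susp.big_card {u x w : ℕ} (h : D.Susp u x w) (ho : D.Out u) :
    (D.nb u).card + 4 ≤ (D.nb x).card := by
  obtain ⟨h1, h2, h3⟩ := h.big ho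
  have := Finset.card_le_card (Finset.union_subset h2 h3)
  rw [Finset.card_union_of_disjoint h1, card_ins, card_ins, D.l2_comm x u] at this
  have := h.card
  have := D.l2_A h.N
  omega

theorem out_six {u : ℕ} (ho : D.Out u) (hd : (D.nb u).card = 6) {y : ℕ} (hy : D.N u y) :
    ∃ w, D.Susp u y w :=
  D.susp_of ho.1 hy (by have := D.l2_A hy; omega)

theorem out_seven {u : ℕ} (ho : D.Out u) (hd : (D.nb u).card = 7) :
    ∃ x w, D.Susp u x w := by
  by_contra hcon
  push Not at hcon
  have h4 : ∀ y ∈ D.nb u, (D.l2 u y).card = 4 := by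
    intro y hy
    have hy := D.mem_nb.1 hy
    have h1 := D.l2_A hy
    have h2 := D.d2_le hy
    by_contra h3
    obtain ⟨w, hw⟩ := D.susp_of ho.1 hy (by omega)
    exact hcon y w hw
  have h28 : ∑ y ∈ D.nb u, (D.l2 u y).card = 28 := by
    rw [Finset.sum_congr rfl h4, Finset.sum_const, hd]; rfl
  have := D.div u
  have h' : 3 ∣ ∑ y ∈ D.nb u, (D.l2 u y).card := this
  rw [h28] at h'
  omega

variable (D)

/-- the out bad vertices with apex `x` -/
def IsSb (x u : ℕ) : Prop := D.Out u ∧ (D.nb u).card ≤ 7 ∧ ∃ w, D.Susp u x w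

open scoped Classical in
/-- the out bad vertices with apex `x` -/
noncomputable def Sb (x : ℕ) : Finset ℕ := D.V.filter (D.IsSb x)

open scoped Classical in
/-- the inner bad vertices with second apex `x` -/
noncomputable def ST (x : ℕ) : Finset ℕ := D.V.filter (fun v => D.N D.t v ∧ D.Susp v D.t x)

theorem mem_Sb {x u : ℕ} : u ∈ D.Sb x ↔ D.IsSb x u := by
  simp only [Sb, Finset.mem_filter]
  refine ⟨fun h => h.2, fun h => ⟨?_, h⟩⟩
  obtain ⟨w, hw⟩ := h.2.2
  exact D.Nmem (D.Nsymm hw.2.1)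

theorem mem_ST {x u : ℕ} : u ∈ D.ST x ↔ D.N D.t u ∧ D.Susp u D.t x := by
  simp only [ST, Finset.mem_filter]
  exact ⟨fun h => h.2, fun h => ⟨D.Nmem h.1, h⟩⟩

theorem Sb_sub (x : ℕ) : D.Sb x ⊆ D.nb x := by
  intro u hu
  obtain ⟨-, -, w, hw⟩ := D.mem_Sb.1 hu
  exact D.mem_nb.2 (D.Nsymm hw.2.1)

variable {D}

theorem anti_notMem {x u w : ℕ} (hu : D.Susp u x w) (ho : D.Out u) : w ∉ D.Sb x := by
  intro hw
  have h1 := hu.symm.big_card ho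
  have h2 := (D.mem_Sb.1 hw).2.1
  have h3 := D.six_le (D.Nmem (D.Nsymm hu.2.1))
  omega

theorem Sb_three {x : ℕ} (hne : (D.Sb x).Nonempty) :
    (D.Sb x).card + 3 ≤ (D.nb x).card := by
  classical
  obtain ⟨u, hu⟩ := hne
  obtain ⟨ho, hd, w, hw⟩ := D.mem_Sb.1 hu
  have hwS := anti_notMem hw ho
  have h2 : 2 ≤ ((D.nb x \ D.Sb x).erase w).card := by
    refine D.Cl (x := x) (w := w) (p := u) (fun a => D.IsSb x a ∧ D.Susp a x w) _
      (D.Nsymm hw.2.1) ⟨⟨ho, hd, w, hw⟩, hw⟩ ?_ hw.N ?_ ?_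
    · rintro a b ⟨ha, has⟩ hr
      by_cases hb : b ∈ D.Sb x
      · left
        have hb' := D.mem_Sb.1 hb
        obtain ⟨-, -, w', hw'⟩ := hb'
        have := has.same hw' hr
        subst this
        exact ⟨D.mem_Sb.1 hb, hw'⟩
      · right
        rw [Finset.mem_erase, Finset.mem_sdiff, D.mem_nb]
        refine ⟨?_, D.RN13 hr, hb⟩
        rintro rfl
        exact has.2.2.2.2.1 (D.R12 hr)
    · rintro ⟨-, h⟩
      exact D.Nne h.2.2.1 rfl
    · simp
  have hm : w ∈ D.nb x \ D.Sb x := by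
    rw [Finset.mem_sdiff, D.mem_nb]; exact ⟨hw.N, hwS⟩
  rw [Finset.card_erase_of_mem hm] at h2
  have := Finset.card_sdiff_add_card_eq_card (D.Sb_sub x)
  omega

theorem Sb_far {x u w c : ℕ} (hx : x ≠ D.t) (hw : D.Susp u x w) (ho : D.Out u)
    (hc : c ∈ D.Sb x) (hr : D.R x u c) :
    (D.nb c).card + (D.nb u).card ≤ (D.nb x).card + 1 := by
  classical
  obtain ⟨hco, hcd, w', hw'⟩ := D.mem_Sb.1 hc
  have hww := hw.same hw' hr
  subst hww
  obtain ⟨hdis, hs1, hs2⟩ := hw.big ho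
  obtain ⟨hdis', hs1', hs2'⟩ := hw'.big hco
  obtain ⟨p, q, hpq, hp, hq, hall⟩ := D.two_ex hr
  have hsub : D.l2 x c ⊆ {u, p, q} ∪ (D.nb x \ (insert u (D.l2 x u) ∪ insert w (D.l2 x w))) := by
    intro y hy
    have hy' := D.mem_l2.1 hy
    rw [Finset.mem_union, Finset.mem_sdiff, D.mem_nb]
    by_cases h1 : y = u
    · left; simp [h1]
    by_cases h2 : D.R x u y
    · left
      have := hall y (D.T hx hr hy' h2)
      rcases this with h | h <;> simp [h]
    right
    refine ⟨D.RN13 hy', ?_⟩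
    rw [Finset.mem_union, not_or]
    constructor
    · simp [h1, D.mem_l2, h2]
    · exact fun h => Finset.disjoint_left.mp hdis' (Finset.mem_insert_of_mem hy) h
  have h1 := Finset.card_le_card hsub
  have h2 := Finset.card_union_le {u, p, q} (D.nb x \ (insert u (D.l2 x u) ∪ insert w (D.l2 x w)))
  have h3 := Finset.card_le_three (a := u) (b := p) (c := q)
  have h4 := Finset.card_sdiff_add_card_eq_card (Finset.union_subset hs1 hs2)
  rw [Finset.card_union_of_disjoint hdis, card_ins, card_ins] at h4
  have h5 := hw.card
  rw [D.l2_comm u x] at h5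
  have h6 := hw'.card
  have h7 := D.l2_A hw.N
  rw [D.l2_comm] at h6
  omega

theorem count_F {x u w : ℕ} (hw : D.Susp u x w) {F : Finset ℕ} (hF : F ⊆ D.nb x)
    (h1 : ∀ c ∈ F, ¬ D.R x u c) (h2 : w ∉ F) : F.card + (D.nb u).card ≤ (D.nb x).card + 1 := by
  classical
  have hw' : w ∉ D.l2 x u := fun h => hw.2.2.2.2.1 (D.R12 (D.mem_l2.1 h))
  have hsub : F ∪ insert w (D.l2 x u) ⊆ D.nb x := by
    refine Finset.union_subset hF ?_
    intro y hy
    rw [Finset.mem_insert, D.mem_l2] at hy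
    rcases hy with rfl | hy
    · exact D.mem_nb.2 hw.N
    · exact D.mem_nb.2 (D.RN13 hy)
  have := Finset.card_le_card hsub
  rw [Finset.card_union_of_disjoint, Finset.card_insert_of_notMem hw', D.l2_comm] at this
  · have := hw.card
    omega
  · rw [Finset.disjoint_left]
    intro a ha hb
    rw [Finset.mem_insert, D.mem_l2] at hb
    rcases hb with rfl | hb
    · exact h2 ha
    · exact h1 a ha hb

theorem out_big {x : ℕ} (hx : D.Out x) (hd : 8 ≤ (D.nb x).card) (s6 s7 : Finset ℕ)
    (h6 : ∀ u, u ∈ s6 ↔ D.IsSb x u ∧ (D.nb u).card = 6)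
    (h7 : ∀ u, u ∈ s7 ↔ D.IsSb x u ∧ (D.nb u).card = 7) :
    2 * s6.card + 3 * s7.card + 48 ≤ 6 * (D.nb x).card := by
  classical
  have hdis : Disjoint s6 s7 := by
    rw [Finset.disjoint_left]; intro a ha hb
    have := (h6 a).1 ha; have := (h7 a).1 hb; omega
  have hun : s6 ∪ s7 = D.Sb x := by
    ext a
    rw [Finset.mem_union, h6, h7, D.mem_Sb]
    constructor
    · rintro (h | h) <;> exact h.1
    · intro h
      obtain ⟨w, hw⟩ := h.2.2
      have h3 := D.six_le (D.Nmem (D.Nsymm hw.2.1))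
      have h4 := h.2.1
      have : (D.nb a).card = 6 ∨ (D.nb a).card = 7 := by omega
      rcases this with h5 | h5
      · exact Or.inl ⟨h, h5⟩
      · exact Or.inr ⟨h, h5⟩
  have hcard : s6.card + s7.card = (D.Sb x).card := by
    rw [← hun, Finset.card_union_of_disjoint hdis]
  by_cases hne : (D.Sb x).Nonempty
  swap
  · rw [Finset.not_nonempty_iff_eq_empty] at hne
    rw [hne, Finset.card_empty] at hcard
    omega
  have h3 := Sb_three hne
  by_cases h13 : 13 ≤ (D.nb x).card
  · omega
  by_cases hs7 : s7 = ∅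
  · rw [hs7, Finset.card_empty] at *
    by_cases h11 : 11 ≤ (D.nb x).card
    · omega
    obtain ⟨u, hu⟩ := hne
    obtain ⟨ho, hd, w, hw⟩ := D.mem_Sb.1 hu
    have hu6 := D.six_le (D.Nmem (D.Nsymm hw.2.1))
    have h10 := hw.big_card ho
    have := count_F hw (D.Sb_sub x) (by
      intro c hc hr
      have := Sb_far hx.1 hw ho hc hr
      have := D.six_le (D.Nmem (D.RN13 hr))
      omega) (anti_notMem hw ho)
    omega
  · obtain ⟨u, hu⟩ := Finset.nonempty_iff_ne_empty.2 hs7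
    obtain ⟨⟨ho, hd, w, hw⟩, hu7⟩ := (h7 u).1 hu
    have h11 := hw.big_card ho
    by_cases h12 : (D.nb x).card = 11
    · have := count_F hw (D.Sb_sub x) (by
        intro c hc hr
        have := Sb_far hx.1 hw ho hc hr
        have := D.six_le (D.Nmem (D.RN13 hr))
        omega) (anti_notMem hw ho)
      omega
    · have hsub : s7 ⊆ D.Sb x := by rw [← hun]; exact Finset.subset_union_right
      have := count_F hw (hsub.trans (D.Sb_sub x)) (by
        intro c hc hr
        have := Sb_far hx.1 hw ho (hsub hc) hr
        have := ((h7 c).1 hc).2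
        omega) (fun h => anti_notMem hw ho (hsub h))
      omega

variable (D) in
/-- interior vertices -/
noncomputable def I (x : ℕ) : Finset ℕ := D.nb x \ (insert D.t (D.l2 x D.t))

theorem mem_I {x y : ℕ} : y ∈ D.I x ↔ D.N x y ∧ y ≠ D.t ∧ ¬ D.R x D.t y := by
  rw [I, Finset.mem_sdiff, D.mem_nb, Finset.mem_insert, D.mem_l2, not_or]

theorem card_I {x : ℕ} (hx : D.N D.t x) :
    (D.I x).card + (D.l2 D.t x).card + 1 = (D.nb x).card := by
  have hs : insert D.t (D.l2 x D.t) ⊆ D.nb x := by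
    intro a ha
    rw [Finset.mem_insert, D.mem_l2] at ha
    rcases ha with rfl | ha
    · exact D.mem_nb.2 (D.Nsymm hx)
    · exact D.mem_nb.2 (D.RN13 ha)
  have := Finset.card_sdiff_add_card_eq_card hs
  rw [card_ins, D.l2_comm] at this
  rw [I, D.l2_comm x]
  omega

theorem Sb_sub_I (x : ℕ) : D.Sb x ⊆ D.I x := by
  intro u hu
  have h := D.mem_Sb.1 hu
  rw [mem_I]
  exact ⟨D.mem_nb.1 (D.Sb_sub x hu), h.1.1, fun hr => h.1.2 (D.RN23 hr)⟩

theorem ST_sub_I (x : ℕ) : D.ST x ⊆ D.I x := by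
  intro v hv
  have h := D.mem_ST.1 hv
  rw [mem_I]
  exact ⟨D.Nsymm h.2.2.2.1, h.2.1, fun hr => h.2.2.2.2.2.1 (D.R13 hr)⟩

theorem L_one {x : ℕ} (hx : D.N D.t x) (h1 : (D.I x).card = 1) :
    D.Sb x = ∅ ∧ D.ST x = ∅ ∧ ∃ w, D.Susp x D.t w := by
  have hxt : x ≠ D.t := (D.Nne hx).symm
  obtain ⟨w, hw⟩ := D.susp_of hxt (D.Nsymm hx) (by
    have := card_I hx
    rw [D.l2_comm x]; omega)
  have hwI : w ∈ D.I x := mem_I.2 ⟨hw.2.2.1, hw.2.2.2.1.symm, hw.2.2.2.2.1⟩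
  have honly : ∀ y ∈ D.I x, y = w := fun y hy => Finset.card_le_one.mp h1.le y hy w hwI
  refine ⟨?_, ?_, w, hw⟩
  · rw [Finset.eq_empty_iff_forall_notMem]
    intro u hu
    have := honly u (Sb_sub_I x hu)
    subst this
    exact (D.mem_Sb.1 hu).1.2 hw.N
  · rw [Finset.eq_empty_iff_forall_notMem]
    intro v hv
    have := honly v (ST_sub_I x hv)
    subst this
    obtain ⟨h2, h3⟩ := D.mem_ST.1 hv
    have h4 := D.l2_A h3.2.1
    obtain ⟨c, hc⟩ := Finset.card_pos.1 (show 0 < (D.l2 v D.t).card by omega)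
    have hc := D.mem_l2.1 hc
    have hct : c ≠ D.t := (D.Rne hc).2.2.symm
    have h5 := h3.P hc hct
    have h6 := h3.cc hc
    rcases hw.2.2.2.2.2 c (D.RN23 h6) with h | h | h
    · exact hct h
    · exact (D.Rne hc).2.1 h.symm
    · exact h5 (D.R12 h)

theorem L_three {x : ℕ} (hx : D.N D.t x) (hs : (D.Sb x).card = 1) : 3 ≤ (D.I x).card := by
  classical
  have hxt : x ≠ D.t := (D.Nne hx).symm
  obtain ⟨u, hu⟩ := Finset.card_pos.1 (show 0 < (D.Sb x).card by omega)
  obtain ⟨ho, hd, w, hw⟩ := D.mem_Sb.1 hu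
  obtain ⟨g, hg1, hg2, hg3⟩ := D.B (D.Nsymm hx)
  have hgI : g ∈ D.I x := mem_I.2 ⟨hg1, (D.Nne hg2).symm, hg3⟩
  have huI := Sb_sub_I x hu
  have hug : u ≠ g := by rintro rfl; exact ho.2 hg2
  by_contra hlt
  have hI : D.I x = {u, g} := by
    refine (Finset.eq_of_subset_of_card_le ?_ ?_).symm
    · intro a ha
      simp only [Finset.mem_insert, Finset.mem_singleton] at ha
      rcases ha with rfl | rfl
      · exact huI
      · exact hgI
    · rw [Finset.card_pair hug]; omega
  have hcase : ∀ y, D.N x y → y = D.t ∨ D.R x D.t y ∨ y = u ∨ y = g := by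
    intro y hy
    by_cases h1 : y = D.t
    · exact Or.inl h1
    by_cases h2 : D.R x D.t y
    · exact Or.inr (Or.inl h2)
    have := mem_I.2 ⟨hy, h1, h2⟩
    rw [hI] at this
    simp only [Finset.mem_insert, Finset.mem_singleton] at this
    exact Or.inr (Or.inr this)
  have hwt : w ≠ D.t := by
    rintro rfl; exact ho.2 (D.Nsymm hw.2.2.1)
  have hwu : w ≠ u := (D.Nne hw.2.2.1).symm
  have hxw := hw.N
  obtain ⟨hdis, -, -⟩ := hw.big ho
  have hdis' : ∀ y, D.R x u y → ¬ D.R x w y := fun y h1 h2 =>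
    Finset.disjoint_left.mp hdis (Finset.mem_insert_of_mem (D.mem_l2.2 h1))
      (Finset.mem_insert_of_mem (D.mem_l2.2 h2))
  have hnuw : ¬ D.R x w u := fun h => hw.2.2.2.2.1 (D.rotr h)
  have hA := D.l2_A hxw
  have hng : ¬ D.R x u g := by
    intro hr
    have hwg : w ≠ g := by rintro rfl; exact hnuw (D.R23 hr)
    have hB : D.R x D.t w := by
      rcases hcase w hxw with h | h | h | h
      · exact absurd h hwt
      · exact h
      · exact absurd h hwu
      · exact absurd h hwg
    obtain ⟨p, q, -, -, -, hall⟩ := D.two_ex hB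
    have hsub : D.l2 x w ⊆ {D.t, p, q} := by
      intro y hy
      have hy := D.mem_l2.1 hy
      rcases hcase y (D.RN13 hy) with h | h | h | h
      · simp [h]
      · rcases hall y (D.T hxt hB hy h) with h | h <;> simp [h]
      · exact absurd (h ▸ hy) hnuw
      · exact absurd (h ▸ hy) (hdis' g hr)
    have := Finset.card_le_card hsub
    have := Finset.card_le_three (a := D.t) (b := p) (c := q)
    omega
  have hCB : ∀ c, D.R x u c → D.R x D.t c := by
    intro c hc
    rcases hcase c (D.RN13 hc) with h | h | h | h
    · exact absurd (D.Nsymm (h ▸ D.RN23 hc)) ho.2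
    · exact h
    · exact absurd h (D.Rne hc).2.2.symm
    · exact absurd (h ▸ hc) hng
  have hA' := D.l2_A (D.Nsymm hw.2.1)
  obtain ⟨c0, hc0⟩ := Finset.card_pos.1 (show 0 < (D.l2 x u).card by omega)
  have hc0 := D.mem_l2.1 hc0
  have hBC : ∀ c, D.R x D.t c → D.R x u c := by
    intro c hc
    refine D.c2 x D.t (D.R x u) ?_ c0 c (hCB c0 hc0) hc hc0
    intro a b hQ ha
    obtain ⟨p, q, hpq, hp, hq, -⟩ := D.two_ex ha
    have hp' := (D.QRs hp)
    have hq' := (D.QRs hq)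
    have h1 : D.Q x D.t a p := D.T hxt (hCB a ha) hp'.2.2.1 (hCB p hp'.2.1)
    have h2 : D.Q x D.t a q := D.T hxt (hCB a ha) hq'.2.2.1 (hCB q hq'.2.1)
    rcases D.two_only h1 h2 hpq hQ with rfl | rfl
    · exact hp'.2.1
    · exact hq'.2.1
  have hwg : w = g := by
    rcases hcase w hxw with h | h | h | h
    · exact absurd h hwt
    · exact absurd (D.R23 (hBC w h)) hnuw
    · exact absurd h hwu
    · exact h
  have hsub : D.l2 x w ⊆ {D.t} := by
    intro y hy
    have hy := D.mem_l2.1 hy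
    rcases hcase y (D.RN13 hy) with h | h | h | h
    · simp [h]
    · exact absurd hy (hdis' y (hBC y h))
    · exact absurd (h ▸ hy) hnuw
    · exact absurd (h.trans hwg.symm) (D.Rne hy).2.2.symm
  have := Finset.card_le_card hsub
  simp at this
  omega

theorem L_main {x : ℕ} (hx : D.N D.t x) (h2 : 2 ≤ (D.I x).card) :
    3 * (D.Sb x).card + 6 * (D.ST x).card + 12 ≤ 6 * (D.I x).card := by
  classical
  have hxt : x ≠ D.t := (D.Nne hx).symm
  have hdis : Disjoint (D.Sb x) (D.ST x) := by
    rw [Finset.disjoint_left]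
    intro a ha hb
    exact (D.mem_Sb.1 ha).1.2 (D.mem_ST.1 hb).1
  by_cases hST : D.ST x = ∅
  · rw [hST, Finset.card_empty]
    obtain ⟨g, hg1, hg2, hg3⟩ := D.B (D.Nsymm hx)
    have hgI : g ∈ D.I x := mem_I.2 ⟨hg1, (D.Nne hg2).symm, hg3⟩
    have hgS : g ∉ D.Sb x := fun h => (D.mem_Sb.1 h).1.2 hg2
    have h1 : (D.Sb x).card + 1 ≤ (D.I x).card := by
      rw [← Finset.card_insert_of_notMem hgS]
      exact Finset.card_le_card (Finset.insert_subset hgI (Sb_sub_I x))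
    by_cases hs : (D.Sb x).card = 1
    · have := L_three hx hs
      omega
    · omega
  · obtain ⟨v, hv⟩ := Finset.nonempty_iff_ne_empty.2 hST
    set O := (D.I x).filter (fun y => D.N D.t y ∧ y ∉ D.ST x) with hO
    have hO2 : 2 ≤ O.card := by
      refine D.Cl (x := x) (w := D.t) (p := v) (fun a => a ∈ D.ST x) O
        (mem_I.1 (ST_sub_I x hv)).1 hv ?_ (D.Nsymm hx) ?_ ?_
      · intro a b ha hr
        have hs := (D.mem_ST.1 ha).2
        have hab : D.R a D.t b := hs.symm.cc (D.R12 hr)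
        have hbt : b ≠ D.t := (D.Rne hab).2.2.symm
        by_cases hb : b ∈ D.ST x
        · exact Or.inl hb
        · right
          rw [hO, Finset.mem_filter, mem_I]
          exact ⟨⟨D.RN13 hr, hbt, fun h => hs.P hab hbt (D.R12 h)⟩, D.RN23 hab, hb⟩
      · intro h; exact (D.mem_ST.1 h).2.1 rfl
      · intro h; rw [hO, Finset.mem_filter, mem_I] at h; exact h.1.2.1 rfl
    have hsub : (D.Sb x ∪ D.ST x) ∪ O ⊆ D.I x :=
      Finset.union_subset (Finset.union_subset (Sb_sub_I x) (ST_sub_I x)) (Finset.filter_subset _ _)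
    have := Finset.card_le_card hsub
    rw [Finset.card_union_of_disjoint, Finset.card_union_of_disjoint hdis] at this
    · omega
    · rw [Finset.disjoint_left]
      intro a ha hb
      rw [hO, Finset.mem_filter] at hb
      rcases Finset.mem_union.1 ha with h | h
      · exact (D.mem_Sb.1 h).1.2 hb.2.1
      · exact hb.2.2 h

variable (D)

open scoped Classical in
/-- amount (in sixths) sent from `u` to `x` -/
noncomputable def share (u x : ℕ) : ℤ :=
  (if D.IsSb x u ∧ (D.nb u).card = 6 then 2 else 0) +
  (if D.IsSb x u ∧ (D.nb u).card = 7 then 3 else 0) +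
  (if D.N D.t u ∧ D.Susp u D.t x then 6 else 0)

open scoped Classical in
/-- charge of a vertex -/
noncomputable def ch (x : ℕ) : ℤ :=
  if D.N D.t x then ((D.nb x).card : ℤ) - 1 - (D.l2 D.t x).card - 2 else ((D.nb x).card : ℤ) - 8

theorem share_nonneg (u x : ℕ) : 0 ≤ D.share u x := by
  unfold share
  split_ifs <;> simp

theorem recv (x : ℕ) (hx : x ∈ D.V.erase D.t) :
    ∑ u ∈ D.V.erase D.t, D.share u x ≤ 6 * D.ch x + ∑ y ∈ D.V.erase D.t, D.share x y := by
  classical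
  obtain ⟨hxt, hxV⟩ := Finset.mem_erase.1 hx
  set s6 := (D.V.erase D.t).filter (fun u => D.IsSb x u ∧ (D.nb u).card = 6) with hs6
  set s7 := (D.V.erase D.t).filter (fun u => D.IsSb x u ∧ (D.nb u).card = 7) with hs7
  have hsum : ∑ u ∈ D.V.erase D.t, D.share u x = 2 * (s6.card : ℤ) + 3 * s7.card
      + 6 * (D.ST x).card := by
    have hST : D.ST x = (D.V.erase D.t).filter (fun v => D.N D.t v ∧ D.Susp v D.t x) := by
      ext v
      rw [D.mem_ST, Finset.mem_filter, Finset.mem_erase]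
      exact ⟨fun h => ⟨⟨h.2.1, D.Nmem h.1⟩, h⟩, fun h => h.2⟩
    unfold share
    rw [Finset.sum_add_distrib, Finset.sum_add_distrib, ← Finset.sum_filter, ← Finset.sum_filter,
      ← Finset.sum_filter, Finset.sum_const, Finset.sum_const, Finset.sum_const, hST, hs6, hs7]
    simp only [nsmul_eq_mul]
    ring
  have hmem : ∀ u, D.IsSb x u → u ∈ D.V.erase D.t := by
    intro u h
    obtain ⟨w, hw⟩ := h.2.2
    exact Finset.mem_erase.2 ⟨h.1.1, D.Nmem (D.Nsymm hw.2.1)⟩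
  have h6 : ∀ u, u ∈ s6 ↔ D.IsSb x u ∧ (D.nb u).card = 6 := by
    intro u; rw [hs6, Finset.mem_filter]; exact ⟨fun h => h.2, fun h => ⟨hmem u h.1, h⟩⟩
  have h7 : ∀ u, u ∈ s7 ↔ D.IsSb x u ∧ (D.nb u).card = 7 := by
    intro u; rw [hs7, Finset.mem_filter]; exact ⟨fun h => h.2, fun h => ⟨hmem u h.1, h⟩⟩
  have hle : s6.card + s7.card ≤ (D.Sb x).card := by
    rw [← Finset.card_union_of_disjoint]
    · apply Finset.card_le_card
      intro a ha
      rw [D.mem_Sb]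
      rcases Finset.mem_union.1 ha with h | h
      · exact ((h6 a).1 h).1
      · exact ((h7 a).1 h).1
    · rw [Finset.disjoint_left]; intro a ha hb
      have := (h6 a).1 ha; have := (h7 a).1 hb; omega
  have hsent : 0 ≤ ∑ y ∈ D.V.erase D.t, D.share x y := Finset.sum_nonneg fun y _ => D.share_nonneg x y
  rw [hsum]
  by_cases hN : D.N D.t x
  · have hch : D.ch x = (D.I x).card - 2 := by
      have := card_I hN
      rw [ch, if_pos hN]; omega
    rw [hch]
    obtain ⟨g, hg1, hg2, hg3⟩ := D.B (D.Nsymm hN)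
    have hgI : g ∈ D.I x := mem_I.2 ⟨hg1, (D.Nne hg2).symm, hg3⟩
    have hpos : 0 < (D.I x).card := Finset.card_pos.2 ⟨g, hgI⟩
    by_cases h1 : (D.I x).card = 1
    · obtain ⟨e1, e2, w, hw⟩ := L_one hN h1
      have hwm : w ∈ D.V.erase D.t := Finset.mem_erase.2 ⟨hw.2.2.2.1.symm, D.Nmem hw.2.2.1⟩
      have h6s : 6 ≤ D.share x w := by
        unfold share
        rw [if_pos (show D.N D.t x ∧ D.Susp x D.t w from ⟨hN, hw⟩)]
        split_ifs <;> simp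
      have := Finset.single_le_sum (fun y _ => D.share_nonneg x y) hwm
      rw [e1, Finset.card_empty] at hle
      rw [e2, Finset.card_empty, h1]
      push_cast
      omega
    · have := L_main hN (by omega)
      omega
  · have hO : D.Out x := ⟨hxt, hN⟩
    have hST : D.ST x = ∅ := by
      rw [Finset.eq_empty_iff_forall_notMem]
      intro v hv
      exact hN (D.mem_ST.1 hv).2.N
    have hch : D.ch x = (D.nb x).card - 8 := by rw [ch, if_neg hN]
    rw [hch, hST, Finset.card_empty]
    by_cases h8 : 8 ≤ (D.nb x).card
    · have := out_big hO h8 s6 s7 h6 h7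
      omega
    · have hSb : D.Sb x = ∅ := by
        rw [Finset.eq_empty_iff_forall_notMem]
        intro u hu
        obtain ⟨ho, -, w, hw⟩ := D.mem_Sb.1 hu
        have := hw.big_card ho
        have := D.six_le (D.Nmem (D.Nsymm hw.2.1))
        omega
      rw [hSb, Finset.card_empty] at hle
      have h6' := D.six_le hxV
      have hnbs : D.nb x ⊆ D.V.erase D.t := by
        intro y hy
        have hy := D.mem_nb.1 hy
        refine Finset.mem_erase.2 ⟨?_, D.Nmem hy⟩
        rintro rfl
        exact hN (D.Nsymm hy)
      by_cases hx6 : (D.nb x).card = 6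
      · have h12 : ∑ y ∈ D.nb x, (2 : ℤ) ≤ ∑ y ∈ D.nb x, D.share x y := by
          apply Finset.sum_le_sum
          intro y hy
          have hs : D.IsSb y x ∧ (D.nb x).card = 6 :=
            ⟨⟨hO, by omega, out_six hO hx6 (D.mem_nb.1 hy)⟩, hx6⟩
          unfold share
          rw [if_pos hs]
          split_ifs <;> simp
        rw [Finset.sum_const, hx6] at h12
        have := Finset.sum_le_sum_of_subset_of_nonneg hnbs (fun y _ _ => D.share_nonneg x y)
        simp only [nsmul_eq_mul] at h12
        omega
      · have hx7 : (D.nb x).card = 7 := by omega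
        obtain ⟨a, b, hab⟩ := out_seven hO hx7
        have hsh : ∀ p q, D.Susp x p q → 3 ≤ D.share x p := by
          intro p q hpq
          have hs : D.IsSb p x ∧ (D.nb x).card = 7 := ⟨⟨hO, by omega, q, hpq⟩, hx7⟩
          unfold share
          rw [if_pos hs]
          split_ifs <;> simp
        have h1 := hsh a b hab
        have h2 := hsh b a hab.symm
        have hsub : {a, b} ⊆ D.V.erase D.t := by
          refine Finset.Subset.trans ?_ hnbs
          intro y hy
          simp only [Finset.mem_insert, Finset.mem_singleton] at hy
          rcases hy with rfl | rfl
          · exact D.mem_nb.2 hab.2.1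
          · exact D.mem_nb.2 hab.2.2.1
        have := Finset.sum_le_sum_of_subset_of_nonneg hsub (fun y _ _ => D.share_nonneg x y)
        rw [Finset.sum_pair hab.2.2.2.1] at this
        omega

theorem main : 0 ≤ ∑ x ∈ D.V.erase D.t, D.ch x := by
  have h := Finset.sum_le_sum D.recv
  rw [Finset.sum_add_distrib, Finset.sum_comm, ← Finset.mul_sum] at h
  omega

end DisData

namespace SComplex

variable {K : SComplex}

/-- closed-set form of connectedness of the link of `s` (also for `s = ∅`) -/
def LC (K : SComplex) (s : Finset ℕ) : Prop :=
  ∀ S : ℕ → Prop, (∀ a b, a ∉ s → b ∉ s → insert a (insert b s) ∈ K.faces → S a → S b) →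
    ∀ a b, a ∉ s → b ∉ s → insert a s ∈ K.faces → insert b s ∈ K.faces → S a → S b

/-- convenient reformulation of being a normal 3-pseudomanifold -/
structure Nrm (K : SComplex) : Prop where
  ne : K.faces.Nonempty
  ext : ∀ s ∈ K.faces, ∃ F ∈ K.faces, s ⊆ F ∧ F.card = 4
  le : ∀ s ∈ K.faces, s.card ≤ 4
  two : ∀ s ∈ K.faces, s.card = 3 →
    ∃ a b, a ≠ b ∧ ∀ y, (y ∉ s ∧ insert y s ∈ K.faces) ↔ y = a ∨ y = b
  lc : ∀ s : Finset ℕ, s.card ≤ 2 → (s = ∅ ∨ s ∈ K.faces) → LC K s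

theorem down {s r : Finset ℕ} (hs : s ∈ K.faces) (hr : r ⊆ s) (hne : r.Nonempty) :
    r ∈ K.faces := K.down_closed s hs r hr hne.ne_empty

theorem face_ne {s : Finset ℕ} (hs : s ∈ K.faces) : s.Nonempty := by
  rw [Finset.nonempty_iff_ne_empty]
  rintro rfl
  exact K.not_empty_mem hs

theorem exists_facet {s : Finset ℕ} (hs : s ∈ K.faces) : ∃ F, K.IsFacet F ∧ s ⊆ F := by
  obtain ⟨F, hF, hm⟩ := K.faces.exists_le_maximal hs
  exact ⟨F, ⟨hm.1, fun t ht hle => le_antisymm hle (hm.2 ht hle)⟩, hF⟩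

theorem facet_le_of {K : SComplex} (hp : ∀ s, K.IsFacet s → s.card = 4) {s : Finset ℕ}
    (hs : s ∈ K.faces) : s.card ≤ 4 := by
  obtain ⟨F, hF, hsF⟩ := exists_facet hs
  rw [← hp F hF]; exact Finset.card_le_card hsF

theorem mem_lk {s r : Finset ℕ} : r ∈ (K.lk s).faces ↔ r ∈ K.faces ∧ r ∩ s = ∅ ∧ r ∪ s ∈ K.faces := by
  simp [lk]

theorem mem_lk' {s r : Finset ℕ} :
    r ∈ (K.lk s).faces ↔ r.Nonempty ∧ Disjoint r s ∧ r ∪ s ∈ K.faces := by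
  rw [mem_lk, Finset.disjoint_iff_inter_eq_empty]
  constructor
  · rintro ⟨h1, h2, h3⟩; exact ⟨face_ne h1, h2, h3⟩
  · rintro ⟨h1, h2, h3⟩; exact ⟨down h3 Finset.subset_union_left h1, h2, h3⟩

/-- two facets through a triangle, in terms of apices -/
theorem card_two_iff (K : SComplex) (s : Finset ℕ) (hs : s.card = 3) :
    (K.faces.filter fun F => F.card = 4 ∧ s ⊆ F).card = 2 ↔
    ∃ a b, a ≠ b ∧ ∀ y, (y ∉ s ∧ insert y s ∈ K.faces) ↔ y = a ∨ y = b := by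
  have key : ∀ F, (F ∈ K.faces.filter fun F => F.card = 4 ∧ s ⊆ F) ↔
      ∃ y, y ∉ s ∧ insert y s ∈ K.faces ∧ F = insert y s := by
    intro F
    rw [Finset.mem_filter]
    constructor
    · rintro ⟨hF, h4, hsF⟩
      have : (F \ s).card = 1 := by
        have := Finset.card_sdiff_add_card_eq_card hsF; omega
      obtain ⟨y, hy⟩ := Finset.card_eq_one.1 this
      have hF' : F = insert y s := by
        rw [← Finset.sdiff_union_of_subset hsF, hy]; rfl
      have hys : y ∉ s := by
        have : y ∈ F \ s := by rw [hy]; simp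
        exact (Finset.mem_sdiff.1 this).2
      exact ⟨y, hys, hF' ▸ hF, hF'⟩
    · rintro ⟨y, hy, hf, rfl⟩
      exact ⟨hf, by rw [Finset.card_insert_of_notMem hy, hs], Finset.subset_insert _ _⟩
  have inj : ∀ {a b}, a ∉ s → b ∉ s → insert a s = insert b s → a = b := by
    intro a b ha hb h
    have : a ∈ insert b s := h ▸ Finset.mem_insert_self a s
    exact (Finset.mem_insert.1 this).resolve_right ha
  constructor
  · intro h
    obtain ⟨F, G, hFG, he⟩ := Finset.card_eq_two.1 h
    have hF := (key F).1 (he ▸ by simp)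
    have hG := (key G).1 (he ▸ by simp)
    obtain ⟨a, ha, haf, rfl⟩ := hF
    obtain ⟨b, hb, hbf, rfl⟩ := hG
    refine ⟨a, b, fun h => hFG (h ▸ rfl), fun y => ⟨fun hy => ?_, ?_⟩⟩
    · have := (key (insert y s)).2 ⟨y, hy.1, hy.2, rfl⟩
      rw [he] at this
      simp only [Finset.mem_insert, Finset.mem_singleton] at this
      rcases this with h | h
      · exact Or.inl (inj hy.1 ha h)
      · exact Or.inr (inj hy.1 hb h)
    · rintro (rfl | rfl)
      · exact ⟨ha, haf⟩
      · exact ⟨hb, hbf⟩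
  · rintro ⟨a, b, hab, h⟩
    have ha := (h a).2 (Or.inl rfl)
    have hb := (h b).2 (Or.inr rfl)
    rw [Finset.card_eq_two]
    refine ⟨insert a s, insert b s, fun he => hab (inj ha.1 hb.1 he), ?_⟩
    ext F
    rw [key]
    simp only [Finset.mem_insert, Finset.mem_singleton]
    constructor
    · rintro ⟨y, hy, hf, rfl⟩
      rcases (h y).1 ⟨hy, hf⟩ with rfl | rfl
      · exact Or.inl rfl
      · exact Or.inr rfl
    · rintro (rfl | rfl)
      · exact ⟨a, ha.1, ha.2, rfl⟩
      · exact ⟨b, hb.1, hb.2, rfl⟩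

theorem IsNormalPseudomanifold.nrm (h : K.IsNormalPseudomanifold 3) : Nrm K := by
  obtain ⟨⟨hne, hp⟩, hsc, h2, hl⟩ := h
  have hp : ∀ s, K.IsFacet s → s.card = 4 := hp
  refine ⟨hne, ?_, fun s hs => facet_le_of hp hs, ?_, ?_⟩
  · intro s hs
    obtain ⟨F, hF, hsF⟩ := exists_facet hs
    exact ⟨F, hF.1, hsF, hp F hF⟩
  · intro s hs h3
    exact (card_two_iff K s h3).1 (h2 s hs h3)
  · intro s hs2 hs
    rcases hs with rfl | hs
    · intro S hS a b _ _ ha hb hSa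
      simp only [Finset.notMem_empty, not_false_eq_true, true_imp_iff] at hS
      obtain ⟨F, hF, haF⟩ := exists_facet ha
      obtain ⟨G, hG, hbG⟩ := exists_facet hb
      have haF : a ∈ F := haF (by simp)
      replace hbG : b ∈ G := hbG (by simp)
      have hall : ∀ {H : Finset ℕ}, K.IsFacet H → ∀ x ∈ H, S x → ∀ y ∈ H, S y := by
        intro H hH x hx hSx y hy
        refine hS x y (down hH.1 ?_ (by simp)) hSx
        intro z hz
        simp only [insert_empty_eq, Finset.mem_insert, Finset.mem_singleton] at hz
        rcases hz with rfl | rfl <;> assumption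
      have : ∀ y ∈ G, S y := by
        have hch := hsc F G hF hG
        clear hbG hG
        induction hch with
        | refl => exact hall hF a haF hSa
        | @tail H G' h1 h2 ih =>
          have hc : 0 < (H ∩ G').card := by
            have := h2.2.2; have := hp H h2.1; omega
          obtain ⟨x, hx⟩ := Finset.card_pos.1 hc
          obtain ⟨hx1, hx2⟩ := Finset.mem_inter.1 hx
          exact hall h2.2.1 x hx2 (ih x hx1)
      exact this b hbG
    · obtain ⟨hne, hcon⟩ := hl s hs hs2
      intro S hS a b ha hb haf hbf hSa
      have mk : ∀ x, x ∉ s → insert x s ∈ K.faces → {x} ∈ (K.lk s).faces := by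
        intro x hx hf
        rw [mem_lk']
        exact ⟨by simp, by simpa using hx, by simpa using hf⟩
      have := hcon a b (mk a ha haf) (mk b hb hbf)
      clear hbf hb
      induction this with
      | refl => exact hSa
      | @tail y z h1 h2 ih =>
        rw [VertAdj, mem_lk'] at h2
        obtain ⟨-, hd, hf⟩ := h2
        rw [Finset.disjoint_left] at hd
        refine hS y z (hd (by simp)) (hd (by simp)) ?_ ih
        convert hf using 1
        ext x; simp [or_assoc]

theorem Nrm.reach (h : Nrm K) (hfac : ∀ F ∈ K.faces, F.card = 4 → K.IsFacet F) :
    ∀ k s, s.card + k = 3 → (s = ∅ ∨ s ∈ K.faces) → ∀ F G, F ∈ K.faces → G ∈ K.faces →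
      F.card = 4 → G.card = 4 → s ⊆ F → s ⊆ G → Relation.ReflTransGen K.FacetAdj F G := by
  intro k
  induction k with
  | zero =>
    intro s hs _ F G hF hG hF4 hG4 hsF hsG
    by_cases hFG : F = G
    · rw [hFG]
    refine Relation.ReflTransGen.single ⟨hfac F hF hF4, hfac G hG hG4, ?_⟩
    have h1 : s ⊆ F ∩ G := Finset.subset_inter hsF hsG
    have h2 := Finset.card_le_card h1
    have h3 : (F ∩ G).card < 4 := by
      rw [← hF4]
      apply Finset.card_lt_card
      refine ⟨Finset.inter_subset_left, fun hh => hFG ?_⟩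
      have : F ⊆ G := hh.trans Finset.inter_subset_right
      exact Finset.eq_of_subset_of_card_le this (by omega)
    omega
  | succ k ih =>
    intro s hs hsf F G hF hG hF4 hG4 hsF hsG
    have pick : ∀ F : Finset ℕ, F.card = 4 → s ⊆ F → ∃ a ∈ F, a ∉ s := by
      intro F hF4 hsF
      by_contra hcon
      push Not at hcon
      have := Finset.card_le_card (show F ⊆ s from hcon)
      omega
    obtain ⟨a, haF, has⟩ := pick F hF4 hsF
    obtain ⟨b, hbG, hbs⟩ := pick G hG4 hsG
    have hsub : ∀ {a : ℕ} {F : Finset ℕ}, a ∈ F → s ⊆ F → insert a s ⊆ F :=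
      fun h1 h2 => Finset.insert_subset h1 h2
    have hfa : insert a s ∈ K.faces := down hF (hsub haF hsF) (by simp)
    have hfb : insert b s ∈ K.faces := down hG (hsub hbG hsG) (by simp)
    refine h.lc s (by omega) hsf (fun y => ∀ H ∈ K.faces, H.card = 4 → insert y s ⊆ H →
      Relation.ReflTransGen K.FacetAdj F H) ?_ a b has hbs hfa hfb ?_ G hG hG4 (hsub hbG hsG)
    · intro x y hx hy hxy hS H hH hH4 hyH
      obtain ⟨E, hE, hsE, hE4⟩ := h.ext _ hxy
      have h1 := hS E hE hE4 ((by
        intro z hz; simp only [Finset.mem_insert] at hz ⊢; tauto : insert x s ⊆ insert x (insert y s)).trans hsE)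
      refine h1.trans (ih (insert y s) ?_ (Or.inr (down hH hyH (by simp))) E H hE hH hE4 hH4 ?_ hyH)
      · rw [Finset.card_insert_of_notMem hy]; omega
      · exact (Finset.subset_insert _ _).trans hsE
    · intro H hH hH4 haH
      refine ih (insert a s) ?_ (Or.inr hfa) F H hF hH hF4 hH4 (hsub haF hsF) haH
      rw [Finset.card_insert_of_notMem has]; omega

theorem Nrm.normal (h : Nrm K) : K.IsNormalPseudomanifold 3 := by
  have hfac : ∀ F ∈ K.faces, F.card = 4 → K.IsFacet F := by
    intro F hF h4
    refine ⟨hF, fun t ht hs => Finset.eq_of_subset_of_card_le hs ?_⟩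
    have := h.le t ht; omega
  have hcard : ∀ s, K.IsFacet s → s.card = 4 := by
    intro s hs
    obtain ⟨F, hF, hsF, h4⟩ := h.ext s hs.1
    rw [hs.2 F hF hsF, h4]
  refine ⟨⟨h.ne, hcard⟩, ?_, ?_, ?_⟩
  · intro F G hF hG
    exact h.reach hfac 3 ∅ rfl (Or.inl rfl) F G hF.1 hG.1 (hcard F hF) (hcard G hG)
      (Finset.empty_subset _) (Finset.empty_subset _)
  · intro s hs h3
    exact (card_two_iff K s h3).2 (h.two s hs h3)
  · intro s hs h2
    have h2 : s.card ≤ 2 := h2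
    constructor
    · obtain ⟨F, hF, hsF, h4⟩ := h.ext s hs
      refine ⟨F \ s, mem_lk'.2 ⟨?_, Finset.sdiff_disjoint, ?_⟩⟩
      · rw [← Finset.card_pos, Finset.card_sdiff_of_subset hsF]; omega
      · rwa [Finset.sdiff_union_of_subset hsF]
    · intro u v hu hv
      have mk : ∀ x, {x} ∈ (K.lk s).faces → x ∉ s ∧ insert x s ∈ K.faces := by
        intro x hx
        rw [mem_lk'] at hx
        exact ⟨by simpa using hx.2.1, by simpa using hx.2.2⟩
      obtain ⟨hu1, hu2⟩ := mk u hu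
      obtain ⟨hv1, hv2⟩ := mk v hv
      refine h.lc s h2 (Or.inr hs) (fun y => Relation.ReflTransGen (K.lk s).VertAdj u y) ?_ u v
        hu1 hv1 hu2 hv2 Relation.ReflTransGen.refl
      intro a b ha hb hab hr
      refine hr.tail ?_
      rw [VertAdj, mem_lk']
      refine ⟨by simp, ?_, ?_⟩
      · rw [Finset.disjoint_left]
        intro x hx
        simp only [Finset.mem_insert, Finset.mem_singleton] at hx
        rcases hx with rfl | rfl <;> assumption
      · convert hab using 1
        ext x; simp [or_assoc]

/-- build a complex from a predicate -/
def ofPred (V : Finset ℕ) (P : Finset ℕ → Prop) [DecidablePred P] (h0 : ¬ P ∅)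
    (hd : ∀ s, P s → ∀ r ⊆ s, r ≠ ∅ → P r) : SComplex where
  faces := V.powerset.filter P
  not_empty_mem := fun h => h0 (Finset.mem_filter.1 h).2
  down_closed := by
    intro s hs t hts ht
    rw [Finset.mem_filter, Finset.mem_powerset] at hs ⊢
    exact ⟨hts.trans hs.1, hd s hs.2 t hts ht⟩

theorem mem_ofPred {V : Finset ℕ} {P : Finset ℕ → Prop} [DecidablePred P] {h0 : ¬ P ∅}
    {hd : ∀ s, P s → ∀ r ⊆ s, r ≠ ∅ → P r} (hV : ∀ s, P s → s ⊆ V) (s : Finset ℕ) :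
    s ∈ (ofPred V P h0 hd).faces ↔ P s := by
  simp only [ofPred, Finset.mem_filter, Finset.mem_powerset]
  exact ⟨fun h => h.2, fun h => ⟨hV s h, h⟩⟩

theorem mem_vertexSet {x : ℕ} : x ∈ K.vertexSet ↔ {x} ∈ K.faces := by
  rw [vertexSet, Finset.mem_sup]
  constructor
  · rintro ⟨s, hs, hx⟩
    exact down hs (by simpa using hx) (by simp)
  · intro h
    exact ⟨_, h, by simp⟩

theorem sub_vertexSet {s : Finset ℕ} (hs : s ∈ K.faces) : s ⊆ K.vertexSet := by
  intro x hx
  exact mem_vertexSet.2 (down hs (by simpa using hx) (by simp))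

end SComplex

namespace SComplex

/-- Data for splitting a vertex `w` along a 3-cycle `A` of its link. -/
structure Spl (K : SComplex) where
  hK : Nrm K
  w : ℕ
  A : Finset ℕ
  f : Finset ℕ → Bool
  pv : Bool → ℕ
  hw : {w} ∈ K.faces
  hA3 : A.card = 3
  hwA : w ∉ A
  hA : ∀ e ⊆ A, e.card = 2 → insert w e ∈ K.faces
  hAn : A ∉ K.faces
  flip : ∀ (e : Finset ℕ) (y z : ℕ), e.card = 2 → w ∉ e → y ∉ e → z ∉ e → y ≠ w → z ≠ w → y ≠ z →
    insert w (insert y e) ∈ K.faces → insert w (insert z e) ∈ K.faces →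
    (e ⊆ A → f (insert y e) = ! f (insert z e)) ∧ (¬ e ⊆ A → f (insert y e) = f (insert z e))
  fresh : ∀ β, {pv β} ∉ K.faces
  pvne : pv true ≠ pv false

namespace Spl

variable {K : SComplex} (X : Spl K)

/-- triangles of the link of `w` -/
def Tri (T : Finset ℕ) : Prop := T.card = 3 ∧ X.w ∉ T ∧ insert X.w T ∈ K.faces

theorem pv_notMem {s : Finset ℕ} (hs : s ∈ K.faces) (β : Bool) : X.pv β ∉ s :=
  fun h => X.fresh β (down hs (by simpa using h) (by simp))

theorem A_face {σ : Finset ℕ} (h : σ ⊆ X.A) (hne : σ ≠ X.A) : insert X.w σ ∈ K.faces := by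
  have hlt : σ.card < 3 := by
    rw [← X.hA3]; exact Finset.card_lt_card (h.ssubset_of_ne hne)
  obtain ⟨e, he1, he2, he3⟩ := Finset.exists_subsuperset_card_eq h (n := 2) (by omega)
    (by rw [X.hA3]; omega)
  exact down (X.hA e he2 he3) (Finset.insert_subset_insert _ he1) (by simp)

theorem A_vert {x : ℕ} (h : x ∈ X.A) : {x} ∈ K.faces := by
  have := X.A_face (σ := {x}) (by simpa using h) (by
    intro h; have := X.hA3; rw [← h] at this; simp at this)
  exact down this (by simp) (by simp)

theorem pv_notMem_A (β : Bool) : X.pv β ∉ X.A := fun h => X.fresh β (X.A_vert h)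

theorem pv_ne_w (β : Bool) : X.pv β ≠ X.w := fun h => X.fresh β (h ▸ X.hw)

theorem pv_inj {β γ : Bool} (h : X.pv β = X.pv γ) : β = γ := by
  have := X.pvne
  cases β <;> cases γ <;> simp_all

theorem tri_ext {τ : Finset ℕ} (h1 : X.w ∉ τ) (h2 : insert X.w τ ∈ K.faces) :
    ∃ T, X.Tri T ∧ τ ⊆ T := by
  obtain ⟨F, hF, hs, h4⟩ := X.hK.ext _ h2
  have hwF : X.w ∈ F := hs (by simp)
  refine ⟨F.erase X.w, ⟨?_, by simp, ?_⟩, ?_⟩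
  · rw [Finset.card_erase_of_mem hwF, h4]
  · rwa [Finset.insert_erase hwF]
  · intro x hx
    rw [Finset.mem_erase]
    exact ⟨fun h => h1 (h ▸ hx), hs (by simp [hx])⟩

theorem split_insert {ρ T : Finset ℕ} (h : ρ ⊆ T) (hc : T.card = ρ.card + 1) :
    ∃ y, y ∉ ρ ∧ T = insert y ρ := by
  have : (T \ ρ).card = 1 := by
    have := Finset.card_sdiff_add_card_eq_card h; omega
  obtain ⟨y, hy⟩ := Finset.card_eq_one.1 this
  refine ⟨y, ?_, ?_⟩
  · have : y ∈ T \ ρ := by rw [hy]; simp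
    exact (Finset.mem_sdiff.1 this).2
  · rw [← Finset.sdiff_union_of_subset h, hy]; rfl

theorem factE2 {ρ T T' : Finset ℕ} (hρ : ¬ ρ ⊆ X.A) (h2 : ρ.card = 2) (hT : X.Tri T) (hT' : X.Tri T')
    (h : ρ ⊆ T) (h' : ρ ⊆ T') : X.f T = X.f T' := by
  obtain ⟨y, hy, rfl⟩ := split_insert h (by rw [hT.1, h2])
  obtain ⟨z, hz, rfl⟩ := split_insert h' (by rw [hT'.1, h2])
  by_cases hyz : y = z
  · rw [hyz]
  have h1 := hT.2.1
  have h1' := hT'.2.1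
  rw [Finset.mem_insert, not_or] at h1 h1'
  exact (X.flip ρ y z h2 h1.2 hy hz (Ne.symm h1.1) (Ne.symm h1'.1) hyz hT.2.2 hT'.2.2).2 hρ

theorem factE {ρ T T' : Finset ℕ} (hρ : ¬ ρ ⊆ X.A) (hT : X.Tri T) (hT' : X.Tri T')
    (h : ρ ⊆ T) (h' : ρ ⊆ T') : X.f T = X.f T' := by
  have hle := Finset.card_le_card h
  rw [hT.1] at hle
  have hcases : ρ.card = 0 ∨ ρ.card = 1 ∨ ρ.card = 2 ∨ ρ.card = 3 := by omega
  rcases hcases with h0 | h0 | h0 | h0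
  · rw [Finset.card_eq_zero] at h0
    exact absurd (h0 ▸ Finset.empty_subset _) hρ
  · obtain ⟨x, rfl⟩ := Finset.card_eq_one.1 h0
    have hxA : x ∉ X.A := by simpa using hρ
    have hxT : x ∈ T := by simpa using h
    have hxT' : x ∈ T' := by simpa using h'
    have hxw : x ≠ X.w := fun e => hT.2.1 (e ▸ hxT)
    have hwx : ({X.w, x} : Finset ℕ) ∈ K.faces :=
      down hT.2.2 (Finset.insert_subset_insert _ h) (by simp)
    have pick : ∀ T, X.Tri T → x ∈ T → ∃ y ∈ T, y ≠ x := by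
      intro T hT hx
      obtain ⟨y, hy, hne⟩ := Finset.exists_mem_ne (s := T) (by rw [hT.1]; omega) x
      exact ⟨y, hy, hne⟩
    obtain ⟨y, hy, hyx⟩ := pick T hT hxT
    obtain ⟨z, hz, hzx⟩ := pick T' hT' hxT'
    have nw : ∀ {T y}, X.Tri T → y ∈ T → y ≠ X.w := fun hT hy e => hT.2.1 (e ▸ hy)
    have mk : ∀ {T y}, X.Tri T → y ∈ T → x ∈ T → insert y ({X.w, x} : Finset ℕ) ∈ K.faces := by
      intro T y hT hy hx
      refine down hT.2.2 ?_ (by simp)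
      intro a ha
      simp only [Finset.mem_insert, Finset.mem_singleton] at ha ⊢
      rcases ha with rfl | rfl | rfl <;> simp [*]
    have := X.hK.lc {X.w, x} (Finset.card_le_two) (Or.inr hwx)
      (fun y => ∀ T'', X.Tri T'' → x ∈ T'' → y ∈ T'' → X.f T = X.f T'') (by
        intro p q hp hq hpq hS T'' hT'' hxT'' hqT''
        by_cases hpq' : p = q
        · subst hpq'; exact hS T'' hT'' hxT'' hqT''
        simp only [Finset.mem_insert, Finset.mem_singleton, not_or] at hp hq
        have hT1 : X.Tri {x, p, q} := by
          refine ⟨Finset.card_eq_three.2 ⟨x, p, q, Ne.symm hp.2, Ne.symm hq.2, hpq', rfl⟩, ?_, ?_⟩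
          · simp only [Finset.mem_insert, Finset.mem_singleton, not_or]
            exact ⟨hxw.symm, Ne.symm hp.1, Ne.symm hq.1⟩
          · convert hpq using 1
            ext a; simp only [Finset.mem_insert, Finset.mem_singleton]; tauto
        rw [hS _ hT1 (by simp) (by simp)]
        refine X.factE2 (ρ := {x, q}) ?_ ?_ hT1 hT'' ?_ ?_
        · intro hh; exact hxA (hh (by simp))
        · exact Finset.card_pair (Ne.symm hq.2)
        · intro a ha; simp only [Finset.mem_insert, Finset.mem_singleton] at ha ⊢; tauto
        · intro a ha; simp only [Finset.mem_insert, Finset.mem_singleton] at ha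
          rcases ha with rfl | rfl <;> assumption) y z
        (by simp [nw hT hy, hyx]) (by simp [nw hT' hz, hzx]) (mk hT hy hxT) (mk hT' hz hxT') (by
          intro T'' hT'' hx hy''
          refine X.factE2 (ρ := {x, y}) ?_ ?_ hT hT'' ?_ ?_
          · intro hh; exact hxA (hh (by simp))
          · exact Finset.card_pair hyx.symm
          · intro a ha; simp only [Finset.mem_insert, Finset.mem_singleton] at ha
            rcases ha with rfl | rfl <;> assumption
          · intro a ha; simp only [Finset.mem_insert, Finset.mem_singleton] at ha
            rcases ha with rfl | rfl <;> assumption)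
    exact this T' hT' hxT' hz
  · exact X.factE2 hρ h0 hT hT' h h'
  · rw [← Finset.eq_of_subset_of_card_le h (by rw [hT.1, h0]),
      ← Finset.eq_of_subset_of_card_le h' (by rw [hT'.1, h0])]

/-- faces of the side of colour `β` -/
def D1 (β : Bool) (σ : Finset ℕ) : Prop := ∃ T, X.Tri T ∧ X.f T = β ∧ σ ⊆ T

/-- faces of the capped side of colour `β` -/
def D (β : Bool) (σ : Finset ℕ) : Prop := X.D1 β σ ∨ σ ⊆ X.A

variable {X}

theorem D1.mono {β : Bool} {σ τ : Finset ℕ} (h : X.D1 β τ) (hs : σ ⊆ τ) : X.D1 β σ := by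
  obtain ⟨T, h1, h2, h3⟩ := h
  exact ⟨T, h1, h2, hs.trans h3⟩

theorem D.mono {β : Bool} {σ τ : Finset ℕ} (h : X.D β τ) (hs : σ ⊆ τ) : X.D β σ := by
  rcases h with h | h
  · exact Or.inl (h.mono hs)
  · exact Or.inr (hs.trans h)

theorem D1.face {β : Bool} {σ : Finset ℕ} (h : X.D1 β σ) : insert X.w σ ∈ K.faces := by
  obtain ⟨T, h1, h2, h3⟩ := h
  exact down h1.2.2 (Finset.insert_subset_insert _ h3) (by simp)

theorem D1.w_notMem {β : Bool} {σ : Finset ℕ} (h : X.D1 β σ) : X.w ∉ σ := by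
  obtain ⟨T, h1, h2, h3⟩ := h
  exact fun h => h1.2.1 (h3 h)

theorem D.w_notMem {β : Bool} {σ : Finset ℕ} (h : X.D β σ) : X.w ∉ σ := by
  rcases h with h | h
  · exact h.w_notMem
  · exact fun hh => X.hwA (h hh)

theorem D.face {β : Bool} {σ : Finset ℕ} (h : X.D β σ) (hne : σ ≠ X.A) : insert X.w σ ∈ K.faces := by
  rcases h with h | h
  · exact h.face
  · exact X.A_face h hne

theorem D.pv {β : Bool} {σ : Finset ℕ} (h : X.D β σ) (γ : Bool) : X.pv γ ∉ σ := by
  rcases h with h | h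
  · intro hh; exact X.pv_notMem h.face γ (Finset.mem_insert_of_mem hh)
  · intro hh; exact X.pv_notMem_A γ (h hh)

theorem Dex {τ : Finset ℕ} (h1 : X.w ∉ τ) (h2 : insert X.w τ ∈ K.faces) : ∃ β, X.D1 β τ := by
  obtain ⟨T, hT, h⟩ := X.tri_ext h1 h2
  exact ⟨X.f T, T, hT, rfl, h⟩

theorem D1.ext {β : Bool} {ρ τ : Finset ℕ} (h : X.D1 β ρ) (hρ : ¬ ρ ⊆ X.A) (hs : ρ ⊆ τ)
    (h1 : X.w ∉ τ) (h2 : insert X.w τ ∈ K.faces) : X.D1 β τ := by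
  obtain ⟨T, hT, hτ⟩ := X.tri_ext h1 h2
  obtain ⟨T', hT', hf, h'⟩ := h
  refine ⟨T, hT, ?_, hτ⟩
  rw [← hf]
  exact X.factE hρ hT hT' (hs.trans hτ) h'

theorem D.ext {β : Bool} {ρ τ : Finset ℕ} (h : X.D β ρ) (hρ : ¬ ρ ⊆ X.A) (hs : ρ ⊆ τ)
    (h1 : X.w ∉ τ) (h2 : insert X.w τ ∈ K.faces) : X.D β τ :=
  Or.inl ((h.resolve_right hρ).ext hρ hs h1 h2)

theorem D_uniq {β γ : Bool} {ρ : Finset ℕ} (h : X.D β ρ) (h' : X.D γ ρ) (hρ : ¬ ρ ⊆ X.A) : β = γ := by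
  obtain ⟨T, hT, hf, h⟩ := h.resolve_right hρ
  obtain ⟨T', hT', hf', h'⟩ := h'.resolve_right hρ
  rw [← hf, ← hf']
  exact X.factE hρ hT hT' h h'

/-- for an edge of `A`: the apices of each colour -/
theorem A_edge {e : Finset ℕ} (he : e ⊆ X.A) (h2 : e.card = 2) (β : Bool) :
    ∃ y, y ∉ e ∧ y ∉ X.A ∧ ∀ z, z ∉ e → (X.D1 β (insert z e) ↔ z = y) := by
  have hwe : X.w ∉ e := fun h => X.hwA (he h)
  obtain ⟨y, z, hyz, hall⟩ := X.hK.two (insert X.w e) (X.hA e he h2)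
    (by rw [Finset.card_insert_of_notMem hwe, h2])
  have hy := (hall y).2 (Or.inl rfl)
  have hz := (hall z).2 (Or.inr rfl)
  simp only [Finset.mem_insert, not_or] at hy hz
  have hyA : ∀ y, y ∉ e → insert y (insert X.w e) ∈ K.faces → y ∉ X.A := by
    intro y hye hf hyA
    have : insert y e = X.A := Finset.eq_of_subset_of_card_le (Finset.insert_subset hyA he)
      (by rw [Finset.card_insert_of_notMem hye, h2, X.hA3])
    refine X.hAn (this ▸ down hf ?_ (by simp))
    exact Finset.insert_subset_insert _ (Finset.subset_insert _ _)
  have htri : ∀ y, y ∉ e → y ≠ X.w → insert y (insert X.w e) ∈ K.faces → X.Tri (insert y e) := by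
    intro y hy1 hy2 hf
    refine ⟨by rw [Finset.card_insert_of_notMem hy1, h2], ?_, ?_⟩
    · simp only [Finset.mem_insert, not_or]; exact ⟨hy2.symm, hwe⟩
    · rwa [Finset.insert_comm]
  have hflip := (X.flip e y z h2 hwe hy.1.2 hz.1.2 hy.1.1 hz.1.1 hyz
    (by rw [Finset.insert_comm]; exact hy.2) (by rw [Finset.insert_comm]; exact hz.2)).1 he
  have hD : ∀ x, x ∉ e → (X.D1 β (insert x e) ↔ (x = y ∨ x = z) ∧ X.f (insert x e) = β) := by
    intro x hx
    constructor
    · intro hd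
      have hfa := hd.face
      have hxw : x ≠ X.w := fun h => hd.w_notMem (h ▸ Finset.mem_insert_self _ _)
      refine ⟨(hall x).1 ⟨by simp [hxw, hx], by rwa [Finset.insert_comm]⟩, ?_⟩
      obtain ⟨T, hT, hf, hsub⟩ := hd
      rw [← hf, Finset.eq_of_subset_of_card_le hsub
        (by rw [Finset.card_insert_of_notMem hx, h2, hT.1])]
    · rintro ⟨rfl | rfl, hf⟩
      · exact ⟨_, htri x hy.1.2 hy.1.1 hy.2, hf, subset_rfl⟩
      · exact ⟨_, htri x hz.1.2 hz.1.1 hz.2, hf, subset_rfl⟩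
  by_cases hfy : X.f (insert y e) = β
  · refine ⟨y, hy.1.2, hyA y hy.1.2 hy.2, fun x hx => ?_⟩
    rw [hD x hx]
    constructor
    · rintro ⟨rfl | rfl, hf⟩
      · rfl
      · exfalso; rw [hfy, hf] at hflip; cases β <;> simp at hflip
    · rintro rfl; exact ⟨Or.inl rfl, hfy⟩
  · refine ⟨z, hz.1.2, hyA z hz.1.2 hz.2, fun x hx => ?_⟩
    rw [hD x hx]
    constructor
    · rintro ⟨rfl | rfl, hf⟩
      · exact absurd hf hfy
      · rfl
    · rintro rfl
      refine ⟨Or.inr rfl, ?_⟩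
      exact (by decide : ∀ p q β : Bool, p = !q → ¬ p = β → q = β) _ _ _ hflip hfy

end Spl
end SComplex

namespace SComplex
namespace Spl

variable {K : SComplex} (X : Spl K)

/-- faces of the new complex -/
def P' (s : Finset ℕ) : Prop := s ≠ ∅ ∧
  (((∀ β, X.pv β ∉ s) ∧ ((s ∈ K.faces ∧ X.w ∉ s) ∨ s ⊆ X.A)) ∨
    ∃ β, X.pv β ∈ s ∧ X.D β (s.erase (X.pv β)))

theorem P'_down : ∀ s, X.P' s → ∀ r ⊆ s, r ≠ ∅ → X.P' r := by
  rintro s ⟨-, hs⟩ r hr hne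
  refine ⟨hne, ?_⟩
  rcases hs with ⟨h1, h2⟩ | ⟨β, h1, h2⟩
  · left
    refine ⟨fun β h => h1 β (hr h), ?_⟩
    rcases h2 with h2 | h2
    · exact Or.inl ⟨K.down_closed s h2.1 r hr hne, fun h => h2.2 (hr h)⟩
    · exact Or.inr (hr.trans h2)
  · by_cases hb : X.pv β ∈ r
    · exact Or.inr ⟨β, hb, h2.mono (Finset.erase_subset_erase _ hr)⟩
    · left
      have hsub : r ⊆ s.erase (X.pv β) := by
        intro x hx
        rw [Finset.mem_erase]
        exact ⟨fun h => hb (h ▸ hx), hr hx⟩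
      have hD := h2.mono hsub
      refine ⟨fun γ => hD.pv γ, ?_⟩
      by_cases hA : r ⊆ X.A
      · exact Or.inr hA
      · refine Or.inl ⟨?_, hD.w_notMem⟩
        exact down (hD.face (fun h => hA h.subset)) (Finset.subset_insert _ _)
          (Finset.nonempty_iff_ne_empty.2 hne)

open scoped Classical in
/-- the complex after splitting and flipping -/
noncomputable def K' : SComplex :=
  ofPred (K.vertexSet ∪ {X.pv true, X.pv false}) X.P' (fun h => h.1 rfl) X.P'_down

theorem D_sub {β : Bool} {σ : Finset ℕ} (h : X.D β σ) : σ ⊆ K.vertexSet := by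
  rcases h with h | h
  · exact (Finset.subset_insert _ _).trans (sub_vertexSet h.face)
  · intro x hx; exact mem_vertexSet.2 (X.A_vert (h hx))

theorem mem_K' (s : Finset ℕ) : s ∈ X.K'.faces ↔ X.P' s := by
  classical
  apply mem_ofPred
  rintro s ⟨-, hs⟩
  rcases hs with ⟨h1, h2⟩ | ⟨β, h1, h2⟩
  · refine Finset.Subset.trans ?_ Finset.subset_union_left
    rcases h2 with h2 | h2
    · exact sub_vertexSet h2.1
    · exact X.D_sub (β := true) (Or.inr h2)
  · rw [← Finset.insert_erase h1]
    apply Finset.insert_subset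
    · cases β <;> simp
    · exact (X.D_sub h2).trans Finset.subset_union_left

theorem mem0 {s : Finset ℕ} (h : ∀ β, X.pv β ∉ s) :
    s ∈ X.K'.faces ↔ s ≠ ∅ ∧ ((s ∈ K.faces ∧ X.w ∉ s) ∨ s ⊆ X.A) := by
  rw [mem_K', P']
  constructor
  · rintro ⟨h1, h2 | ⟨β, h2, -⟩⟩
    · exact ⟨h1, h2.2⟩
    · exact absurd h2 (h β)
  · rintro ⟨h1, h2⟩
    exact ⟨h1, Or.inl ⟨h, h2⟩⟩

theorem mem1 {σ : Finset ℕ} (h : ∀ β, X.pv β ∉ σ) (β : Bool) :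
    insert (X.pv β) σ ∈ X.K'.faces ↔ X.D β σ := by
  rw [mem_K', P']
  constructor
  · rintro ⟨h1, h2 | ⟨γ, h2, h3⟩⟩
    · exact absurd (Finset.mem_insert_self _ _) (h2.1 β)
    · have : γ = β := by
        rcases Finset.mem_insert.1 h2 with h4 | h4
        · exact X.pv_inj h4
        · exact absurd h4 (h γ)
      subst this
      rwa [Finset.erase_insert (h γ)] at h3
  · intro hD
    refine ⟨by simp, Or.inr ⟨β, by simp, ?_⟩⟩
    rwa [Finset.erase_insert (h β)]

theorem cases' {s : Finset ℕ} (h : s ∈ X.K'.faces) :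
    (∀ β, X.pv β ∉ s) ∨ ∃ β σ, s = insert (X.pv β) σ ∧ (∀ γ, X.pv γ ∉ σ) ∧ X.D β σ := by
  rw [mem_K', P'] at h
  rcases h.2 with h2 | ⟨β, h2, h3⟩
  · exact Or.inl h2.1
  · exact Or.inr ⟨β, _, (Finset.insert_erase h2).symm, fun γ => h3.pv γ, h3⟩

theorem mk1 {β : Bool} {σ : Finset ℕ} (h : X.D β σ) : insert (X.pv β) σ ∈ X.K'.faces :=
  (X.mem1 (fun γ => h.pv γ) β).2 h

theorem K'_le (s : Finset ℕ) (hs : s ∈ X.K'.faces) : s.card ≤ 4 := by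
  rcases X.cases' hs with h | ⟨β, σ, rfl, h, hD⟩
  · rw [X.mem0 h] at hs
    rcases hs.2 with h1 | h1
    · exact X.hK.le s h1.1
    · have := Finset.card_le_card h1; rw [X.hA3] at this; omega
  · rw [Finset.card_insert_of_notMem (h β)]
    rcases hD with ⟨T, hT, -, hs⟩ | hs
    · have := Finset.card_le_card hs; rw [hT.1] at this; omega
    · have := Finset.card_le_card hs; rw [X.hA3] at this; omega

theorem K'_ext (s : Finset ℕ) (hs : s ∈ X.K'.faces) : ∃ F ∈ X.K'.faces, s ⊆ F ∧ F.card = 4 := by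
  have hDc : ∀ {β σ}, X.D β σ → ∃ F ∈ X.K'.faces, insert (X.pv β) σ ⊆ F ∧ F.card = 4 := by
    rintro β σ (⟨T, hT, hf, hs⟩ | hs)
    · have hD : X.D β T := Or.inl ⟨T, hT, hf, subset_rfl⟩
      exact ⟨_, X.mk1 hD, Finset.insert_subset_insert _ hs,
        by rw [Finset.card_insert_of_notMem (hD.pv β), hT.1]⟩
    · have hD : X.D β X.A := Or.inr subset_rfl
      exact ⟨_, X.mk1 hD, Finset.insert_subset_insert _ hs,
        by rw [Finset.card_insert_of_notMem (hD.pv β), X.hA3]⟩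
  rcases X.cases' hs with h | ⟨β, σ, rfl, h, hD⟩
  · rw [X.mem0 h] at hs
    rcases hs.2 with ⟨h1, h2⟩ | h1
    · obtain ⟨F, hF, hsF, h4⟩ := X.hK.ext s h1
      by_cases hwF : X.w ∈ F
      · have hsub : s ⊆ F.erase X.w := by
          intro x hx
          rw [Finset.mem_erase]
          exact ⟨fun e => h2 (e ▸ hx), hsF hx⟩
        obtain ⟨β, hβ⟩ := Dex (X := X) (τ := F.erase X.w) (by simp)
          (by rwa [Finset.insert_erase hwF])
        obtain ⟨G, hG, h1, h2⟩ := hDc (Or.inl hβ)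
        exact ⟨G, hG, hsub.trans ((Finset.subset_insert _ _).trans h1), h2⟩
      · refine ⟨F, (X.mem0 (fun β => X.pv_notMem hF β)).2 ⟨?_, Or.inl ⟨hF, hwF⟩⟩, hsF, h4⟩
        rintro rfl; simp at h4
    · obtain ⟨G, hG, h1, h2⟩ := hDc (β := true) (Or.inr h1)
      exact ⟨G, hG, (Finset.subset_insert _ _).trans h1, h2⟩
  · exact hDc hD

theorem notMem_ins {s : Finset ℕ} {y : ℕ} (h : ∀ β, X.pv β ∉ s) (hy : ∀ β, y ≠ X.pv β) :
    ∀ β, X.pv β ∉ insert y s := by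
  intro β hh
  rcases Finset.mem_insert.1 hh with h1 | h1
  · exact hy β h1.symm
  · exact h β h1

theorem K'_two (s : Finset ℕ) (hs : s ∈ X.K'.faces) (h3 : s.card = 3) :
    ∃ a b, a ≠ b ∧ ∀ y, (y ∉ s ∧ insert y s ∈ X.K'.faces) ↔ y = a ∨ y = b := by
  classical
  rcases X.cases' hs with h | ⟨β, e, rfl, h, hD⟩
  · by_cases hsA : s = X.A
    · subst hsA
      refine ⟨X.pv true, X.pv false, X.pvne, fun y => ?_⟩
      constructor
      · rintro ⟨h1, h2⟩
        by_contra hcon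
        rw [not_or] at hcon
        have hy : ∀ β, y ≠ X.pv β := by intro β; cases β; exacts [hcon.2, hcon.1]
        rw [X.mem0 (X.notMem_ins h hy)] at h2
        rcases h2.2 with h4 | h4
        · exact X.hAn (down h4.1 (Finset.subset_insert _ _) (face_ne hs))
        · exact h1 (h4 (by simp))
      · have key : ∀ β, X.pv β ∉ X.A ∧ insert (X.pv β) X.A ∈ X.K'.faces :=
          fun β => ⟨X.pv_notMem_A β, X.mk1 (Or.inr subset_rfl)⟩
        rintro (rfl | rfl)
        · exact key _
        · exact key _
    · have hnA : ¬ s ⊆ X.A := fun hh => hsA (Finset.eq_of_subset_of_card_le hh (by rw [h3, X.hA3]))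
      have hs' := (X.mem0 h).1 hs
      obtain ⟨hsK, hws⟩ := hs'.2.resolve_right hnA
      obtain ⟨y1, y2, hne, hall⟩ := X.hK.two s hsK h3
      have hDs : ∀ β, X.D β s ↔ insert X.w s ∈ K.faces ∧ β = X.f s := by
        intro β
        constructor
        · intro hD
          refine ⟨hD.face hsA, ?_⟩
          obtain ⟨T, hT, hf, hsub⟩ := hD.resolve_right hnA
          rw [← hf, Finset.eq_of_subset_of_card_le hsub (by rw [h3, hT.1])]
        · rintro ⟨h1, rfl⟩
          exact Or.inl ⟨s, ⟨h3, hws, h1⟩, rfl, subset_rfl⟩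
      have hy1 := (hall y1).2 (Or.inl rfl)
      have hy2 := (hall y2).2 (Or.inr rfl)
      have hvn : ∀ y, insert y s ∈ K.faces → ∀ β, y ≠ X.pv β := by
        rintro y hf β rfl
        exact X.pv_notMem hf β (by simp)
      have hnew : ∀ y, (y ∉ s ∧ insert y s ∈ X.K'.faces) ↔
          (y ≠ X.w ∧ (y = y1 ∨ y = y2)) ∨ (y = X.pv (X.f s) ∧ (X.w = y1 ∨ X.w = y2)) := by
        intro y
        rw [← hall y, ← hall X.w]
        constructor
        · rintro ⟨h1, h2⟩
          by_cases hy : ∃ β, y = X.pv β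
          · obtain ⟨β, rfl⟩ := hy
            rw [X.mem1 h, hDs] at h2
            exact Or.inr ⟨by rw [h2.2], hws, h2.1⟩
          · push Not at hy
            rw [X.mem0 (X.notMem_ins h hy)] at h2
            rcases h2.2 with h4 | h4
            · refine Or.inl ⟨?_, h1, h4.1⟩
              rintro rfl; exact h4.2 (by simp)
            · exact absurd ((Finset.subset_insert _ _).trans h4) hnA
        · rintro (⟨h1, h2, h4⟩ | ⟨rfl, h1, h2⟩)
          · refine ⟨h2, (X.mem0 (X.notMem_ins h (hvn y h4))).2 ⟨by simp, Or.inl ⟨h4, ?_⟩⟩⟩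
            simp only [Finset.mem_insert, not_or]
            exact ⟨h1.symm, hws⟩
          · exact ⟨h _, X.mk1 ((hDs _).2 ⟨h2, rfl⟩)⟩
      by_cases hw1 : X.w = y1
      · refine ⟨X.pv (X.f s), y2, (hvn y2 hy2.2 _).symm, fun y => ?_⟩
        rw [hnew]
        grind
      · by_cases hw2 : X.w = y2
        · refine ⟨X.pv (X.f s), y1, (hvn y1 hy1.2 _).symm, fun y => ?_⟩
          rw [hnew]
          grind
        · refine ⟨y1, y2, hne, fun y => ?_⟩
          rw [hnew]
          grind
  · have he2 : e.card = 2 := by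
      rw [Finset.card_insert_of_notMem (h β)] at h3; omega
    have hnew : ∀ y, (y ∉ insert (X.pv β) e ∧ insert y (insert (X.pv β) e) ∈ X.K'.faces) ↔
        (y ∉ e ∧ X.D β (insert y e)) := by
      intro y
      rw [Finset.insert_comm, Finset.mem_insert, not_or]
      constructor
      · rintro ⟨⟨h1, h2⟩, h4⟩
        refine ⟨h2, ?_⟩
        rcases X.cases' h4 with h5 | ⟨γ, σ, h5, h6, h7⟩
        · exact absurd (Finset.mem_insert_self _ _) (h5 β)
        · have hβ : X.pv β ∈ insert (X.pv γ) σ := h5 ▸ Finset.mem_insert_self _ _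
          have : β = γ := by
            rcases Finset.mem_insert.1 hβ with h8 | h8
            · exact X.pv_inj h8
            · exact absurd h8 (h6 β)
          subst this
          have hyn : X.pv β ∉ insert y e := by
            rw [Finset.mem_insert, not_or]; exact ⟨Ne.symm h1, h β⟩
          have : insert y e = σ := by
            rw [← Finset.erase_insert hyn, h5, Finset.erase_insert (h6 β)]
          rwa [this]
      · rintro ⟨h1, h2⟩
        exact ⟨⟨fun hy => h2.pv β (hy ▸ Finset.mem_insert_self _ _), h1⟩, X.mk1 h2⟩
    by_cases heA : e ⊆ X.A
    · obtain ⟨y, hye, hyA, hy⟩ := A_edge heA he2 β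
      obtain ⟨x, hxe, hx⟩ := split_insert heA (by rw [X.hA3, he2])
      refine ⟨y, x, ?_, fun z => ?_⟩
      · rintro rfl; exact hyA (by rw [hx]; simp)
      · rw [hnew]
        constructor
        · rintro ⟨h1, h2 | h2⟩
          · exact Or.inl ((hy z h1).1 h2)
          · right
            have : z ∈ X.A := h2 (by simp)
            rw [hx, Finset.mem_insert] at this
            exact this.resolve_right h1
        · rintro (rfl | rfl)
          · exact ⟨hye, Or.inl ((hy z hye).2 rfl)⟩
          · exact ⟨hxe, Or.inr hx.symm.subset⟩
    · have hface := hD.face (fun hh => heA hh.subset)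
      obtain ⟨y1, y2, hne, hall⟩ := X.hK.two _ hface
        (by rw [Finset.card_insert_of_notMem hD.w_notMem, he2])
      refine ⟨y1, y2, hne, fun y => ?_⟩
      rw [hnew, ← hall]
      simp only [Finset.mem_insert, not_or]
      constructor
      · rintro ⟨h1, h2⟩
        refine ⟨⟨fun hy => h2.w_notMem (hy ▸ Finset.mem_insert_self _ _), h1⟩, ?_⟩
        rw [Finset.insert_comm]
        exact h2.face (fun hh => heA (hh ▸ Finset.subset_insert _ _))
      · rintro ⟨⟨h1, h2⟩, h4⟩
        refine ⟨h2, hD.ext heA (Finset.subset_insert _ _) ?_ ?_⟩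
        · rw [Finset.mem_insert, not_or]; exact ⟨Ne.symm h1, hD.w_notMem⟩
        · rwa [Finset.insert_comm]

theorem exists_A {σ : Finset ℕ} (h : σ.card ≤ 2) : ∃ e ∈ X.A, e ∉ σ := by
  by_contra hcon
  push Not at hcon
  have := Finset.card_le_card (show X.A ⊆ σ from hcon)
  rw [X.hA3] at this; omega

theorem K'_lc0 (s : Finset ℕ) (h2 : s.card ≤ 2) (h : ∀ β, X.pv β ∉ s)
    (hs : s = ∅ ∨ s ∈ X.K'.faces) : LC X.K' s := by
  classical
  have hsne : s ≠ X.A := by rintro rfl; rw [X.hA3] at h2; omega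
  have hsK : s = ∅ ∨ s ∈ K.faces := by
    rcases hs with hs | hs
    · exact Or.inl hs
    · right
      rcases ((X.mem0 h).1 hs).2 with h1 | h1
      · exact h1.1
      · exact down (X.A_face h1 hsne) (Finset.subset_insert _ _) (face_ne hs)
  have hws : X.w ∉ s := by
    rcases hs with rfl | hs
    · simp
    · rcases ((X.mem0 h).1 hs).2 with h1 | h1
      · exact h1.2
      · exact fun hh => X.hwA (h1 hh)
  intro S hS
  have hS' : ∀ a b, a ∉ s → b ∉ s → insert a (insert b s) ∈ X.K'.faces → (S a ↔ S b) :=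
    fun a b ha hb hab => ⟨hS a b ha hb hab, hS b a hb ha (by rwa [Finset.insert_comm])⟩
  have hτ : ∃ τ : Prop, ∀ β, X.D β s → (S (X.pv β) ↔ τ) := by
    by_cases hsA : s ⊆ X.A
    · obtain ⟨e, heA, hes⟩ := X.exists_A h2
      refine ⟨S e, fun β _ => ?_⟩
      exact hS' _ _ (h β) hes (X.mk1 (Or.inr (Finset.insert_subset heA hsA)))
    · by_cases hex : ∃ β, X.D β s
      · obtain ⟨β, hβ⟩ := hex
        refine ⟨S (X.pv β), fun γ hγ => ?_⟩
        rw [D_uniq hγ hβ hsA]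
      · exact ⟨True, fun β hβ => absurd ⟨β, hβ⟩ hex⟩
  obtain ⟨τ, hτ⟩ := hτ
  have hwy : ∀ y, y ∉ s → y ≠ X.w → insert X.w (insert y s) ∈ K.faces → (τ ↔ S y) := by
    intro y hy hyw hf
    obtain ⟨β, hβ⟩ := Dex (X := X) (τ := insert y s)
      (by rw [Finset.mem_insert, not_or]; exact ⟨hyw.symm, hws⟩) hf
    have hD : X.D β (insert y s) := Or.inl hβ
    rw [← hτ β (hD.mono (Finset.subset_insert _ _))]
    exact hS' _ _ (h β) hy (X.mk1 hD)
  have hvn : ∀ {r : Finset ℕ}, r ∈ K.faces → X.w ∉ r → r ∈ X.K'.faces := by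
    intro r hr hwr
    exact (X.mem0 (fun β => X.pv_notMem hr β)).2 ⟨(face_ne hr).ne_empty, Or.inl ⟨hr, hwr⟩⟩
  set S2 : ℕ → Prop := fun y => if y = X.w then τ else S y with hS2
  have hcl : ∀ a b, a ∉ s → b ∉ s → insert a (insert b s) ∈ K.faces → S2 a → S2 b := by
    intro a b ha hb hab
    simp only [hS2]
    by_cases haw : a = X.w
    · by_cases hbw : b = X.w
      · simp [haw, hbw]
      · subst haw
        rw [if_pos rfl, if_neg hbw]
        exact (hwy b hb hbw hab).1
    · by_cases hbw : b = X.w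
      · subst hbw
        rw [if_pos rfl, if_neg haw]
        exact (hwy a ha haw (by rwa [Finset.insert_comm])).2
      · rw [if_neg haw, if_neg hbw]
        refine hS a b ha hb (hvn hab ?_)
        simp only [Finset.mem_insert, not_or]
        exact ⟨Ne.symm haw, Ne.symm hbw, hws⟩
  have hlift : ∀ a, a ∉ s → insert a s ∈ X.K'.faces →
      ∃ a', a' ∉ s ∧ insert a' s ∈ K.faces ∧ (S a ↔ S2 a') := by
    intro a ha hf
    by_cases hy : ∃ β, a = X.pv β
    · obtain ⟨β, rfl⟩ := hy
      rw [X.mem1 h] at hf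
      refine ⟨X.w, hws, hf.face hsne, ?_⟩
      simp only [hS2, if_true]
      exact hτ β hf
    · push Not at hy
      rw [X.mem0 (X.notMem_ins h hy)] at hf
      rcases hf.2 with ⟨h1, h2⟩ | h1
      · refine ⟨a, ha, h1, ?_⟩
        have : a ≠ X.w := by rintro rfl; exact h2 (by simp)
        simp only [hS2, if_neg this]
      · have hD : X.D true (insert a s) := Or.inr h1
        have hD' := hD.mono (Finset.subset_insert a s)
        refine ⟨X.w, hws, hD'.face hsne, ?_⟩
        simp only [hS2, if_true]
        rw [← hτ true hD']
        exact (hS' _ _ (h true) ha (X.mk1 hD)).symm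
  intro a b ha hb haf hbf
  obtain ⟨a', h1, h3, h4⟩ := hlift a ha haf
  obtain ⟨b', h5, h6, h7⟩ := hlift b hb hbf
  rw [h4, h7]
  exact X.hK.lc s h2 hsK S2 hcl a' b' h1 h5 h3 h6

theorem mem_ins2 {β : Bool} {σ : Finset ℕ} {y : ℕ} (hσ : ∀ γ, X.pv γ ∉ σ)
    (h1 : y ∉ insert (X.pv β) σ) (h4 : insert y (insert (X.pv β) σ) ∈ X.K'.faces) :
    y ∉ σ ∧ X.D β (insert y σ) := by
  rw [Finset.mem_insert, not_or] at h1
  refine ⟨h1.2, ?_⟩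
  rw [Finset.insert_comm] at h4
  rcases X.cases' h4 with h5 | ⟨γ, τ, h5, h6, h7⟩
  · exact absurd (Finset.mem_insert_self _ _) (h5 β)
  · have hβ : X.pv β ∈ insert (X.pv γ) τ := h5 ▸ Finset.mem_insert_self _ _
    have : β = γ := by
      rcases Finset.mem_insert.1 hβ with h8 | h8
      · exact X.pv_inj h8
      · exact absurd h8 (h6 β)
    subst this
    have hyn : X.pv β ∉ insert y σ := by
      rw [Finset.mem_insert, not_or]; exact ⟨Ne.symm h1.1, hσ β⟩
    have : insert y σ = τ := by
      rw [← Finset.erase_insert hyn, h5, Finset.erase_insert (h6 β)]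
    rwa [this]

theorem K'_lc1 (β : Bool) (σ : Finset ℕ) (h2 : σ.card ≤ 1) (h : ∀ β, X.pv β ∉ σ)
    (hD : X.D β σ) : LC X.K' (insert (X.pv β) σ) := by
  classical
  have hws := hD.w_notMem
  have hσA : σ ≠ X.A := by rintro rfl; rw [X.hA3] at h2; omega
  have hcw : (insert X.w σ).card ≤ 2 := by rw [Finset.card_insert_of_notMem hws]; omega
  have hfw : insert X.w σ ∈ K.faces := hD.face hσA
  -- closed sets, in terms of `D`
  suffices H : ∀ S : ℕ → Prop, (∀ a b, a ∉ σ → b ∉ σ → X.D β (insert a (insert b σ)) → S a → S b) →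
      ∀ a b, a ∉ σ → b ∉ σ → X.D β (insert a σ) → X.D β (insert b σ) → S a → S b by
    intro S hS a b ha hb haf hbf
    have ha' := X.mem_ins2 h ha haf
    have hb' := X.mem_ins2 h hb hbf
    refine H S ?_ a b ha'.1 hb'.1 ha'.2 hb'.2
    intro x y hx hy hxy
    refine hS x y ?_ ?_ ?_
    · rw [Finset.mem_insert, not_or]
      exact ⟨fun e => hxy.pv β (by rw [← e]; simp), hx⟩
    · rw [Finset.mem_insert, not_or]
      exact ⟨fun e => hxy.pv β (by rw [← e]; simp), hy⟩
    · have := X.mk1 hxy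
      rwa [Finset.insert_comm (X.pv β) x, Finset.insert_comm (X.pv β) y] at this
  by_cases hA : σ ⊆ X.A
  · -- base point
    obtain ⟨e, heA, heσ⟩ := X.exists_A (σ := σ) (by omega)
    have key : ∀ S : ℕ → Prop, (∀ a b, a ∉ σ → b ∉ σ → X.D β (insert a (insert b σ)) → S a → S b) →
        ∀ a, a ∉ σ → X.D β (insert a σ) → S a → S e := by
      intro S hS y hy hyD hSy
      by_contra hSe
      have hAS : ∀ z ∈ X.A, z ∉ σ → ¬ S z := by
        intro z hz hzσ hSz
        exact hSe (hS z e hzσ heσ (Or.inr (Finset.insert_subset hz (Finset.insert_subset heA hA))) hSz)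
      have hyA : y ∉ X.A := fun hh => hAS y hh hy hSy
      have := X.hK.lc (insert X.w σ) hcw (Or.inr hfw)
        (fun z => S z ∧ X.D β (insert z σ)) (by
          rintro p q hp hq hpq ⟨h4, h5⟩
          rw [Finset.mem_insert, not_or] at hp hq
          have hpA : p ∉ X.A := fun hh => hAS p hh hp.2 h4
          have hD2 : X.D β (insert p (insert q σ)) := by
            refine h5.ext (fun hh => hpA (hh (by simp)))
              (Finset.insert_subset_insert _ (Finset.subset_insert _ _)) ?_ ?_
            · simp only [Finset.mem_insert, not_or]; exact ⟨Ne.symm hp.1, Ne.symm hq.1, hws⟩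
            · rwa [Finset.insert_comm X.w, Finset.insert_comm X.w]
          exact ⟨hS p q hp.2 hq.2 hD2 h4, hD2.mono (Finset.subset_insert _ _)⟩) y e
          (by rw [Finset.mem_insert, not_or]
              exact ⟨fun hh => hyD.w_notMem (hh ▸ Finset.mem_insert_self _ _), hy⟩)
          (by rw [Finset.mem_insert, not_or]
              exact ⟨fun hh => X.hwA (hh ▸ heA), heσ⟩)
          (by rw [Finset.insert_comm]
              exact hyD.face (fun hh => hyA (hh ▸ Finset.mem_insert_self _ _)))
          (by rw [Finset.insert_comm]
              refine X.A_face (Finset.insert_subset heA hA) (fun hh => ?_)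
              have := X.hA3
              rw [← hh, Finset.card_insert_of_notMem heσ] at this
              omega) ⟨hSy, hyD⟩
      exact hSe this.1
    intro S hS a b ha hb haD hbD hSa
    by_contra hSb
    have h1 := key S hS a ha haD hSa
    exact key (fun z => ¬ S z) (fun x y hx hy hxy hnx hSy => hnx (hS y x hy hx
      (by rwa [Finset.insert_comm]) hSy)) b hb hbD hSb h1
  · intro S hS a b ha hb haD hbD
    have hnA : ∀ y, insert y σ ≠ X.A := fun y hh => hA (hh ▸ Finset.subset_insert _ _)
    refine X.hK.lc (insert X.w σ) hcw (Or.inr hfw) S ?_ a b ?_ ?_ ?_ ?_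
    · intro p q hp hq hpq
      rw [Finset.mem_insert, not_or] at hp hq
      refine hS p q hp.2 hq.2 (hD.ext hA ?_ ?_ ?_)
      · exact (Finset.subset_insert _ _).trans (Finset.subset_insert _ _)
      · simp only [Finset.mem_insert, not_or]; exact ⟨Ne.symm hp.1, Ne.symm hq.1, hws⟩
      · rwa [Finset.insert_comm X.w, Finset.insert_comm X.w]
    · rw [Finset.mem_insert, not_or]
      exact ⟨fun hh => haD.w_notMem (hh ▸ Finset.mem_insert_self _ _), ha⟩
    · rw [Finset.mem_insert, not_or]
      exact ⟨fun hh => hbD.w_notMem (hh ▸ Finset.mem_insert_self _ _), hb⟩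
    · rw [Finset.insert_comm]; exact haD.face (hnA a)
    · rw [Finset.insert_comm]; exact hbD.face (hnA b)

theorem K'_nrm : Nrm X.K' := by
  refine ⟨?_, X.K'_ext, X.K'_le, X.K'_two, ?_⟩
  · exact ⟨_, X.mk1 (β := true) (Or.inr subset_rfl)⟩
  · intro s h2 hs
    by_cases h : ∀ β, X.pv β ∉ s
    · exact X.K'_lc0 s h2 h hs
    · have hs' : s ∈ X.K'.faces := by
        refine hs.resolve_left ?_
        rintro rfl; simp at h
      obtain ⟨β, σ, rfl, h1, hD⟩ := (X.cases' hs').resolve_left h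
      refine X.K'_lc1 β σ ?_ h1 hD
      rw [Finset.card_insert_of_notMem (h1 β)] at h2; omega

end Spl
end SComplex

namespace SComplex

theorem card_one_iff (G : Finset (Finset ℕ)) (s : Finset ℕ) (hs : s.card = 3) :
    (G.filter fun F => F.card = 4 ∧ s ⊆ F).card = 1 ↔
    ∃ a, ∀ y, (y ∉ s ∧ insert y s ∈ G) ↔ y = a := by
  have key : ∀ F, (F ∈ G.filter fun F => F.card = 4 ∧ s ⊆ F) ↔
      ∃ y, y ∉ s ∧ insert y s ∈ G ∧ F = insert y s := by
    intro F
    rw [Finset.mem_filter]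
    constructor
    · rintro ⟨hF, h4, hsF⟩
      obtain ⟨y, hy, rfl⟩ := Spl.split_insert hsF (by omega)
      exact ⟨y, hy, hF, rfl⟩
    · rintro ⟨y, hy, hf, rfl⟩
      exact ⟨hf, by rw [Finset.card_insert_of_notMem hy, hs], Finset.subset_insert _ _⟩
  have inj : ∀ {a b}, a ∉ s → b ∉ s → insert a s = insert b s → a = b := by
    intro a b ha hb h
    have : a ∈ insert b s := h ▸ Finset.mem_insert_self a s
    exact (Finset.mem_insert.1 this).resolve_right ha
  rw [Finset.card_eq_one]
  constructor
  · rintro ⟨F, hF⟩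
    obtain ⟨a, ha, haf, rfl⟩ := (key F).1 (hF ▸ by simp)
    refine ⟨a, fun y => ⟨fun hy => ?_, ?_⟩⟩
    · have := (key (insert y s)).2 ⟨y, hy.1, hy.2, rfl⟩
      rw [hF, Finset.mem_singleton] at this
      exact inj hy.1 ha this
    · rintro rfl; exact ⟨ha, haf⟩
  · rintro ⟨a, ha⟩
    refine ⟨insert a s, ?_⟩
    ext F
    rw [key, Finset.mem_singleton]
    constructor
    · rintro ⟨y, hy, hf, rfl⟩
      rw [(ha y).1 ⟨hy, hf⟩]
    · rintro rfl
      exact ⟨a, ((ha a).2 rfl).1, ((ha a).2 rfl).2, rfl⟩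

theorem mem_coneFaces {w : ℕ} {F : Finset (Finset ℕ)} {s : Finset ℕ} (hF : ∀ r ∈ F, w ∉ r) :
    s ∈ coneFaces w F ↔ s ∈ F ∨ (w ∈ s ∧ (s.erase w ∈ F ∨ s = {w})) := by
  simp only [coneFaces, Finset.mem_union, Finset.mem_image, Finset.mem_singleton]
  constructor
  · rintro ((h | ⟨r, hr, rfl⟩) | h)
    · exact Or.inl h
    · exact Or.inr ⟨by simp, Or.inl (by rwa [Finset.erase_insert (hF r hr)])⟩
    · exact Or.inr ⟨by simp [h], Or.inr h⟩
  · rintro (h | ⟨h1, h2 | h2⟩)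
    · exact Or.inl (Or.inl h)
    · exact Or.inl (Or.inr ⟨_, h2, Finset.insert_erase h1⟩)
    · exact Or.inr h2

theorem BD {K : SComplex} (hK : Nrm K) (w : ℕ) (s : Finset ℕ) :
    s ∈ bdryFaces (K.faces.filter fun α => w ∉ α) 3 ↔ s.Nonempty ∧ w ∉ s ∧ insert w s ∈ K.faces := by
  rw [bdryFaces, Finset.mem_filter, Finset.mem_filter]
  constructor
  · rintro ⟨⟨hs, hws⟩, r, hr, hsr, h3, hc⟩
    refine ⟨face_ne hs, hws, ?_⟩
    rw [card_one_iff _ _ h3] at hc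
    obtain ⟨y, hy⟩ := hc
    rw [Finset.mem_filter] at hr
    obtain ⟨a, b, hab, hall⟩ := hK.two r hr.1 h3
    by_contra hcon
    have hcon2 : insert w r ∉ K.faces := fun h => hcon (down h (Finset.insert_subset_insert _ hsr) (by simp))
    have : ∀ x, (x = a ∨ x = b) → x = y := by
      intro x hx
      have h1 := (hall x).2 hx
      refine (hy x).1 ⟨h1.1, Finset.mem_filter.2 ⟨h1.2, ?_⟩⟩
      rw [Finset.mem_insert, not_or]
      refine ⟨?_, hr.2⟩
      rintro rfl; exact hcon2 h1.2
    exact hab ((this a (Or.inl rfl)).trans (this b (Or.inr rfl)).symm)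
  · rintro ⟨hne, hws, hf⟩
    refine ⟨⟨down hf (Finset.subset_insert _ _) hne, hws⟩, ?_⟩
    obtain ⟨F, hF, hsF, h4⟩ := hK.ext _ hf
    have hwF : w ∈ F := hsF (by simp)
    have hsr : s ⊆ F.erase w := by
      intro x hx
      rw [Finset.mem_erase]
      exact ⟨fun e => hws (e ▸ hx), hsF (by simp [hx])⟩
    have h3 : (F.erase w).card = 3 := by rw [Finset.card_erase_of_mem hwF, h4]
    have hrK : F.erase w ∈ K.faces := down hF (Finset.erase_subset _ _) (Finset.card_pos.1 (by omega))
    refine ⟨F.erase w, Finset.mem_filter.2 ⟨hrK, by simp⟩, hsr, h3, ?_⟩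
    rw [card_one_iff _ _ h3]
    obtain ⟨a, b, hab, hall⟩ := hK.two _ hrK h3
    have hw := (hall w).1 ⟨by simp, by rwa [Finset.insert_erase hwF]⟩
    have : ∀ c, c ≠ w → (∀ y, (y = a ∨ y = b) ↔ (y = w ∨ y = c)) → ∀ y, (y ∉ F.erase w ∧ insert y (F.erase w) ∈ K.faces.filter fun α => w ∉ α) ↔ y = c := by
      intro c hc hh y
      rw [Finset.mem_filter, ← and_assoc, hall, hh, Finset.mem_insert]
      have : w ∉ F.erase w := by simp
      grind
    rcases hw with rfl | rfl
    · exact ⟨b, this b hab.symm (fun y => Iff.rfl)⟩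
    · exact ⟨a, this a hab (fun y => or_comm)⟩

theorem BD_faces {K : SComplex} (hK : Nrm K) (w : ℕ) (hw : {w} ∈ K.faces) :
    K.faces = (K.faces.filter fun α => w ∉ α) ∪
      coneFaces w (bdryFaces (K.faces.filter fun α => w ∉ α) 3) := by
  ext s
  rw [Finset.mem_union, mem_coneFaces (fun r hr => ((BD hK w r).1 hr).2.1), BD hK, BD hK,
    Finset.mem_filter]
  constructor
  · intro hs
    by_cases h : w ∈ s
    · right; right
      refine ⟨h, ?_⟩
      by_cases h1 : s.erase w = ∅
      · right
        rw [← Finset.insert_erase h, h1]; rfl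
      · left
        exact ⟨Finset.nonempty_iff_ne_empty.2 h1, by simp, by rwa [Finset.insert_erase h]⟩
    · exact Or.inl ⟨hs, h⟩
  · rintro (h | h | ⟨h, h1 | rfl⟩)
    · exact h.1
    · exact down h.2.2 (Finset.subset_insert _ _) h.1
    · rw [← Finset.insert_erase h]; exact h1.2.2
    · exact hw

namespace Spl
variable {K : SComplex} (X : Spl K)

theorem D1_A {σ : Finset ℕ} (h : σ ⊆ X.A) (hne : σ ≠ X.A) (β : Bool) : X.D1 β σ := by
  have hlt : σ.card < 3 := by
    rw [← X.hA3]; exact Finset.card_lt_card (h.ssubset_of_ne hne)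
  obtain ⟨e, he1, he2, he3⟩ := Finset.exists_subsuperset_card_eq h (n := 2) (by omega)
    (by rw [X.hA3]; omega)
  obtain ⟨y, hy, -, h1⟩ := A_edge he2 he3 β
  exact ((h1 y hy).2 rfl).mono (he1.trans (Finset.subset_insert _ _))

theorem D1.pv {β : Bool} {σ : Finset ℕ} (h : X.D1 β σ) (γ : Bool) : X.pv γ ∉ σ :=
  D.pv (Or.inl h) γ

/-- faces of the split complex -/
def PM (s : Finset ℕ) : Prop := s ≠ ∅ ∧
  ((s ∈ K.faces ∧ X.w ∉ s) ∨ (∃ β σ, s = insert (X.pv β) σ ∧ X.D1 β σ) ∨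
    ∃ σ, σ ⊆ X.A ∧ σ ≠ X.A ∧ s = insert (X.pv true) (insert (X.pv false) σ))

theorem D1_face {β : Bool} {r : Finset ℕ} (h : X.D1 β r) (hne : r ≠ ∅) : r ∈ K.faces ∧ X.w ∉ r :=
  ⟨down h.face (Finset.subset_insert _ _) (Finset.nonempty_iff_ne_empty.2 hne), h.w_notMem⟩

theorem PM_down1 {β : Bool} {σ r : Finset ℕ} (h : X.D1 β σ) (hr : r ⊆ insert (X.pv β) σ)
    (hne : r ≠ ∅) : X.PM r := by
  refine ⟨hne, ?_⟩
  by_cases hb : X.pv β ∈ r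
  · right; left
    refine ⟨β, r.erase (X.pv β), (Finset.insert_erase hb).symm, h.mono ?_⟩
    exact (Finset.erase_subset_erase _ hr).trans (Finset.erase_insert_subset _ _)
  · left
    refine X.D1_face (β := β) (h.mono ?_) hne
    exact (Finset.subset_insert_iff_of_notMem hb).1 hr

theorem PM_down : ∀ s, X.PM s → ∀ r ⊆ s, r ≠ ∅ → X.PM r := by
  rintro s ⟨-, hs⟩ r hr hne
  rcases hs with h | ⟨β, σ, rfl, h⟩ | ⟨σ, h1, h2, rfl⟩
  · exact ⟨hne, Or.inl ⟨down h.1 hr (Finset.nonempty_iff_ne_empty.2 hne), fun hh => h.2 (hr hh)⟩⟩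
  · exact X.PM_down1 h hr hne
  · by_cases ht : X.pv true ∈ r
    · by_cases hf : X.pv false ∈ r
      · refine ⟨hne, Or.inr (Or.inr ⟨(r.erase (X.pv true)).erase (X.pv false), ?_, ?_, ?_⟩)⟩
        · intro x hx
          have := hr (Finset.mem_of_mem_erase (Finset.mem_of_mem_erase hx))
          grind
        · intro hh
          apply h2
          apply Finset.Subset.antisymm h1
          rw [← hh]
          intro x hx
          have := hr (Finset.mem_of_mem_erase (Finset.mem_of_mem_erase hx))
          grind
        · rw [Finset.insert_erase, Finset.insert_erase ht]
          rw [Finset.mem_erase]; exact ⟨X.pvne.symm, hf⟩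
      · refine X.PM_down1 (X.D1_A h1 h2 true) ?_ hne
        intro x hx
        have := hr hx
        grind
    · refine X.PM_down1 (X.D1_A h1 h2 false) ?_ hne
      intro x hx
      have := hr hx
      grind

open scoped Classical in
/-- the split complex -/
noncomputable def M : SComplex :=
  ofPred (K.vertexSet ∪ {X.pv true, X.pv false}) X.PM (fun h => h.1 rfl) X.PM_down

theorem mem_M (s : Finset ℕ) : s ∈ X.M.faces ↔ X.PM s := by
  classical
  apply mem_ofPred
  rintro s ⟨-, hs⟩
  rcases hs with h | ⟨β, σ, rfl, h⟩ | ⟨σ, h1, h2, rfl⟩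
  · exact (sub_vertexSet h.1).trans Finset.subset_union_left
  · apply Finset.insert_subset
    · cases β <;> simp
    · exact (X.D_sub (Or.inl h)).trans Finset.subset_union_left
  · apply Finset.insert_subset (by simp)
    apply Finset.insert_subset (by simp)
    exact (X.D_sub (β := true) (Or.inr h1)).trans Finset.subset_union_left

theorem M0 {s : Finset ℕ} (h : ∀ β, X.pv β ∉ s) : s ∈ X.M.faces ↔ s ∈ K.faces ∧ X.w ∉ s := by
  rw [mem_M, PM]
  constructor
  · rintro ⟨-, hs | ⟨β, σ, rfl, -⟩ | ⟨σ, h1, h2, rfl⟩⟩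
    · exact hs
    · exact absurd (Finset.mem_insert_self _ _) (h β)
    · exact absurd (Finset.mem_insert_self _ _) (h true)
  · intro hs
    exact ⟨(face_ne hs.1).ne_empty, Or.inl hs⟩

theorem M1 {σ : Finset ℕ} (h : ∀ β, X.pv β ∉ σ) (β : Bool) :
    insert (X.pv β) σ ∈ X.M.faces ↔ X.D1 β σ := by
  rw [mem_M, PM]
  constructor
  · rintro ⟨-, hs | ⟨γ, τ, h1, h2⟩ | ⟨τ, h1, h2, h3⟩⟩
    · exact absurd (Finset.mem_insert_self _ _) (X.pv_notMem hs.1 β)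
    · have h4 : X.pv β ∈ insert (X.pv γ) τ := h1 ▸ Finset.mem_insert_self _ _
      have : β = γ := by
        rcases Finset.mem_insert.1 h4 with h5 | h5
        · exact X.pv_inj h5
        · exact absurd h5 (h2.pv _ β)
      subst this
      rwa [← Finset.erase_insert (h β), h1, Finset.erase_insert (h2.pv _ β)]
    · exfalso
      have h4 : X.pv (!β) ∈ insert (X.pv β) σ := by
        rw [h3]; cases β <;> simp
      rcases Finset.mem_insert.1 h4 with h5 | h5
      · have := X.pv_inj h5; cases β <;> simp at this
      · exact h _ h5
  · intro h
    exact ⟨by simp, Or.inr (Or.inl ⟨β, σ, rfl, h⟩)⟩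

theorem M2 {σ : Finset ℕ} (h : ∀ β, X.pv β ∉ σ) :
    insert (X.pv true) (insert (X.pv false) σ) ∈ X.M.faces ↔ σ ⊆ X.A ∧ σ ≠ X.A := by
  rw [mem_M, PM]
  constructor
  · rintro ⟨-, hs | ⟨γ, τ, h1, h2⟩ | ⟨τ, h1, h2, h3⟩⟩
    · exact absurd (Finset.mem_insert_self _ _) (X.pv_notMem hs.1 true)
    · exfalso
      have h4 : X.pv (!γ) ∈ insert (X.pv γ) τ := by
        rw [← h1]; cases γ <;> simp
      rcases Finset.mem_insert.1 h4 with h5 | h5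
      · have := X.pv_inj h5; cases γ <;> simp at this
      · exact h2.pv _ _ h5
    · have : σ = τ := by
        have ht := fun β => fun hh => X.pv_notMem_A β (h1 hh)
        have hp := X.pvne
        ext x
        have h4 := congrArg (x ∈ ·) h3
        simp only [Finset.mem_insert, eq_iff_iff] at h4
        have := h true; have := h false; have := ht true; have := ht false
        grind
      subst this
      exact ⟨h1, h2⟩
  · intro h
    exact ⟨by simp, Or.inr (Or.inr ⟨σ, h.1, h.2, rfl⟩)⟩

theorem bforall {p : Bool → Prop} (h1 : p true) (h2 : p false) : ∀ β, p β := by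
  intro β; cases β <;> assumption

theorem lkuv (s : Finset ℕ) : s ∈ (X.M.lk {X.pv true, X.pv false}).faces ↔
    s.Nonempty ∧ s ⊆ X.A ∧ s ≠ X.A := by
  rw [mem_lk']
  constructor
  · rintro ⟨h1, h2, h3⟩
    simp only [Finset.disjoint_insert_right, Finset.disjoint_singleton_right] at h2
    refine ⟨h1, (X.M2 (bforall h2.1 h2.2)).1 ?_⟩
    convert h3 using 1
    ext x; simp only [Finset.mem_insert, Finset.mem_union, Finset.mem_singleton]; tauto
  · rintro ⟨h1, h2, h3⟩
    have hp : ∀ β, X.pv β ∉ s := fun β hh => X.pv_notMem_A β (h2 hh)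
    refine ⟨h1, ?_, ?_⟩
    · simp only [Finset.disjoint_insert_right, Finset.disjoint_singleton_right]
      exact ⟨hp _, hp _⟩
    · convert (X.M2 hp).2 ⟨h2, h3⟩ using 1
      ext x; simp only [Finset.mem_insert, Finset.mem_union, Finset.mem_singleton]; tauto

theorem M_contr : EdgeContraction X.M K := by
  refine ⟨X.pv true, X.pv false, ?_, X.pvne, ?_, X.w, ?_, ?_⟩
  · have := (X.M2 (σ := ∅) (by simp)).2 ⟨by simp, fun h => by have := X.hA3; rw [← h] at this; simp at this⟩
    simpa using this
  · ext s
    rw [lkuv, Finset.mem_inter, mem_lk', mem_lk']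
    simp only [Finset.disjoint_singleton_right]
    constructor
    · rintro ⟨⟨h1, h2, h3⟩, -, h4, h5⟩
      have hp : ∀ β, X.pv β ∉ s := bforall h2 h4
      have e : ∀ a, s ∪ {a} = insert a s := by intro a; rw [Finset.union_comm]; rfl
      rw [e, X.M1 hp] at h3 h5
      refine ⟨h1, ?_, ?_⟩
      · by_contra hA
        exact absurd (D_uniq (Or.inl h3) (Or.inl h5) hA) (by simp)
      · rintro rfl
        exact X.hAn (down h3.face (Finset.subset_insert _ _) h1)
    · rintro ⟨h1, h2, h3⟩
      have hp : ∀ β, X.pv β ∉ s := fun β hh => X.pv_notMem_A β (h2 hh)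
      have e : ∀ a, s ∪ {a} = insert a s := by intro a; rw [Finset.union_comm]; rfl
      rw [e, e, X.M1 hp, X.M1 hp]
      exact ⟨⟨h1, hp _, X.D1_A h2 h3 _⟩, h1, hp _, X.D1_A h2 h3 _⟩
  · rw [mem_vertexSet, X.M0]
    · simp
    · intro β; simpa using X.pv_ne_w β
  · have : (X.M.faces.filter fun α => X.pv true ∉ α ∧ X.pv false ∉ α) =
        K.faces.filter fun α => X.w ∉ α := by
      ext s
      rw [Finset.mem_filter, Finset.mem_filter]
      constructor
      · rintro ⟨h1, h2⟩
        exact (X.M0 (bforall h2.1 h2.2)).1 h1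
      · intro h
        have hp : ∀ β, X.pv β ∉ s := fun β => X.pv_notMem h.1 β
        exact ⟨(X.M0 hp).2 h, hp _, hp _⟩
    rw [this]
    exact BD_faces X.hK X.w X.hw

theorem mem_properFaces {s t : Finset ℕ} : t ∈ properFaces s ↔ t ⊆ s ∧ t ≠ ∅ ∧ t ≠ s := by
  simp [properFaces]

theorem mem_simplexFaces {s t : Finset ℕ} : t ∈ simplexFaces s ↔ t ⊆ s ∧ t ≠ ∅ := by
  simp [simplexFaces]

theorem M_flip : BistellarTwoMove X.M X.K' := by
  obtain ⟨a, b, c, hab, hac, hbc, hA⟩ := Finset.card_eq_three.1 X.hA3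
  refine ⟨X.pv true, X.pv false, a, b, c, ?_, X.pvne, ?_, ?_, ?_, ?_, ?_, ?_⟩
  · have := (X.M2 (σ := ∅) (by simp)).2 ⟨by simp, fun h => by have := X.hA3; rw [← h] at this; simp at this⟩
    simpa using this
  · rw [← hA, X.hA3]
  · rw [← hA]; exact X.pv_notMem_A _
  · rw [← hA]; exact X.pv_notMem_A _
  · rw [← hA]
    ext s
    rw [lkuv, mem_properFaces, Finset.nonempty_iff_ne_empty]; tauto
  · rw [← hA, X.M0 (fun β => X.pv_notMem_A β)]
    exact fun h => X.hAn h.1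
  · rw [← hA]
    ext s
    simp only [Finset.mem_union, Finset.mem_filter, mem_simplexFaces]
    by_cases hne : s = ∅
    · subst hne
      have h1 : ∅ ∉ X.K'.faces := X.K'.not_empty_mem
      have h2 : ∅ ∉ X.M.faces := X.M.not_empty_mem
      simp [h1, h2]
    by_cases hp : ∀ β, X.pv β ∉ s
    · rw [X.mem0 hp, X.M0 hp, Finset.subset_insert_iff_of_notMem (hp _),
        Finset.subset_insert_iff_of_notMem (hp _)]
      have : ¬ ({X.pv true, X.pv false} : Finset ℕ) ⊆ s := fun hh => hp true (hh (by simp))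
      tauto
    · push Not at hp
      obtain ⟨β, hβ⟩ := hp
      by_cases hγ : X.pv (!β) ∈ s
      · have h1 : ({X.pv true, X.pv false} : Finset ℕ) ⊆ s := by
          intro x hx
          simp only [Finset.mem_insert, Finset.mem_singleton] at hx
          cases β
          · rcases hx with rfl | rfl; exacts [hγ, hβ]
          · rcases hx with rfl | rfl; exacts [hβ, hγ]
        have h2 : ∀ β, X.pv β ∈ s := by
          apply bforall
          · exact h1 (by simp)
          · exact h1 (by simp)
        have h3 : s ∉ X.K'.faces := by
          intro hh
          rcases X.cases' hh with h | ⟨δ, σ, rfl, h4, h5⟩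
          · exact h β hβ
          · have := h2 (!δ)
            rcases Finset.mem_insert.1 this with h6 | h6
            · have := X.pv_inj h6; cases δ <;> simp at this
            · exact h4 _ h6
        have h4 : ∀ δ, ¬ s ⊆ insert (X.pv δ) X.A := by
          intro δ hh
          have := hh (h2 (!δ))
          rcases Finset.mem_insert.1 this with h6 | h6
          · have := X.pv_inj h6; cases δ <;> simp at this
          · exact X.pv_notMem_A _ h6
        have := h4 true; have := h4 false
        tauto
      · have hs := Finset.insert_erase hβ
        set σ := s.erase (X.pv β) with hσ
        have hp : ∀ γ, X.pv γ ∉ σ := by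
          intro γ hh
          by_cases hg : γ = β
          · subst hg; simp [hσ] at hh
          · have : γ = !β := by cases γ <;> cases β <;> simp_all
            subst this
            exact hγ (Finset.mem_of_mem_erase hh)
        have h1 : ¬ ({X.pv true, X.pv false} : Finset ℕ) ⊆ s := by
          intro hh
          apply hγ
          apply hh
          cases β <;> simp
        have h2 : ¬ s ⊆ insert (X.pv (!β)) X.A := by
          intro hh
          rcases Finset.mem_insert.1 (hh hβ) with h6 | h6
          · have := X.pv_inj h6; cases β <;> simp at this
          · exact X.pv_notMem_A _ h6
        have h3 : s ⊆ insert (X.pv β) X.A ↔ σ ⊆ X.A := by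
          rw [← hs]
          rw [Finset.insert_subset_insert_iff (hp β)]
        have h4 : s ∈ X.K'.faces ↔ X.D β σ := by rw [← hs, X.mem1 hp]
        have h5 : s ∈ X.M.faces ↔ X.D1 β σ := by rw [← hs, X.M1 hp]
        rw [h4, h5, D]
        cases β
        · simp only [Bool.not_false] at h2
          simp only [h1, h2, h3, hne, not_false_eq_true, and_true, false_and, or_false, ne_eq]
        · simp only [Bool.not_true] at h2
          simp only [h1, h2, h3, hne, not_false_eq_true, and_true, false_and, or_false, ne_eq]

end Spl
end SComplex

namespace SComplex

theorem cnt1 (G : Finset (Finset ℕ)) (w : ℕ) (N : Finset ℕ)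
    (hN : ∀ y, y ∈ N ↔ y ≠ w ∧ ({w, y} : Finset ℕ) ∈ G) :
    (G.filter fun s => s.card = 2).card =
      ((G.filter fun s => w ∉ s).filter fun s => s.card = 2).card + N.card := by
  classical
  rw [← Finset.card_filter_add_card_filter_not (s := G.filter fun s => s.card = 2) (fun s => w ∉ s)]
  congr 1
  · rw [Finset.filter_comm]
  · symm
    apply Finset.card_bij (fun y _ => ({w, y} : Finset ℕ))
    · intro y hy
      rw [hN] at hy
      simp [hy.2, Finset.card_pair (Ne.symm hy.1)]
    · intro y hy z hz h
      rw [hN] at hy hz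
      have : y ∈ ({w, z} : Finset ℕ) := h ▸ (by simp)
      simp only [Finset.mem_insert, Finset.mem_singleton] at this
      exact this.resolve_left hy.1
    · intro s hs
      simp only [Finset.mem_filter, not_not] at hs
      obtain ⟨⟨h1, h2⟩, h3⟩ := hs
      obtain ⟨y, hy, rfl⟩ := Spl.split_insert (ρ := {w}) (T := s) (by simpa using h3) (by simp [h2])
      refine ⟨y, (hN y).2 ⟨by simpa using hy, ?_⟩, ?_⟩
      · rwa [Finset.pair_comm]
      · exact Finset.pair_comm _ _

theorem cnt0 (G : Finset (Finset ℕ)) (w : ℕ) (h : {w} ∈ G) :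
    (G.filter fun s => s.card = 1).card =
      ((G.filter fun s => w ∉ s).filter fun s => s.card = 1).card + 1 := by
  classical
  rw [← Finset.card_filter_add_card_filter_not (s := G.filter fun s => s.card = 1) (fun s => w ∉ s)]
  congr 1
  · rw [Finset.filter_comm]
  · rw [Finset.card_eq_one]
    refine ⟨{w}, ?_⟩
    ext s
    simp only [Finset.mem_filter, not_not, Finset.mem_singleton]
    constructor
    · rintro ⟨⟨h1, h2⟩, h3⟩
      obtain ⟨y, rfl⟩ := Finset.card_eq_one.1 h2
      rw [Finset.mem_singleton] at h3; rw [h3]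
    · rintro rfl; simp [h]

theorem fnum0 (K : SComplex) : K.fnum 0 = (K.faces.filter fun s => s.card = 1).card := rfl
theorem fnum1 (K : SComplex) : K.fnum 1 = (K.faces.filter fun s => s.card = 2).card := rfl

namespace Spl
variable {K : SComplex} (X : Spl K)

theorem base_eq : ((X.K'.faces.filter fun s => X.pv true ∉ s).filter fun s => X.pv false ∉ s).filter
      (fun s => s.card = 2) = (K.faces.filter fun s => X.w ∉ s).filter (fun s => s.card = 2) := by
  ext s
  simp only [Finset.mem_filter]
  constructor
  · rintro ⟨⟨⟨h1, h2⟩, h3⟩, h4⟩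
    refine ⟨?_, h4⟩
    rw [X.mem0 (bforall h2 h3)] at h1
    rcases h1.2 with h | h
    · exact h
    · have : s ≠ X.A := by rintro rfl; rw [X.hA3] at h4; omega
      exact X.D1_face (X.D1_A h this true) h1.1
  · rintro ⟨⟨h1, h2⟩, h3⟩
    have hp := fun β => X.pv_notMem h1 β
    exact ⟨⟨⟨(X.mem0 hp).2 ⟨(face_ne h1).ne_empty, Or.inl ⟨h1, h2⟩⟩, hp _⟩, hp _⟩, h3⟩

theorem base_eq0 : ((X.K'.faces.filter fun s => X.pv true ∉ s).filter fun s => X.pv false ∉ s).filter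
      (fun s => s.card = 1) = (K.faces.filter fun s => X.w ∉ s).filter (fun s => s.card = 1) := by
  ext s
  simp only [Finset.mem_filter]
  constructor
  · rintro ⟨⟨⟨h1, h2⟩, h3⟩, h4⟩
    refine ⟨?_, h4⟩
    rw [X.mem0 (bforall h2 h3)] at h1
    rcases h1.2 with h | h
    · exact h
    · have : s ≠ X.A := by rintro rfl; rw [X.hA3] at h4; omega
      exact X.D1_face (X.D1_A h this true) h1.1
  · rintro ⟨⟨h1, h2⟩, h3⟩
    have hp := fun β => X.pv_notMem h1 β
    exact ⟨⟨⟨(X.mem0 hp).2 ⟨(face_ne h1).ne_empty, Or.inl ⟨h1, h2⟩⟩, hp _⟩, hp _⟩, h3⟩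

theorem g2_lt : X.K'.g2 < K.g2 := by
  classical
  set N : Finset ℕ := K.vertexSet.filter fun y => y ≠ X.w ∧ ({X.w, y} : Finset ℕ) ∈ K.faces with hN
  set NB : Bool → Finset ℕ := fun β => N.filter fun y => X.D β {y} with hNB
  have hNm : ∀ y, y ∈ N ↔ y ≠ X.w ∧ ({X.w, y} : Finset ℕ) ∈ K.faces := by
    intro y
    rw [hN, Finset.mem_filter, mem_vertexSet]
    constructor
    · exact fun h => h.2
    · exact fun h => ⟨down h.2 (by simp) (by simp), h⟩
  have hne : ∀ y, ({y} : Finset ℕ) ≠ X.A := by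
    intro y h; have := X.hA3; rw [← h] at this; simp at this
  have hNBm : ∀ β y, y ∈ NB β ↔ X.D β {y} := by
    intro β y
    rw [hNB, Finset.mem_filter, hNm]
    constructor
    · exact fun h => h.2
    · intro h
      refine ⟨⟨?_, h.face (hne y)⟩, h⟩
      have := h.w_notMem
      rw [Finset.mem_singleton] at this
      exact Ne.symm this
  have hu : NB true ∪ NB false = N := by
    ext y
    rw [Finset.mem_union, hNBm, hNBm, hNm]
    constructor
    · intro h
      have : ∃ β, X.D β {y} := by rcases h with h | h; exacts [⟨_, h⟩, ⟨_, h⟩]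
      obtain ⟨β, h⟩ := this
      refine ⟨?_, h.face (hne y)⟩
      have := h.w_notMem
      rw [Finset.mem_singleton] at this
      exact Ne.symm this
    · rintro ⟨h1, h2⟩
      obtain ⟨β, h⟩ := Dex (X := X) (τ := {y}) (by simpa using h1.symm) h2
      cases β
      · exact Or.inr (Or.inl h)
      · exact Or.inl (Or.inl h)
  have hi : NB true ∩ NB false = X.A := by
    ext y
    rw [Finset.mem_inter, hNBm, hNBm]
    constructor
    · rintro ⟨h1, h2⟩
      by_contra hy
      exact absurd (D_uniq h1 h2 (by simpa using hy)) (by simp)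
    · intro h
      have : ({y} : Finset ℕ) ⊆ X.A := by simpa using h
      exact ⟨Or.inr this, Or.inr this⟩
  have hcard : (NB true).card + (NB false).card = N.card + 3 := by
    have := Finset.card_union_add_card_inter (NB true) (NB false)
    rw [hu, hi, X.hA3] at this
    exact this.symm
  have e1 := cnt1 X.K'.faces (X.pv true) (NB true) (by
    intro y
    rw [hNBm]
    constructor
    · intro h
      have := h.pv true
      rw [Finset.mem_singleton] at this
      exact ⟨Ne.symm this, X.mk1 h⟩
    · rintro ⟨h1, h2⟩
      refine (X.mem_ins2 (σ := ∅) (β := true) (y := y) (by simp) (by simpa using h1) ?_).2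
      rw [Finset.pair_comm] at h2
      simpa using h2)
  have e2 := cnt1 (X.K'.faces.filter fun s => X.pv true ∉ s) (X.pv false) (NB false) (by
    intro y
    rw [hNBm, Finset.mem_filter]
    constructor
    · intro h
      have h0 := h.pv true
      have := h.pv false
      rw [Finset.mem_singleton] at this
      refine ⟨Ne.symm this, X.mk1 h, ?_⟩
      rw [Finset.mem_insert, not_or]
      exact ⟨X.pvne, h0⟩
    · rintro ⟨h1, h2, -⟩
      refine (X.mem_ins2 (σ := ∅) (β := false) (y := y) (by simp) (by simpa using h1) ?_).2
      rw [Finset.pair_comm] at h2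
      simpa using h2)
  have e3 := cnt1 K.faces X.w N hNm
  have c1 := cnt0 X.K'.faces (X.pv true) (X.mk1 (β := true) (σ := ∅) (Or.inr (by simp)))
  have c2 := cnt0 (X.K'.faces.filter fun s => X.pv true ∉ s) (X.pv false) (by
    rw [Finset.mem_filter]
    exact ⟨X.mk1 (β := false) (σ := ∅) (Or.inr (by simp)), by simpa using X.pvne⟩)
  have c3 := cnt0 K.faces X.w X.hw
  rw [base_eq] at e2
  rw [base_eq0] at c2
  rw [g2, g2, fnum0, fnum0, fnum1, fnum1]
  omega

end Spl

theorem InClassR.noSpl {K : SComplex} (h : InClassR K) (X : Spl K) : False := by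
  obtain ⟨h1, -, -, h2, h3⟩ := h
  have := h3 X.K' X.K'_nrm.normal (Or.inr (Or.inr (Or.inl ⟨X.M, X.M_contr, X.M_flip⟩)))
  have := X.g2_lt
  omega

end SComplex

namespace SComplex

/-- adjacency -/
def NK (K : SComplex) (x y : ℕ) : Prop := x ≠ y ∧ ({x, y} : Finset ℕ) ∈ K.faces
/-- triangles -/
def RK (K : SComplex) (x y z : ℕ) : Prop :=
  x ≠ y ∧ x ≠ z ∧ y ≠ z ∧ ({x, y, z} : Finset ℕ) ∈ K.faces
/-- tetrahedra -/
def QK (K : SComplex) (x y z w : ℕ) : Prop :=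
  x ≠ y ∧ x ≠ z ∧ x ≠ w ∧ y ≠ z ∧ y ≠ w ∧ z ≠ w ∧ ({x, y, z, w} : Finset ℕ) ∈ K.faces

variable {K : SComplex}

theorem NK.symm {x y : ℕ} (h : NK K x y) : NK K y x :=
  ⟨h.1.symm, by rw [Finset.pair_comm]; exact h.2⟩

theorem RK.r12 {x y z : ℕ} (h : RK K x y z) : RK K y x z := by
  obtain ⟨h1, h2, h3, h4⟩ := h
  exact ⟨h1.symm, h3, h2, by rwa [Finset.insert_comm]⟩

theorem RK.r23 {x y z : ℕ} (h : RK K x y z) : RK K x z y := by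
  obtain ⟨h1, h2, h3, h4⟩ := h
  exact ⟨h2, h1, h3.symm, by rwa [Finset.pair_comm]⟩

theorem QK.q12 {x y z w : ℕ} (h : QK K x y z w) : QK K y x z w := by
  obtain ⟨h1, h2, h3, h4, h5, h6, h7⟩ := h
  exact ⟨h1.symm, h4, h5, h2, h3, h6, by rwa [Finset.insert_comm]⟩

theorem QK.q23 {x y z w : ℕ} (h : QK K x y z w) : QK K x z y w := by
  obtain ⟨h1, h2, h3, h4, h5, h6, h7⟩ := h
  exact ⟨h2, h1, h3, h4.symm, h6, h5, by rwa [Finset.insert_comm z y]⟩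

theorem QK.q34 {x y z w : ℕ} (h : QK K x y z w) : QK K x y w z := by
  obtain ⟨h1, h2, h3, h4, h5, h6, h7⟩ := h
  exact ⟨h1, h3, h2, h5, h4, h6.symm, by rwa [Finset.pair_comm w z]⟩

theorem QK.r {x y z w : ℕ} (h : QK K x y z w) : RK K x y z := by
  obtain ⟨h1, h2, h3, h4, h5, h6, h7⟩ := h
  exact ⟨h1, h2, h4, down h7 (by intro a; simp; tauto) (by simp)⟩

theorem RK.n {x y z : ℕ} (h : RK K x y z) : NK K x y := by
  obtain ⟨h1, h2, h3, h4⟩ := h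
  exact ⟨h1, down h4 (by intro a; simp; tauto) (by simp)⟩

theorem NK.mem {x y : ℕ} (h : NK K x y) : y ∈ K.vertexSet :=
  mem_vertexSet.2 (down h.2 (by simp) (by simp))

theorem NK.mem' {x y : ℕ} (h : NK K x y) : x ∈ K.vertexSet := h.symm.mem

theorem RK.r13 {x y z : ℕ} (h : RK K x y z) : RK K z y x := h.r12.r23.r12
theorem QK.q13 {x y z w : ℕ} (h : QK K x y z w) : QK K z y x w := h.q12.q23.q12

theorem Nrm.twoQ (hK : Nrm K) {x y z : ℕ} (h : RK K x y z) :
    ∃ a b, a ≠ b ∧ ∀ c, QK K x y z c ↔ c = a ∨ c = b := by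
  obtain ⟨h1, h2, h3, h4⟩ := h
  obtain ⟨a, b, hab, hall⟩ := hK.two _ h4 (Finset.card_eq_three.2 ⟨x, y, z, h1, h2, h3, rfl⟩)
  refine ⟨a, b, hab, fun c => ?_⟩
  rw [← hall, QK]
  have : (insert c {x, y, z} : Finset ℕ) = {x, y, z, c} := by ext; simp; tauto
  rw [this]
  simp only [Finset.mem_insert, Finset.mem_singleton, not_or]
  constructor
  · rintro ⟨a1, a2, a3, a4, a5, a6, a7⟩
    exact ⟨⟨a3.symm, a5.symm, a6.symm⟩, a7⟩
  · rintro ⟨⟨a1, a2, a3⟩, a4⟩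
    exact ⟨h1, h2, Ne.symm a1, h3, Ne.symm a2, Ne.symm a3, a4⟩

/-- an edge extends to a triangle -/
theorem Nrm.exR (hK : Nrm K) {x y : ℕ} (h : NK K x y) : ∃ z, RK K x y z := by
  obtain ⟨F, hF, hs, h4⟩ := hK.ext _ h.2
  obtain ⟨T, h1, h2, h3⟩ := Finset.exists_subsuperset_card_eq hs (n := 3)
    (by rw [Finset.card_pair h.1]; omega) (by omega)
  obtain ⟨z, hz, rfl⟩ := Spl.split_insert h1 (by rw [h3, Finset.card_pair h.1])
  simp only [Finset.mem_insert, Finset.mem_singleton, not_or] at hz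
  refine ⟨z, h.1, Ne.symm hz.1, Ne.symm hz.2, down hF ?_ (by simp)⟩
  refine Finset.Subset.trans ?_ h2
  intro a; simp; tauto

theorem five (hK : Nrm K) (W : Finset ℕ) (hW : W.card = 5)
    (h4 : ∀ F ⊆ W, F.card = 4 → F ∈ K.faces) : K.vertexSet ⊆ W := by
  have key : ∀ n ≤ 3, ∀ s ⊆ W, s.card + n = 3 → ∀ y, insert y s ∈ K.faces → y ∈ W := by
    intro n
    induction n with
    | zero =>
      intro _ s hs h3 y hy
      have hsK : s ∈ K.faces := down hy (Finset.subset_insert _ _) (Finset.card_pos.1 (by omega))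
      obtain ⟨a, b, hab, hall⟩ := hK.two s hsK (by omega)
      by_cases hys : y ∈ s
      · exact hs hys
      have hc : (W \ s).card = 2 := by
        have := Finset.card_sdiff_add_card_eq_card hs; omega
      obtain ⟨p, q, hpq, he⟩ := Finset.card_eq_two.1 hc
      have hmem : ∀ x, (x = p ∨ x = q) → x ∈ W ∧ (x = a ∨ x = b) := by
        intro x hx
        have : x ∈ W \ s := by rw [he]; simpa using hx
        rw [Finset.mem_sdiff] at this
        refine ⟨this.1, (hall x).1 ⟨this.2, h4 _ (Finset.insert_subset this.1 hs) ?_⟩⟩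
        rw [Finset.card_insert_of_notMem this.2]; omega
      have h1 := hmem p (Or.inl rfl)
      have h2 := hmem q (Or.inr rfl)
      have := (hall y).1 ⟨hys, hy⟩
      grind
    | succ n ih =>
      intro hn s hs h3 y hy
      by_cases hys : y ∈ s
      · exact hs hys
      have hlt : (W \ s).card = 5 - s.card := by
        have := Finset.card_sdiff_add_card_eq_card hs; omega
      obtain ⟨a, ha⟩ := Finset.card_pos.1 (show 0 < (W \ s).card by omega)
      rw [Finset.mem_sdiff] at ha
      have haK : insert a s ∈ K.faces := by
        obtain ⟨F, h5, h6, h7⟩ := Finset.exists_subsuperset_card_eq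
          (Finset.insert_subset ha.1 hs) (n := 4)
          (by rw [Finset.card_insert_of_notMem ha.2]; omega) (by omega)
        exact down (h4 F h6 h7) h5 (by simp)
      refine hK.lc s (by omega) ?_ (fun x => x ∈ W) ?_ a y ha.2 hys haK hy ha.1
      · by_cases h : s = ∅
        · exact Or.inl h
        · exact Or.inr (down hy (Finset.subset_insert _ _) (Finset.nonempty_iff_ne_empty.2 h))
      · intro p q hp hq hpq hpW
        refine ih (by omega) (insert p s) (Finset.insert_subset hpW hs) ?_ q ?_
        · rw [Finset.card_insert_of_notMem hp]; omega
        · rwa [Finset.insert_comm]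
  intro x hx
  rw [mem_vertexSet] at hx
  exact key 3 le_rfl ∅ (by simp) (by simp) x (by simpa using hx)

theorem exists_fresh (K : SComplex) : ∃ pv : Bool → ℕ, (∀ β, {pv β} ∉ K.faces) ∧ pv true ≠ pv false := by
  have key : ∀ n, {K.vertexSet.sup id + 1 + n} ∉ K.faces := by
    intro n h
    rw [← mem_vertexSet] at h
    have := Finset.le_sup (f := id) h
    simp only [id] at this
    omega
  refine ⟨fun β => K.vertexSet.sup id + 1 + (if β then 1 else 0), fun β => key _, ?_⟩
  simp

/-- class R property (i) for quadruples -/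
theorem InClassR.fill (h : InClassR K) {a b c d : ℕ} (h1 : RK K a b c) (h2 : RK K a b d)
    (h3 : RK K a c d) (h4 : RK K b c d) : QK K a b c d := by
  obtain ⟨-, -, -, hi, -⟩ := h
  refine ⟨h1.1, h1.2.1, h2.2.1, h1.2.2.1, h2.2.2.1, h3.2.2.1, ?_⟩
  apply hi
  · rw [Finset.card_eq_succ]
    refine ⟨a, {b, c, d}, ?_, rfl, Finset.card_eq_three.2 ⟨b, c, d, h4.1, h4.2.1, h4.2.2.1, rfl⟩⟩
    simp only [Finset.mem_insert, Finset.mem_singleton, not_or]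
    exact ⟨h1.1, h1.2.1, h2.2.1⟩
  · intro s hs
    rw [Spl.mem_properFaces] at hs
    obtain ⟨h5, h6, h7⟩ := hs
    have : ∃ x ∈ ({a, b, c, d} : Finset ℕ), x ∉ s := by
      by_contra hcon
      push Not at hcon
      exact h7 (Finset.Subset.antisymm h5 hcon)
    obtain ⟨x, hx, hxs⟩ := this
    have hne := Finset.nonempty_iff_ne_empty.2 h6
    have hsub : ∀ y ∈ s, y ≠ x ∧ (y = a ∨ y = b ∨ y = c ∨ y = d) := by
      intro y hy
      refine ⟨fun e => hxs (e ▸ hy), ?_⟩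
      simpa using h5 hy
    simp only [Finset.mem_insert, Finset.mem_singleton] at hx
    rcases hx with rfl | rfl | rfl | rfl
    · exact down h4.2.2.2 (by intro y hy; have := hsub y hy; simp; tauto) hne
    · exact down h3.2.2.2 (by intro y hy; have := hsub y hy; simp; tauto) hne
    · exact down h2.2.2.2 (by intro y hy; have := hsub y hy; simp; tauto) hne
    · exact down h1.2.2.2 (by intro y hy; have := hsub y hy; simp; tauto) hne

open scoped Classical in
theorem InClassR.A (h : InClassR K) (h6 : 6 ≤ K.vertexSet.card) {u v : ℕ} (huv : NK K u v) :
    4 ≤ (K.vertexSet.filter (RK K u v)).card := by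
  have hK := h.1.nrm
  set A := K.vertexSet.filter (RK K u v) with hA
  have hAm : ∀ x, x ∈ A ↔ RK K u v x := by
    intro x
    rw [hA, Finset.mem_filter]
    exact ⟨fun h => h.2, fun h => ⟨h.r23.n.mem, h⟩⟩
  by_contra hcon
  obtain ⟨z, hz⟩ := hK.exR huv
  obtain ⟨a, b, hab, hall⟩ := hK.twoQ hz
  have ha := (hall a).2 (Or.inl rfl)
  have hb := (hall b).2 (Or.inr rfl)
  have hza : z ≠ a := ha.2.2.2.2.2.1
  have hzb : z ≠ b := hb.2.2.2.2.2.1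
  have hsub : {z, a, b} ⊆ A := by
    intro x hx
    simp only [Finset.mem_insert, Finset.mem_singleton] at hx
    rw [hAm]
    rcases hx with rfl | rfl | rfl
    · exact hz
    · exact ha.q34.r
    · exact hb.q34.r
  have h3 : ({z, a, b} : Finset ℕ).card = 3 := Finset.card_eq_three.2 ⟨z, a, b, hza, hzb, hab, rfl⟩
  have hAe : {z, a, b} = A := Finset.eq_of_subset_of_card_le hsub (by omega)
  have hA3 : A.card = 3 := by rw [← hAe, h3]
  have hAm' : ∀ x, RK K u v x → x = z ∨ x = a ∨ x = b := by
    intro x hx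
    rw [← hAm, ← hAe] at hx
    simpa using hx
  have hQ : QK K u v a b := by
    obtain ⟨p, q, hpq, hall2⟩ := hK.twoQ ha.q34.r
    have hp := (hall2 p).2 (Or.inl rfl)
    have hq := (hall2 q).2 (Or.inr rfl)
    have hp1 := hAm' p hp.q34.r
    have hq1 := hAm' q hq.q34.r
    have hp2 : a ≠ p := hp.2.2.2.2.2.1
    have hq2 : a ≠ q := hq.2.2.2.2.2.1
    have : p = b ∨ q = b := by grind
    rcases this with rfl | rfl
    · exact hp
    · exact hq
  have huA : u ∉ A := fun hh => ((hAm u).1 hh).2.1 rfl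
  have hvA : v ∉ A := fun hh => ((hAm v).1 hh).2.2.1 rfl
  -- edges of the link
  have hlink : ∀ e ⊆ A, e.card = 2 → insert u (insert v e) ∈ K.faces := by
    intro e he he2
    obtain ⟨p, q, hpq, rfl⟩ := Finset.card_eq_two.1 he2
    rw [← hAe] at he
    have hp := he (show p ∈ ({p, q} : Finset ℕ) by simp)
    have hq := he (show q ∈ ({p, q} : Finset ℕ) by simp)
    have e1 := ha.2.2.2.2.2.2
    have e2 := hb.2.2.2.2.2.2
    have e3 := hQ.2.2.2.2.2.2
    have e1' := ha.q34.2.2.2.2.2.2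
    have e2' := hb.q34.2.2.2.2.2.2
    have e3' := hQ.q34.2.2.2.2.2.2
    simp only [Finset.mem_insert, Finset.mem_singleton] at hp hq
    rcases hp with rfl | rfl | rfl <;> rcases hq with rfl | rfl | rfl <;>
      first | exact absurd rfl hpq | assumption
  by_cases hAK : A ∈ K.faces
  · have hzab : RK K z a b := ⟨hza, hzb, hab, by rw [hAe]; exact hAK⟩
    have q1 : QK K u z a b := h.fill ha.q23.q34.r (by
      exact hb.q23.q34.r) hQ.q23.q34.r hzab
    have q2 : QK K v z a b := h.fill ha.q12.q23.q34.r hb.q12.q23.q34.r hQ.q12.q23.q34.r hzab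
    have := five hK {u, v, z, a, b} (by
      rw [Finset.card_insert_of_notMem, Finset.card_insert_of_notMem, h3]
      · rw [hAe]; exact hvA
      · rw [Finset.mem_insert, not_or, hAe]; exact ⟨huv.1, huA⟩) (by
      intro F hF h4
      have : ∃ x ∈ ({u, v, z, a, b} : Finset ℕ), x ∉ F := by
        by_contra hcon
        push Not at hcon
        have := Finset.card_le_card (show ({u, v, z, a, b} : Finset ℕ) ⊆ F from hcon)
        rw [Finset.card_insert_of_notMem, Finset.card_insert_of_notMem, h3] at this
        · omega
        · rw [hAe]; exact hvA
        · rw [Finset.mem_insert, not_or, hAe]; exact ⟨huv.1, huA⟩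
      obtain ⟨x, hx, hxF⟩ := this
      have hne : F.Nonempty := Finset.card_pos.1 (by omega)
      have hsub : ∀ y ∈ F, y ≠ x ∧ (y = u ∨ y = v ∨ y = z ∨ y = a ∨ y = b) := by
        intro y hy
        refine ⟨fun e => hxF (e ▸ hy), ?_⟩
        simpa using hF hy
      simp only [Finset.mem_insert, Finset.mem_singleton] at hx
      rcases hx with rfl | rfl | rfl | rfl | rfl
      · exact down q2.2.2.2.2.2.2 (by intro y hy; have := hsub y hy; simp; tauto) hne
      · exact down q1.2.2.2.2.2.2 (by intro y hy; have := hsub y hy; simp; tauto) hne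
      · exact down hQ.2.2.2.2.2.2 (by intro y hy; have := hsub y hy; simp; tauto) hne
      · exact down hb.2.2.2.2.2.2 (by intro y hy; have := hsub y hy; simp; tauto) hne
      · exact down ha.2.2.2.2.2.2 (by intro y hy; have := hsub y hy; simp; tauto) hne)
    have := Finset.card_le_card this
    have h5 : ({u, v, z, a, b} : Finset ℕ).card ≤ 5 := Finset.card_le_five
    omega
  · obtain ⟨pv, hpv, hpvne⟩ := exists_fresh K
    refine h.noSpl
      { hK := hK, w := u, A := A, f := fun T => decide (v ∈ T), pv := pv, hw := ?_, hA3 := hA3,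
        hwA := huA, hA := ?_, hAn := hAK, flip := ?_, fresh := hpv, pvne := hpvne }
    · exact mem_vertexSet.1 huv.mem'
    · intro e he he2
      exact down (hlink e he he2) (Finset.insert_subset_insert _ (Finset.subset_insert _ _)) (by simp)
    · intro e y y' he2 hue hye hye' hyu hyu' hyy hf hf'
      have hfe : insert u e ∈ K.faces :=
        down hf (Finset.insert_subset_insert _ (Finset.subset_insert _ _)) (by simp)
      obtain ⟨p, q, hpq, hall⟩ := hK.two _ hfe (by rw [Finset.card_insert_of_notMem hue, he2])
      have h1 := (hall y).1 ⟨by simp [hyu, hye], by rwa [Finset.insert_comm]⟩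
      have h2 := (hall y').1 ⟨by simp [hyu', hye'], by rwa [Finset.insert_comm]⟩
      constructor
      · intro heA
        have hve : v ∉ e := fun hh => hvA (heA hh)
        have h3 := (hall v).1 ⟨by simp [huv.1.symm, hve],
          by rw [Finset.insert_comm]; exact hlink e heA he2⟩
        have : (v ∈ insert y e) ↔ ¬ (v ∈ insert y' e) := by
          simp only [Finset.mem_insert, hve, or_false]
          grind
        by_cases hh : v ∈ insert y' e
        · simp only [this, hh, decide_true, decide_false, not_true, Bool.not_true]
        · simp only [this, hh, decide_true, decide_false, not_false_eq_true, Bool.not_false]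
      · intro heA
        have hkey : ∀ y, y ∉ e → insert u (insert y e) ∈ K.faces → v = y → False := by
          rintro y hy hf rfl
          apply heA
          intro x hx
          rw [hAm]
          refine ⟨huv.1, fun e => hue (e ▸ hx), fun e => hy (e ▸ hx), down hf ?_ (by simp)⟩
          intro c hc
          simp only [Finset.mem_insert, Finset.mem_singleton] at hc ⊢
          rcases hc with rfl | rfl | rfl <;> simp [hx]
        have h4 : ¬ v = y := hkey y hye hf
        have h5 : ¬ v = y' := hkey y' hye' hf'
        simp [Finset.mem_insert, h4, h5]

end SComplex

namespace SComplex

/-- data for contracting an edge -/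
structure Ctr (K : SComplex) where
  hK : Nrm K
  u : ℕ
  v : ℕ
  w : ℕ
  uv : NK K u v
  hw : {w} ∉ K.faces
  lcd : ∀ σ : Finset ℕ, u ∉ σ → v ∉ σ → insert u σ ∈ K.faces → insert v σ ∈ K.faces →
    insert u (insert v σ) ∈ K.faces

namespace Ctr
variable {K : SComplex} (X : Ctr K)

/-- exchange the ends -/
def swap : Ctr K := ⟨X.hK, X.v, X.u, X.w, X.uv.symm, X.hw, fun σ h1 h2 h3 h4 => by
  rw [Finset.insert_comm]; exact X.lcd σ h2 h1 h4 h3⟩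

theorem wn {s : Finset ℕ} (hs : s ∈ K.faces) : X.w ∉ s :=
  fun h => X.hw (down hs (by simpa using h) (by simp))

theorem wu : X.w ≠ X.u := by
  have := X.wn X.uv.2
  simp only [Finset.mem_insert, not_or] at this
  exact this.1

theorem wv : X.w ≠ X.v := by
  have := X.wn X.uv.2
  simp only [Finset.mem_insert, Finset.mem_singleton, not_or] at this
  exact this.2

/-- faces of the link of the new vertex -/
def U (σ : Finset ℕ) : Prop := insert X.u σ ∈ K.faces ∨ insert X.v σ ∈ K.faces

theorem U.mono {X : Ctr K} {σ τ : Finset ℕ} (h : X.U τ) (hs : σ ⊆ τ) : X.U σ := by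
  rcases h with h | h
  · exact Or.inl (down h (Finset.insert_subset_insert _ hs) (by simp))
  · exact Or.inr (down h (Finset.insert_subset_insert _ hs) (by simp))

theorem U.wn {X : Ctr K} {σ : Finset ℕ} (h : X.U σ) : X.w ∉ σ := by
  intro hh
  rcases h with h | h
  · exact X.wn h (Finset.mem_insert_of_mem hh)
  · exact X.wn h (Finset.mem_insert_of_mem hh)

theorem U.face {X : Ctr K} {σ : Finset ℕ} (h : X.U σ) (hne : σ.Nonempty) : σ ∈ K.faces := by
  rcases h with h | h
  · exact down h (Finset.subset_insert _ _) hne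
  · exact down h (Finset.subset_insert _ _) hne

theorem swapU {σ : Finset ℕ} : X.swap.U σ ↔ X.U σ := or_comm

/-- no triangle is joined to both ends -/
theorem notboth {r : Finset ℕ} (h3 : r.card = 3) (hu : X.u ∉ r) (hv : X.v ∉ r)
    (h1 : insert X.u r ∈ K.faces) (h2 : insert X.v r ∈ K.faces) : False := by
  have := X.hK.le _ (X.lcd r hu hv h1 h2)
  rw [Finset.card_insert_of_notMem, Finset.card_insert_of_notMem hv, h3] at this
  · omega
  · rw [Finset.mem_insert, not_or]; exact ⟨X.uv.1, hu⟩

theorem facet {σ : Finset ℕ} (hu : X.u ∉ σ) (hv : X.v ∉ σ) (h : insert X.u σ ∈ K.faces) :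
    ∃ r, r.card = 3 ∧ X.u ∉ r ∧ X.v ∉ r ∧ σ ⊆ r ∧ insert X.u r ∈ K.faces := by
  obtain ⟨F, hF, hs, h4⟩ := X.hK.ext _ h
  have huF : X.u ∈ F := hs (by simp)
  have hσF : σ ⊆ F := (Finset.subset_insert _ _).trans hs
  by_cases hvF : X.v ∈ F
  · have hG3 : (F.erase X.v).card = 3 := by rw [Finset.card_erase_of_mem hvF, h4]
    have hGK : F.erase X.v ∈ K.faces := down hF (Finset.erase_subset _ _) (Finset.card_pos.1 (by omega))
    obtain ⟨a, b, hab, hall⟩ := X.hK.two _ hGK hG3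
    have hva := (hall X.v).1 ⟨by simp, by rwa [Finset.insert_erase hvF]⟩
    have : ∃ c, c ≠ X.v ∧ c ∉ F.erase X.v ∧ insert c (F.erase X.v) ∈ K.faces := by
      rcases hva with h | h
      · exact ⟨b, by rw [h]; exact hab.symm, (hall b).2 (Or.inr rfl)⟩
      · exact ⟨a, by rw [h]; exact hab, (hall a).2 (Or.inl rfl)⟩
    obtain ⟨c, hcv, hcG, hcK⟩ := this
    have huG : X.u ∈ F.erase X.v := by rw [Finset.mem_erase]; exact ⟨X.uv.1, huF⟩
    have huc : X.u ≠ c := fun h => hcG (h ▸ huG)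
    have he : insert X.u ((insert c (F.erase X.v)).erase X.u) = insert c (F.erase X.v) :=
      Finset.insert_erase (by simp [huG])
    refine ⟨(insert c (F.erase X.v)).erase X.u, ?_, by simp, ?_, ?_, ?_⟩
    · rw [Finset.card_erase_of_mem (by simp [huG]), Finset.card_insert_of_notMem hcG, hG3]
    · simp [Ne.symm hcv]
    · intro x hx
      have h1 : x ≠ X.u := fun e => hu (e ▸ hx)
      have h2 : x ≠ X.v := fun e => hv (e ▸ hx)
      simp [h1, h2, hσF hx]
    · rwa [he]
  · refine ⟨F.erase X.u, by rw [Finset.card_erase_of_mem huF, h4], by simp, ?_, ?_, ?_⟩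
    · simp [hvF]
    · intro x hx
      rw [Finset.mem_erase]
      exact ⟨fun e => hu (e ▸ hx), hσF hx⟩
    · rwa [Finset.insert_erase huF]

theorem facetU {σ : Finset ℕ} (hu : X.u ∉ σ) (hv : X.v ∉ σ) (h : X.U σ) :
    ∃ r, r.card = 3 ∧ X.u ∉ r ∧ X.v ∉ r ∧ σ ⊆ r ∧ X.U r := by
  rcases h with h | h
  · obtain ⟨r, h1, h2, h3, h4, h5⟩ := X.facet hu hv h
    exact ⟨r, h1, h2, h3, h4, Or.inl h5⟩
  · obtain ⟨r, h1, h2, h3, h4, h5⟩ := X.swap.facet hv hu h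
    exact ⟨r, h1, h3, h2, h4, Or.inr h5⟩

/-- faces of the contraction -/
def P1 (s : Finset ℕ) : Prop := s ≠ ∅ ∧ X.u ∉ s ∧ X.v ∉ s ∧ (s ∈ K.faces ∨ (X.w ∈ s ∧ X.U (s.erase X.w)))

theorem P1_down : ∀ s, X.P1 s → ∀ r ⊆ s, r ≠ ∅ → X.P1 r := by
  rintro s ⟨-, hu, hv, hs⟩ r hr hne
  refine ⟨hne, fun h => hu (hr h), fun h => hv (hr h), ?_⟩
  have hne' := Finset.nonempty_iff_ne_empty.2 hne
  rcases hs with h | ⟨h1, h2⟩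
  · exact Or.inl (down h hr hne')
  · by_cases hw : X.w ∈ r
    · exact Or.inr ⟨hw, h2.mono (Finset.erase_subset_erase _ hr)⟩
    · left
      refine U.face (X := X) (h2.mono ?_) hne'
      intro x hx
      rw [Finset.mem_erase]
      exact ⟨fun e => hw (e ▸ hx), hr hx⟩

open scoped Classical in
/-- the contraction -/
noncomputable def K1 : SComplex :=
  ofPred (insert X.w K.vertexSet) X.P1 (fun h => h.1 rfl) X.P1_down

theorem mem_K1 (s : Finset ℕ) : s ∈ X.K1.faces ↔ X.P1 s := by
  classical
  apply mem_ofPred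
  rintro s ⟨-, hu, hv, h | ⟨h1, h2⟩⟩
  · exact (sub_vertexSet h).trans (Finset.subset_insert _ _)
  · intro x hx
    by_cases hxw : x = X.w
    · simp [hxw]
    · rw [Finset.mem_insert]; right
      have : X.U {x} := h2.mono (by simp [hx, hxw])
      exact mem_vertexSet.2 (this.face (by simp))

theorem m0 {s : Finset ℕ} (h : X.w ∉ s) : s ∈ X.K1.faces ↔ s ∈ K.faces ∧ X.u ∉ s ∧ X.v ∉ s := by
  rw [mem_K1, P1]
  constructor
  · rintro ⟨-, h1, h2, h3 | h3⟩
    · exact ⟨h3, h1, h2⟩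
    · exact absurd h3.1 h
  · rintro ⟨h1, h2, h3⟩
    exact ⟨(face_ne h1).ne_empty, h2, h3, Or.inl h1⟩

theorem m1 {σ : Finset ℕ} (h : X.w ∉ σ) :
    insert X.w σ ∈ X.K1.faces ↔ X.u ∉ σ ∧ X.v ∉ σ ∧ X.U σ := by
  rw [mem_K1, P1, Finset.erase_insert h]
  simp only [Finset.mem_insert, not_or]
  constructor
  · rintro ⟨-, h1, h2, h3 | h3⟩
    · exact absurd (Finset.mem_insert_self _ _) (X.wn h3)
    · exact ⟨h1.2, h2.2, h3.2⟩
  · rintro ⟨h1, h2, h3⟩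
    exact ⟨by simp, ⟨X.wu.symm, h1⟩, ⟨X.wv.symm, h2⟩, Or.inr ⟨Or.inl trivial, h3⟩⟩

theorem casesK1 {s : Finset ℕ} (hs : s ∈ X.K1.faces) :
    (X.w ∉ s ∧ s ∈ K.faces ∧ X.u ∉ s ∧ X.v ∉ s) ∨
      ∃ σ, s = insert X.w σ ∧ X.w ∉ σ ∧ X.u ∉ σ ∧ X.v ∉ σ ∧ X.U σ := by
  by_cases h : X.w ∈ s
  · right
    refine ⟨s.erase X.w, (Finset.insert_erase h).symm, by simp, ?_⟩
    rwa [← Finset.insert_erase h, X.m1 (by simp)] at hs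
  · exact Or.inl ⟨h, (X.m0 h).1 hs⟩

theorem K1_le (s : Finset ℕ) (hs : s ∈ X.K1.faces) : s.card ≤ 4 := by
  rcases X.casesK1 hs with ⟨h, h1, -⟩ | ⟨σ, rfl, h1, h2, h3, h4⟩
  · exact X.hK.le _ h1
  · rw [Finset.card_insert_of_notMem h1]
    rcases h4 with h4 | h4
    · have := X.hK.le _ h4
      rwa [Finset.card_insert_of_notMem h2] at this
    · have := X.hK.le _ h4
      rwa [Finset.card_insert_of_notMem h3] at this

theorem K1_ext (s : Finset ℕ) (hs : s ∈ X.K1.faces) : ∃ F ∈ X.K1.faces, s ⊆ F ∧ F.card = 4 := by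
  have key : ∀ σ, X.u ∉ σ → X.v ∉ σ → X.U σ → ∃ F ∈ X.K1.faces, insert X.w σ ⊆ F ∧ F.card = 4 := by
    intro σ h2 h3 h4
    obtain ⟨r, a1, a2, a3, a4, a5⟩ := X.facetU h2 h3 h4
    refine ⟨insert X.w r, (X.m1 a5.wn).2 ⟨a2, a3, a5⟩, Finset.insert_subset_insert _ a4, ?_⟩
    rw [Finset.card_insert_of_notMem a5.wn, a1]
  rcases X.casesK1 hs with ⟨h, h1, h2, h3⟩ | ⟨σ, rfl, h1, h2, h3, h4⟩
  · obtain ⟨F, hF, hsF, h4⟩ := X.hK.ext s h1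
    by_cases hU : X.U s
    · obtain ⟨G, hG, h5, h6⟩ := key s h2 h3 hU
      exact ⟨G, hG, (Finset.subset_insert _ _).trans h5, h6⟩
    · refine ⟨F, (X.m0 (X.wn hF)).2 ⟨hF, ?_, ?_⟩, hsF, h4⟩
      · intro hh
        exact hU (Or.inl (down hF (Finset.insert_subset hh hsF) (by simp)))
      · intro hh
        exact hU (Or.inr (down hF (Finset.insert_subset hh hsF) (by simp)))
  · exact key σ h2 h3 h4

/-- apices over an edge seen from one end only -/
theorem two_one {e : Finset ℕ} (h2 : e.card = 2) (hu : X.u ∉ e) (hv : X.v ∉ e)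
    (h1 : insert X.u e ∈ K.faces) (hn : insert X.v e ∉ K.faces) :
    ∃ a b, a ≠ b ∧ ∀ y, (y ∉ e ∧ X.u ∉ insert y e ∧ X.v ∉ insert y e ∧ X.U (insert y e)) ↔ y = a ∨ y = b := by
  obtain ⟨a, b, hab, hall⟩ := X.hK.two _ h1 (by rw [Finset.card_insert_of_notMem hu, h2])
  refine ⟨a, b, hab, fun y => ?_⟩
  rw [← hall]
  simp only [Finset.mem_insert, not_or]
  constructor
  · rintro ⟨h3, h4, h5, h6 | h6⟩
    · exact ⟨⟨Ne.symm h4.1, h3⟩, by rwa [Finset.insert_comm]⟩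
    · exact absurd (down h6 (Finset.insert_subset_insert _ (Finset.subset_insert _ _)) (by simp)) hn
  · rintro ⟨⟨h3, h4⟩, h5⟩
    refine ⟨h4, ⟨Ne.symm h3, hu⟩, ⟨?_, hv⟩, Or.inl (by rwa [Finset.insert_comm])⟩
    rintro rfl
    exact hn (down h5 (Finset.insert_subset_insert _ (Finset.subset_insert _ _)) (by simp))

/-- the second apex -/
theorem second {e : Finset ℕ} (h2 : e.card = 2) (hu : X.u ∉ e) (hv : X.v ∉ e)
    (h1 : insert X.u (insert X.v e) ∈ K.faces) :
    ∃ a, ∀ y, (y ∉ e ∧ y ≠ X.u ∧ y ≠ X.v ∧ insert X.u (insert y e) ∈ K.faces) ↔ y = a := by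
  have h1' : insert X.u e ∈ K.faces :=
    down h1 (Finset.insert_subset_insert _ (Finset.subset_insert _ _)) (by simp)
  obtain ⟨a, b, hab, hall⟩ := X.hK.two _ h1' (by rw [Finset.card_insert_of_notMem hu, h2])
  have h3 := (hall X.v).1 ⟨by simp [X.uv.1.symm, hv], by rwa [Finset.insert_comm]⟩
  have : ∀ y, (y ∉ e ∧ y ≠ X.u ∧ y ≠ X.v ∧ insert X.u (insert y e) ∈ K.faces) ↔
      (y ≠ X.v ∧ (y = a ∨ y = b)) := by
    intro y
    rw [← hall, Finset.insert_comm y]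
    simp only [Finset.mem_insert, not_or]
    tauto
  rcases h3 with h3 | h3
  · refine ⟨b, fun y => ?_⟩
    rw [this, h3]; grind
  · refine ⟨a, fun y => ?_⟩
    rw [this, h3]; grind

theorem K1_two (s : Finset ℕ) (hs : s ∈ X.K1.faces) (h3 : s.card = 3) :
    ∃ a b, a ≠ b ∧ ∀ y, (y ∉ s ∧ insert y s ∈ X.K1.faces) ↔ y = a ∨ y = b := by
  rcases X.casesK1 hs with ⟨hw, h1, hu, hv⟩ | ⟨e, rfl, hwe, hu, hv, hU⟩
  · obtain ⟨a, b, hab, hall⟩ := X.hK.two s h1 h3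
    have ha := (hall a).2 (Or.inl rfl)
    have hb := (hall b).2 (Or.inr rfl)
    have haw : a ≠ X.w := fun e => X.wn ha.2 (by simp [e])
    have hbw : b ≠ X.w := fun e => X.wn hb.2 (by simp [e])
    have hUs : X.U s ↔ (X.u = a ∨ X.u = b) ∨ (X.v = a ∨ X.v = b) := by
      rw [← hall, ← hall, U]; tauto
    have hnb : ¬ ((X.u = a ∨ X.u = b) ∧ (X.v = a ∨ X.v = b)) := by
      rw [← hall, ← hall]
      rintro ⟨h5, h6⟩
      exact X.notboth h3 hu hv h5.2 h6.2
    have hnew : ∀ y, (y ∉ s ∧ insert y s ∈ X.K1.faces) ↔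
        ((y = a ∨ y = b) ∧ y ≠ X.u ∧ y ≠ X.v) ∨ (y = X.w ∧ X.U s) := by
      intro y
      by_cases hy : y = X.w
      · subst hy
        rw [X.m1 hw]
        constructor
        · rintro ⟨-, -, -, h5⟩
          exact Or.inr ⟨rfl, h5⟩
        · rintro (⟨h5 | h5, -⟩ | ⟨-, h5⟩)
          · exact absurd h5.symm haw
          · exact absurd h5.symm hbw
          · exact ⟨hw, hu, hv, h5⟩
      · rw [X.m0 (by simp [Ne.symm hy, hw]), ← hall]
        simp only [Finset.mem_insert, not_or]
        constructor
        · rintro ⟨h4, h5, h6, h7⟩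
          exact Or.inl ⟨⟨h4, h5⟩, Ne.symm h6.1, Ne.symm h7.1⟩
        · rintro (⟨⟨h4, h5⟩, h6, h7⟩ | ⟨h5, -⟩)
          · exact ⟨h4, h5, ⟨Ne.symm h6, hu⟩, ⟨Ne.symm h7, hv⟩⟩
          · exact absurd h5 hy
    have huv := X.uv.1
    simp only [hnew, hUs]
    by_cases hau : a = X.u ∨ a = X.v
    · refine ⟨X.w, b, hbw.symm, fun y => ?_⟩
      grind
    · by_cases hbu : b = X.u ∨ b = X.v
      · refine ⟨X.w, a, haw.symm, fun y => ?_⟩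
        grind
      · refine ⟨a, b, hab, fun y => ?_⟩
        grind
  · have he2 : e.card = 2 := by
      rw [Finset.card_insert_of_notMem hwe] at h3; omega
    have hnew : ∀ y, (y ∉ insert X.w e ∧ insert y (insert X.w e) ∈ X.K1.faces) ↔
        (y ∉ e ∧ X.u ∉ insert y e ∧ X.v ∉ insert y e ∧ X.U (insert y e)) := by
      intro y
      rw [Finset.mem_insert, not_or, Finset.insert_comm]
      constructor
      · rintro ⟨⟨h4, h5⟩, h6⟩
        refine ⟨h5, (X.m1 ?_).1 h6⟩
        rw [Finset.mem_insert, not_or]; exact ⟨Ne.symm h4, hwe⟩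
      · rintro ⟨h4, h5, h6, h7⟩
        have := h7.wn
        refine ⟨⟨?_, h4⟩, (X.m1 this).2 ⟨h5, h6, h7⟩⟩
        rw [Finset.mem_insert, not_or] at this
        exact Ne.symm this.1
    simp only [hnew]
    by_cases h1 : insert X.u e ∈ K.faces
    · by_cases h2 : insert X.v e ∈ K.faces
      · have huv := X.lcd e hu hv h1 h2
        obtain ⟨a, ha⟩ := X.second he2 hu hv huv
        obtain ⟨b, hb⟩ := X.swap.second he2 hv hu (by rw [Finset.insert_comm]; exact huv)
        change ∀ y, (y ∉ e ∧ y ≠ X.v ∧ y ≠ X.u ∧ insert X.v (insert y e) ∈ K.faces) ↔ y = b at hb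
        have ha' := (ha a).2 rfl
        have hb' := (hb b).2 rfl
        refine ⟨a, b, ?_, fun y => ?_⟩
        · rintro rfl
          exact X.notboth (r := insert a e) (by rw [Finset.card_insert_of_notMem ha'.1, he2])
            (by simp [ha'.2.1.symm, hu]) (by simp [ha'.2.2.1.symm, hv]) ha'.2.2.2 hb'.2.2.2
        · rw [← ha, ← hb, U]
          simp only [Finset.mem_insert, not_or, hu, hv, not_false_eq_true, and_true]
          have e1 : ¬ X.u = y ↔ y ≠ X.u := ne_comm
          have e2 : ¬ X.v = y ↔ y ≠ X.v := ne_comm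
          rw [e1, e2]
          tauto
      · exact X.two_one he2 hu hv h1 h2
    · have h2 := hU.resolve_left h1
      obtain ⟨a, b, hab, h⟩ := X.swap.two_one he2 hv hu h2 h1
      refine ⟨a, b, hab, fun y => ?_⟩
      rw [← h, swapU]
      change _ ↔ (y ∉ e ∧ X.v ∉ insert y e ∧ X.u ∉ insert y e ∧ X.U (insert y e))
      tauto

end Ctr
end SComplex

namespace SComplex

theorem noodd (C : Finset ℕ) (A : ℕ → ℕ → Prop) (hs : ∀ x y, A x y → A y x) (hi : ∀ x, ¬ A x x)
    (p : ℕ) (hp : p ∈ C) (h1 : ∃ a ∈ C, ∀ z ∈ C, A p z ↔ z = a)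
    (h2 : ∀ y ∈ C, y ≠ p → ∃ a ∈ C, ∃ b ∈ C, a ≠ b ∧ ∀ z ∈ C, A y z ↔ z = a ∨ z = b) : False := by
  classical
  let G : SimpleGraph {x // x ∈ C} :=
    { Adj := fun x y => A x y
      symm := ⟨fun x y h => hs _ _ h⟩
      loopless := ⟨fun x h => hi _ h⟩ }
  have d1 : Odd (G.degree ⟨p, hp⟩) := by
    obtain ⟨a, ha, h⟩ := h1
    have : G.neighborFinset ⟨p, hp⟩ = {⟨a, ha⟩} := by
      ext ⟨z, hz⟩
      rw [SimpleGraph.mem_neighborFinset, Finset.mem_singleton, Subtype.mk.injEq]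
      exact h z hz
    rw [← SimpleGraph.card_neighborFinset_eq_degree, this]
    simp
  obtain ⟨⟨y, hy⟩, hne, hodd⟩ := G.exists_ne_odd_degree_of_exists_odd_degree _ d1
  obtain ⟨a, ha, b, hb, hab, h⟩ := h2 y hy (by simpa using hne)
  have : G.neighborFinset ⟨y, hy⟩ = {⟨a, ha⟩, ⟨b, hb⟩} := by
    ext ⟨z, hz⟩
    rw [SimpleGraph.mem_neighborFinset, Finset.mem_insert, Finset.mem_singleton, Subtype.mk.injEq, Subtype.mk.injEq]
    exact h z hz
  rw [← SimpleGraph.card_neighborFinset_eq_degree, this, Finset.card_pair (by simpa using hab)] at hodd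
  exact absurd hodd (by decide)

/-- in the cycle around an edge, removing a vertex leaves its neighbours connected -/
theorem Nrm.cyc {K : SComplex} (hK : Nrm K) {u x v p q : ℕ} (S : ℕ → Prop)
    (hS : ∀ a b, a ≠ v → b ≠ v → QK K u x a b → S a → S b)
    (hp : QK K u x v p) (hq : QK K u x v q) (hSp : S p) : S q := by
  classical
  by_contra hSq
  have huxv : RK K u x v := hp.r
  obtain ⟨p', q', hne', hall'⟩ := hK.twoQ huxv
  have hpq : p ≠ q := fun e => hSq (e ▸ hSp)
  have hall : ∀ c, QK K u x v c ↔ c = p ∨ c = q := by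
    intro c
    have h1 := (hall' p).1 hp
    have h2 := (hall' q).1 hq
    rw [hall' c]
    rcases h1 with rfl | rfl <;> rcases h2 with rfl | rfl <;> tauto
  let C := K.vertexSet.filter fun y => RK K u x y ∧ y ≠ v ∧ S y
  have hC : ∀ y, y ∈ C ↔ RK K u x y ∧ y ≠ v ∧ S y := by
    intro y
    simp only [C, Finset.mem_filter, and_iff_right_iff_imp]
    intro h
    exact h.1.r23.n.mem
  have hnb : ∀ y ∈ C, ∀ z, z ≠ v → QK K u x y z → z ∈ C := by
    intro y hy z hz h
    rw [hC] at hy ⊢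
    exact ⟨h.q34.r, hz, hS y z hy.2.1 hz h hy.2.2⟩
  have hpC : p ∈ C := (hC p).2 ⟨hp.q34.r, hp.2.2.2.2.2.1.symm, hSp⟩
  refine noodd C (fun a b => QK K u x a b) (fun _ _ h => h.q34) (fun a h => h.2.2.2.2.2.1 rfl) p hpC ?_ ?_
  · obtain ⟨a, b, hab, h⟩ := hK.twoQ hp.q34.r
    have hv := (h v).1 hp.q34
    rcases hv with rfl | rfl
    · have hb := (h b).2 (Or.inr rfl)
      refine ⟨b, hnb p hpC b hab.symm hb, fun z hz => ?_⟩
      rw [h]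
      have := ((hC z).1 hz).2.1
      tauto
    · have hb := (h a).2 (Or.inl rfl)
      refine ⟨a, hnb p hpC a hab hb, fun z hz => ?_⟩
      rw [h]
      have := ((hC z).1 hz).2.1
      tauto
  · intro y hy hyp
    have hy' := (hC y).1 hy
    obtain ⟨a, b, hab, h⟩ := hK.twoQ hy'.1
    have hnv : ¬ QK K u x y v := by
      intro hh
      rcases (hall y).1 hh.q34 with e | e
      · exact hyp e
      · exact hSq (e ▸ hy'.2.2)
    have ha := (h a).2 (Or.inl rfl)
    have hb := (h b).2 (Or.inr rfl)
    exact ⟨a, hnb y hy a (fun e => hnv (e ▸ ha)) ha, b, hnb y hy b (fun e => hnv (e ▸ hb)) hb, hab,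
      fun z _ => h z⟩

namespace Ctr
variable {K : SComplex} (X : Ctr K)

theorem LC0 {s : Finset ℕ} (hw : X.w ∉ s) (hu : X.u ∉ s) (hv : X.v ∉ s) (hL : LC K s) :
    LC X.K1 s := by
  classical
  intro S hS
  let S2 : ℕ → Prop := fun y => if y = X.u ∨ y = X.v then S X.w else S y
  have hpos : ∀ y, (y = X.u ∨ y = X.v) → (S2 y ↔ S X.w) := fun y h => by simp only [S2, if_pos h]
  have hneg : ∀ y, ¬ (y = X.u ∨ y = X.v) → (S2 y ↔ S y) := fun y h => by simp only [S2, if_neg h]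
  have hUof : ∀ a τ, (a = X.u ∨ a = X.v) → insert a τ ∈ K.faces → X.U τ := by
    rintro a τ (rfl | rfl) h
    · exact Or.inl h
    · exact Or.inr h
  have hnw : ∀ a b, insert a (insert b s) ∈ K.faces → X.w ≠ a ∧ X.w ≠ b := by
    intro a b h
    have := X.wn h
    simp only [Finset.mem_insert, not_or] at this
    exact ⟨this.1, this.2.1⟩
  have hcl : ∀ a b, a ∉ s → b ∉ s → insert a (insert b s) ∈ K.faces → S2 a → S2 b := by
    intro a b ha hb hab h
    obtain ⟨hwa, hwb⟩ := hnw a b hab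
    by_cases h1 : a = X.u ∨ a = X.v
    · rw [hpos a h1] at h
      by_cases h2 : b = X.u ∨ b = X.v
      · rwa [hpos b h2]
      · rw [hneg b h2]
        refine hS X.w b hw hb ?_ h
        rw [X.m1 (by simp [hwb, hw])]
        rw [not_or] at h2
        exact ⟨by simp [Ne.symm h2.1, hu], by simp [Ne.symm h2.2, hv], hUof a _ h1 hab⟩
    · rw [hneg a h1] at h
      by_cases h2 : b = X.u ∨ b = X.v
      · rw [hpos b h2]
        refine hS a X.w ha hw ?_ h
        rw [Finset.insert_comm, X.m1 (by simp [hwa, hw])]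
        rw [not_or] at h1
        exact ⟨by simp [Ne.symm h1.1, hu], by simp [Ne.symm h1.2, hv],
          hUof b _ h2 (by rwa [Finset.insert_comm])⟩
      · rw [hneg b h2]
        refine hS a b ha hb ?_ h
        rw [not_or] at h1 h2
        rw [X.m0 (by simp [hwa, hwb, hw])]
        exact ⟨hab, by simp [Ne.symm h1.1, Ne.symm h2.1, hu], by simp [Ne.symm h1.2, Ne.symm h2.2, hv]⟩
  have lift : ∀ a, a ∉ s → insert a s ∈ X.K1.faces → ∃ c, c ∉ s ∧ insert c s ∈ K.faces ∧ (S2 c ↔ S a) := by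
    intro a ha h
    by_cases haw : a = X.w
    · subst haw
      rcases ((X.m1 hw).1 h).2.2 with h | h
      · exact ⟨X.u, hu, h, hpos _ (Or.inl rfl)⟩
      · exact ⟨X.v, hv, h, hpos _ (Or.inr rfl)⟩
    · rw [X.m0 (by simp [Ne.symm haw, hw])] at h
      simp only [Finset.mem_insert, not_or] at h
      refine ⟨a, ha, h.1, hneg a ?_⟩
      rw [not_or]
      exact ⟨Ne.symm h.2.1.1, Ne.symm h.2.2.1⟩
  intro a b ha hb h1 h2 h
  obtain ⟨c, c1, c2, c3⟩ := lift a ha h1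
  obtain ⟨d, d1, d2, d3⟩ := lift b hb h2
  exact d3.1 (hL S2 hcl c d c1 d1 c2 d2 (c3.2 h))

/-- all vertices seen from `u` are on the same side -/
theorem side {σ : Finset ℕ} (hσ : σ.card ≤ 1) (hu : X.u ∉ σ) (hv : X.v ∉ σ) (S : ℕ → Prop)
    (hS : ∀ a b, a ∉ σ → b ∉ σ → a ≠ X.u → b ≠ X.u → a ≠ X.v → b ≠ X.v →
      X.U (insert a (insert b σ)) → S a → S b)
    (h1 : insert X.u (insert X.v σ) ∈ K.faces) (τ : Prop)
    (hE : ∀ e, e ∉ σ → e ≠ X.u → e ≠ X.v → insert X.u (insert X.v (insert e σ)) ∈ K.faces → (S e ↔ τ))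
    (a : ℕ) (ha : a ∉ σ) (hau : a ≠ X.u) (hav : a ≠ X.v) (haf : insert X.u (insert a σ) ∈ K.faces) :
    S a ↔ τ := by
  classical
  let S2 : ℕ → Prop := fun y => if y = X.v then τ else S y
  have hpos : S2 X.v ↔ τ := by simp only [S2, if_true]
  have hneg : ∀ y, y ≠ X.v → (S2 y ↔ S y) := fun y h => by simp only [S2, if_neg h]
  have hu2 : insert X.u σ ∈ K.faces :=
    down h1 (Finset.insert_subset_insert _ (Finset.subset_insert _ _)) (by simp)
  have hL := X.hK.lc (insert X.u σ) (by rw [Finset.card_insert_of_notMem hu]; omega) (Or.inr hu2) S2 (by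
    intro a b ha hb hab h
    simp only [Finset.mem_insert, not_or] at ha hb
    by_cases h1 : a = X.v
    · subst h1
      rw [hpos] at h
      by_cases h2 : b = X.v
      · rw [h2, hpos]; exact h
      · rw [hneg b h2, hE b hb.2 hb.1 h2 ?_]; exact h
        rw [Finset.insert_comm, Finset.insert_comm X.u]; exact hab
    · rw [hneg a h1] at h
      by_cases h2 : b = X.v
      · subst h2
        rw [hpos, ← hE a ha.2 ha.1 h1 ?_]; exact h
        convert hab using 1
        ext; simp; tauto
      · rw [hneg b h2]
        refine hS a b ha.2 hb.2 ha.1 hb.1 h1 h2 (Or.inl ?_) h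
        convert hab using 1
        ext; simp; tauto)
  have e1 : a ∉ insert X.u σ := by simp [hau, ha]
  have e2 : X.v ∉ insert X.u σ := by simp [X.uv.1.symm, hv]
  have e3 : insert a (insert X.u σ) ∈ K.faces := by rwa [Finset.insert_comm]
  have e4 : insert X.v (insert X.u σ) ∈ K.faces := by rwa [Finset.insert_comm]
  have l1 := hL a X.v e1 e2 e3 e4
  have l2 := hL X.v a e2 e1 e4 e3
  rw [hpos, hneg a hav] at l1 l2
  exact ⟨l1, l2⟩

theorem claimE {σ : Finset ℕ} (hσ : σ.card ≤ 1) (hu : X.u ∉ σ) (hv : X.v ∉ σ) (S : ℕ → Prop)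
    (hS : ∀ a b, a ∉ σ → b ∉ σ → a ≠ X.u → b ≠ X.u → a ≠ X.v → b ≠ X.v →
      X.U (insert a (insert b σ)) → S a → S b)
    (e f : ℕ) (he : e ∉ σ) (heu : e ≠ X.u) (hev : e ≠ X.v) (hef : insert X.u (insert X.v (insert e σ)) ∈ K.faces)
    (hf : f ∉ σ) (hfu : f ≠ X.u) (hfv : f ≠ X.v) (hff : insert X.u (insert X.v (insert f σ)) ∈ K.faces)
    (h : S e) : S f := by
  rcases Nat.lt_or_ge σ.card 1 with h0 | h0
  · obtain rfl : σ = ∅ := Finset.card_eq_zero.1 (by omega)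
    have := X.hK.lc {X.u, X.v} (by rw [Finset.card_pair X.uv.1]) (Or.inr X.uv.2) S (by
      intro a b ha hb hab h
      simp only [Finset.mem_insert, Finset.mem_singleton, not_or] at ha hb
      refine hS a b (by simp) (by simp) ha.1 hb.1 ha.2 hb.2 (Or.inl (down hab ?_ (by simp))) h
      intro z; simp; tauto)
    refine this e f (by simp [heu, hev]) (by simp [hfu, hfv]) ?_ ?_ h
    · convert hef using 1; ext; simp; tauto
    · convert hff using 1; ext; simp; tauto
  · obtain ⟨x, rfl⟩ := Finset.card_eq_one.1 (le_antisymm hσ h0)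
    simp only [Finset.mem_singleton] at hu hv he hf
    refine X.hK.cyc (u := X.u) (x := x) (v := X.v) S ?_ (p := e) (q := f) ?_ ?_ h
    · intro a b ha hb hab h
      refine hS a b (by simpa using hab.2.2.2.1.symm) (by simpa using hab.2.2.2.2.1.symm) hab.2.1.symm hab.2.2.1.symm ha hb (Or.inl ?_) h
      convert hab.2.2.2.2.2.2 using 1; ext; simp; tauto
    · refine ⟨hu, X.uv.1, heu.symm, Ne.symm hv, Ne.symm he, hev.symm, ?_⟩
      convert hef using 1; ext; simp; tauto
    · refine ⟨hu, X.uv.1, hfu.symm, Ne.symm hv, Ne.symm hf, hfv.symm, ?_⟩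
      convert hff using 1; ext; simp; tauto

theorem one_side {σ : Finset ℕ} (hσ : σ.card ≤ 1) (hu : X.u ∉ σ) (hv : X.v ∉ σ) (S : ℕ → Prop)
    (hS : ∀ a b, a ∉ σ → b ∉ σ → a ≠ X.u → b ≠ X.u → a ≠ X.v → b ≠ X.v →
      X.U (insert a (insert b σ)) → S a → S b)
    (h1 : insert X.u σ ∈ K.faces) (h2 : insert X.v σ ∉ K.faces) (a b : ℕ)
    (ha : a ∉ σ) (hb : b ∉ σ) (hau : a ≠ X.u) (hbu : b ≠ X.u) (haf : X.U (insert a σ)) (hbf : X.U (insert b σ))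
    (h : S a) : S b := by
  have hred : ∀ c, X.U (insert c σ) → insert c (insert X.u σ) ∈ K.faces := by
    rintro c (hc | hc)
    · rwa [Finset.insert_comm]
    · exact absurd (down hc (Finset.insert_subset_insert _ (Finset.subset_insert _ _)) (by simp)) h2
  refine X.hK.lc (insert X.u σ) (by rw [Finset.card_insert_of_notMem hu]; omega) (Or.inr h1) S ?_ a b
    (by simp [hau, ha]) (by simp [hbu, hb]) (hred a haf) (hred b hbf) h
  intro a b ha hb hab h
  simp only [Finset.mem_insert, not_or] at ha hb
  refine hS a b ha.2 hb.2 ha.1 hb.1 ?_ ?_ (Or.inl ?_) h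
  · rintro rfl
    exact h2 (down hab (by intro z; simp; tauto) (by simp))
  · rintro rfl
    exact h2 (down hab (by intro z; simp; tauto) (by simp))
  · convert hab using 1; ext; simp; tauto

theorem LC1 {σ : Finset ℕ} (hσ : σ.card ≤ 1) (hw : X.w ∉ σ) (hu : X.u ∉ σ) (hv : X.v ∉ σ) (hU : X.U σ) :
    LC X.K1 (insert X.w σ) := by
  intro S hS' a b ha hb haf hbf h
  have hS : ∀ a b, a ∉ σ → b ∉ σ → a ≠ X.u → b ≠ X.u → a ≠ X.v → b ≠ X.v →
      X.U (insert a (insert b σ)) → S a → S b := by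
    intro a b h1 h2 h3 h4 h5 h6 h7 h8
    have hwn := h7.wn
    have hwn' := hwn
    simp only [Finset.mem_insert, not_or] at hwn'
    refine hS' a b (by simp [Ne.symm hwn'.1, h1]) (by simp [Ne.symm hwn'.2.1, h2]) ?_ h8
    have : insert a (insert b (insert X.w σ)) = insert X.w (insert a (insert b σ)) := by
      ext; simp; tauto
    rw [this, X.m1 hwn]
    exact ⟨by simp [h3.symm, h4.symm, hu], by simp [h5.symm, h6.symm, hv], h7⟩
  simp only [Finset.mem_insert, not_or] at ha hb
  have conv : ∀ a, a ≠ X.w → insert a (insert X.w σ) ∈ X.K1.faces → a ≠ X.u ∧ a ≠ X.v ∧ X.U (insert a σ) := by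
    intro a ha h
    rw [Finset.insert_comm, X.m1 (by simp [Ne.symm ha, hw])] at h
    simp only [Finset.mem_insert, not_or] at h
    exact ⟨Ne.symm h.1.1, Ne.symm h.2.1.1, h.2.2⟩
  obtain ⟨a1, a2, a3⟩ := conv a ha.1 haf
  obtain ⟨b1, b2, b3⟩ := conv b hb.1 hbf
  have hSs : ∀ a b, a ∉ σ → b ∉ σ → a ≠ X.swap.u → b ≠ X.swap.u → a ≠ X.swap.v → b ≠ X.swap.v →
      X.swap.U (insert a (insert b σ)) → S a → S b :=
    fun a b h1 h2 h3 h4 h5 h6 h7 => hS a b h1 h2 h5 h6 h3 h4 (X.swapU.1 h7)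
  by_cases h1 : insert X.u σ ∈ K.faces
  · by_cases h2 : insert X.v σ ∈ K.faces
    · have h12 := X.lcd σ hu hv h1 h2
      have : ∃ e0, e0 ∉ σ ∧ e0 ≠ X.u ∧ e0 ≠ X.v ∧ insert X.u (insert X.v (insert e0 σ)) ∈ K.faces := by
        obtain ⟨F, hF, hs, h4⟩ := X.hK.ext _ h12
        have hc : (insert X.u (insert X.v σ)).card < F.card := by
          have := Finset.card_insert_le X.u (insert X.v σ)
          have := Finset.card_insert_le X.v σ
          omega
        obtain ⟨e0, he, hn⟩ := Finset.exists_mem_notMem_of_card_lt_card hc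
        simp only [Finset.mem_insert, not_or] at hn
        refine ⟨e0, hn.2.2, hn.1, hn.2.1, down hF ?_ (by simp)⟩
        intro z hz
        simp only [Finset.mem_insert] at hz
        rcases hz with rfl | rfl | rfl | hz
        · exact hs (by simp)
        · exact hs (by simp)
        · exact he
        · exact hs (by simp [hz])
      obtain ⟨e0, n1, n2, n3, n4⟩ := this
      have hE : ∀ e, e ∉ σ → e ≠ X.u → e ≠ X.v → insert X.u (insert X.v (insert e σ)) ∈ K.faces → (S e ↔ S e0) :=
        fun e m1 m2 m3 m4 => ⟨X.claimE hσ hu hv S hS e e0 m1 m2 m3 m4 n1 n2 n3 n4,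
          X.claimE hσ hu hv S hS e0 e n1 n2 n3 n4 m1 m2 m3 m4⟩
      have key : ∀ a, a ∉ σ → a ≠ X.u → a ≠ X.v → X.U (insert a σ) → (S a ↔ S e0) := by
        rintro a c1 c2 c3 (c4 | c4)
        · exact X.side hσ hu hv S hS h12 _ hE a c1 c2 c3 c4
        · refine X.swap.side hσ hv hu S hSs ?_ _ ?_ a c1 c3 c2 c4
          · rw [Finset.insert_comm]; exact h12
          · intro e m1 m2 m3 m4
            rw [Finset.insert_comm] at m4
            exact hE e m1 m3 m2 m4
      exact (key b hb.2 b1 b2 b3).2 ((key a ha.2 a1 a2 a3).1 h)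
    · exact X.one_side hσ hu hv S hS h1 h2 a b ha.2 hb.2 a1 b1 a3 b3 h
  · exact X.swap.one_side hσ hv hu S hSs (hU.resolve_left h1) h1 a b ha.2 hb.2 a2 b2
      (X.swapU.2 a3) (X.swapU.2 b3) h

theorem K1_nrm : Nrm X.K1 where
  ne := ⟨insert X.w ∅, (X.m1 (by simp)).2 ⟨by simp, by simp, Or.inl (down X.uv.2 (by simp) (by simp))⟩⟩
  ext := X.K1_ext
  le := X.K1_le
  two := X.K1_two
  lc := by
    rintro s h2 (rfl | hs)
    · exact X.LC0 (by simp) (by simp) (by simp) (X.hK.lc ∅ (by simp) (Or.inl rfl))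
    · rcases X.casesK1 hs with ⟨hw, h1, hu, hv⟩ | ⟨e, rfl, hwe, hu, hv, hU⟩
      · exact X.LC0 hw hu hv (X.hK.lc s h2 (Or.inr h1))
      · refine X.LC1 ?_ hwe hu hv hU
        rw [Finset.card_insert_of_notMem hwe] at h2; omega

end Ctr
end SComplex

namespace SComplex
namespace Ctr
variable {K : SComplex} (X : Ctr K)

theorem bdry (s : Finset ℕ) : s ∈ bdryFaces (K.faces.filter fun α => X.u ∉ α ∧ X.v ∉ α) 3 ↔
    s ≠ ∅ ∧ X.u ∉ s ∧ X.v ∉ s ∧ X.U s := by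
  rw [bdryFaces, Finset.mem_filter, Finset.mem_filter]
  constructor
  · rintro ⟨⟨h1, h2, h3⟩, r, hr, hsr, hr3, hc⟩
    refine ⟨(face_ne h1).ne_empty, h2, h3, U.mono (X := X) (τ := r) ?_ hsr⟩
    rw [card_one_iff _ _ hr3] at hc
    obtain ⟨a, ha⟩ := hc
    rw [Finset.mem_filter] at hr
    obtain ⟨p, q, hpq, hall⟩ := X.hK.two r hr.1 hr3
    have hp := (hall p).2 (Or.inl rfl)
    have hq := (hall q).2 (Or.inr rfl)
    by_contra hU
    rw [U, not_or] at hU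
    have key : ∀ y, y ∉ r → insert y r ∈ K.faces → y = a := by
      intro y h4 h5
      rw [← ha, Finset.mem_filter]
      refine ⟨h4, h5, ?_, ?_⟩
      · rw [Finset.mem_insert, not_or]; exact ⟨fun e => hU.1 (e ▸ h5), hr.2.1⟩
      · rw [Finset.mem_insert, not_or]; exact ⟨fun e => hU.2 (e ▸ h5), hr.2.2⟩
    exact hpq ((key p hp.1 hp.2).trans (key q hq.1 hq.2).symm)
  · rintro ⟨h1, h2, h3, h4⟩
    have h1' := Finset.nonempty_iff_ne_empty.2 h1
    refine ⟨⟨h4.face h1', h2, h3⟩, ?_⟩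
    obtain ⟨r, hr3, hu, hv, hsr, hU⟩ := X.facetU h2 h3 h4
    have hrK : r ∈ K.faces := hU.face (h1'.mono hsr)
    refine ⟨r, by rw [Finset.mem_filter]; exact ⟨hrK, hu, hv⟩, hsr, hr3, ?_⟩
    rw [card_one_iff _ _ hr3]
    obtain ⟨p, q, hpq, hall⟩ := X.hK.two r hrK hr3
    have hnew : ∀ y, (y ∉ r ∧ insert y r ∈ K.faces.filter fun α => X.u ∉ α ∧ X.v ∉ α) ↔
        (y = p ∨ y = q) ∧ y ≠ X.u ∧ y ≠ X.v := by
      intro y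
      rw [← hall, Finset.mem_filter, Finset.mem_insert, Finset.mem_insert, not_or, not_or]
      constructor
      · rintro ⟨a1, a2, a3, a4⟩
        exact ⟨⟨a1, a2⟩, Ne.symm a3.1, Ne.symm a4.1⟩
      · rintro ⟨⟨a1, a2⟩, a3, a4⟩
        exact ⟨a1, a2, ⟨Ne.symm a3, hu⟩, ⟨Ne.symm a4, hv⟩⟩
    simp only [hnew]
    have hUs : (X.u = p ∨ X.u = q) ∨ (X.v = p ∨ X.v = q) := by
      rw [← hall, ← hall]
      exact hU.imp (fun h => ⟨hu, h⟩) (fun h => ⟨hv, h⟩)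
    have hnb : ¬ ((X.u = p ∨ X.u = q) ∧ (X.v = p ∨ X.v = q)) := by
      rw [← hall, ← hall]
      rintro ⟨h5, h6⟩
      exact X.notboth hr3 hu hv h5.2 h6.2
    clear hall hnew
    by_cases hp : p = X.u ∨ p = X.v
    · refine ⟨q, fun y => ?_⟩
      grind
    · refine ⟨p, fun y => ?_⟩
      grind

theorem contr : EdgeContraction K X.K1 := by
  refine ⟨X.u, X.v, X.uv.2, X.uv.1, ?_, X.w, ?_, ?_⟩
  · ext s
    rw [Finset.mem_inter, mem_lk', mem_lk', mem_lk']
    have e1 : s ∪ {X.u} = insert X.u s := by ext; simp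
    have e2 : s ∪ {X.v} = insert X.v s := by ext; simp
    have e3 : s ∪ {X.u, X.v} = insert X.u (insert X.v s) := by ext; simp
    rw [e1, e2, e3, Finset.disjoint_singleton_right, Finset.disjoint_singleton_right,
      Finset.disjoint_insert_right, Finset.disjoint_singleton_right]
    constructor
    · rintro ⟨⟨a1, a2, a3⟩, -, b2, b3⟩
      exact ⟨a1, ⟨a2, b2⟩, X.lcd s a2 b2 a3 b3⟩
    · rintro ⟨a1, ⟨a2, b2⟩, a3⟩
      exact ⟨⟨a1, a2, down a3 (Finset.insert_subset_insert _ (Finset.subset_insert _ _)) (by simp)⟩,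
        a1, b2, down a3 (Finset.subset_insert _ _) (by simp)⟩
  · rw [mem_vertexSet]; exact X.hw
  · ext s
    rw [Finset.mem_union, mem_coneFaces (fun r hr => ((X.bdry r).1 hr).2.2.2.wn), X.bdry, X.bdry,
      Finset.mem_filter]
    by_cases hws : X.w ∈ s
    · obtain ⟨σ, rfl, hσ⟩ : ∃ σ, s = insert X.w σ ∧ X.w ∉ σ :=
        ⟨s.erase X.w, (Finset.insert_erase hws).symm, by simp⟩
      rw [X.m1 hσ, Finset.erase_insert hσ]
      constructor
      · rintro ⟨h1, h2, h3⟩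
        right; right
        refine ⟨hws, ?_⟩
        by_cases h0 : σ = ∅
        · right; simp [h0]
        · exact Or.inl ⟨h0, h1, h2, h3⟩
      · rintro (⟨h, -⟩ | ⟨-, -, -, h⟩ | ⟨-, ⟨-, h⟩ | h⟩)
        · exact absurd hws (X.wn h)
        · exact absurd hws h.wn
        · exact h
        · have : σ = ∅ := by
            rw [← Finset.erase_insert hσ, h]; simp
          subst this
          exact ⟨by simp, by simp, Or.inl (down X.uv.2 (by simp) (by simp))⟩
    · rw [X.m0 hws]
      constructor
      · exact fun h => Or.inl h
      · rintro (h | ⟨h1, h2, h3, h4⟩ | ⟨h, -⟩)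
        · exact h
        · exact ⟨h4.face (Finset.nonempty_iff_ne_empty.2 h1), h2, h3⟩
        · exact absurd h hws

theorem base (n : ℕ) : (X.K1.faces.filter fun s => X.w ∉ s).filter (fun s => s.card = n) =
    ((K.faces.filter fun s => X.u ∉ s).filter fun s => X.v ∉ s).filter fun s => s.card = n := by
  ext s
  simp only [Finset.mem_filter]
  constructor
  · rintro ⟨⟨h1, h2⟩, h3⟩
    rw [X.m0 h2] at h1
    exact ⟨⟨⟨h1.1, h1.2.1⟩, h1.2.2⟩, h3⟩
  · rintro ⟨⟨⟨h1, h2⟩, h3⟩, h4⟩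
    exact ⟨⟨(X.m0 (X.wn h1)).2 ⟨h1, h2, h3⟩, X.wn h1⟩, h4⟩

open scoped Classical in
theorem g2_eq : X.K1.g2 = K.g2 + 3 - (K.vertexSet.filter (RK K X.u X.v)).card := by
  have huK : {X.u} ∈ K.faces := down X.uv.2 (by simp) (by simp)
  have hvK : {X.v} ∈ K.faces := down X.uv.2 (by simp) (by simp)
  have c1 := cnt0 K.faces X.u huK
  have c2 := cnt0 (K.faces.filter fun s => X.u ∉ s) X.v (by
    rw [Finset.mem_filter]; exact ⟨hvK, by simpa using X.uv.1⟩)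
  have c3 := cnt0 X.K1.faces X.w ((X.m1 (σ := ∅) (by simp)).2 ⟨by simp, by simp, Or.inl huK⟩)
  rw [X.base] at c3
  set Nu := K.vertexSet.filter fun y => NK K X.u y with hNu
  set Nv := K.vertexSet.filter fun y => y ≠ X.u ∧ NK K X.v y with hNv
  have mu : ∀ y, y ∈ Nu ↔ NK K X.u y := by
    intro y; rw [hNu, Finset.mem_filter]; exact ⟨fun h => h.2, fun h => ⟨h.mem, h⟩⟩
  have mv : ∀ y, y ∈ Nv ↔ y ≠ X.u ∧ NK K X.v y := by
    intro y; rw [hNv, Finset.mem_filter]; exact ⟨fun h => h.2, fun h => ⟨h.2.mem, h⟩⟩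
  have e1 := cnt1 K.faces X.u Nu (by
    intro y; rw [mu, NK]; exact and_congr_left' ne_comm)
  have e2 := cnt1 (K.faces.filter fun s => X.u ∉ s) X.v Nv (by
    intro y; rw [mv, NK, Finset.mem_filter]
    simp only [Finset.mem_insert, Finset.mem_singleton, not_or]
    constructor
    · rintro ⟨h1, h2, h3⟩; exact ⟨h2.symm, h3, X.uv.1, h1.symm⟩
    · rintro ⟨h1, h2, -, h3⟩; exact ⟨Ne.symm h3, Ne.symm h1, h2⟩)
  have e3 := cnt1 X.K1.faces X.w (Nu.erase X.v ∪ Nv) (by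
    intro y
    rw [Finset.mem_union, Finset.mem_erase, mu, mv]
    constructor
    · intro h
      have h' : y ≠ X.u ∧ y ≠ X.v ∧ X.U {y} := by
        rcases h with ⟨h1, h2⟩ | ⟨h1, h2⟩
        · exact ⟨h2.1.symm, h1, Or.inl h2.2⟩
        · exact ⟨h1, h2.1.symm, Or.inr h2.2⟩
      have := h'.2.2.wn
      refine ⟨by simpa using Ne.symm (by simpa using this), (X.m1 this).2 ⟨?_, ?_, h'.2.2⟩⟩
      · simpa using h'.1.symm
      · simpa using h'.2.1.symm
    · rintro ⟨h1, h2⟩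
      rw [X.m1 (by simpa using h1.symm)] at h2
      simp only [Finset.mem_singleton] at h2
      obtain ⟨h3, h4, h5 | h5⟩ := h2
      · exact Or.inl ⟨Ne.symm h4, h3, h5⟩
      · exact Or.inr ⟨Ne.symm h3, h4, h5⟩)
  rw [X.base] at e3
  have hvu : X.v ∈ Nu := (mu _).2 X.uv
  have hu := Finset.card_union_add_card_inter (Nu.erase X.v) Nv
  have hi : Nu.erase X.v ∩ Nv = K.vertexSet.filter (RK K X.u X.v) := by
    ext y
    rw [Finset.mem_inter, Finset.mem_erase, mu, mv, Finset.mem_filter]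
    constructor
    · rintro ⟨⟨h1, h2⟩, h3, h4⟩
      exact ⟨h2.mem, X.uv.1, h2.1, h4.1,
        X.lcd {y} (by simpa using h2.1) (by simpa using h4.1) h2.2 h4.2⟩
    · rintro ⟨-, h⟩
      exact ⟨⟨h.2.2.1.symm, h.r23.n⟩, h.2.1.symm, h.r12.r23.n⟩
  rw [hi] at hu
  have := Finset.card_erase_add_one hvu
  rw [g2, g2, fnum0, fnum0, fnum1, fnum1]
  omega

end Ctr

theorem InClassR.B {K : SComplex} (h : InClassR K) (h6 : 6 ≤ K.vertexSet.card) {u v : ℕ} (huv : NK K u v) :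
    ∃ z, NK K u z ∧ NK K v z ∧ ¬ RK K u v z := by
  classical
  by_contra! hB
  have hK := h.1.nrm
  obtain ⟨pv, hpv, -⟩ := exists_fresh K
  have l1 : ∀ y, NK K u y → NK K v y → RK K u v y := hB
  have lcd : ∀ σ : Finset ℕ, u ∉ σ → v ∉ σ → insert u σ ∈ K.faces → insert v σ ∈ K.faces →
    insert u (insert v σ) ∈ K.faces := by
    intro σ hu hv h1 h2
    have hle : σ.card ≤ 3 := by
      have := hK.le _ h1
      rw [Finset.card_insert_of_notMem hu] at this; omega
    have sub1 : ∀ y ∈ σ, NK K u y ∧ NK K v y := fun y hy =>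
      ⟨⟨fun e => hu (e ▸ hy), down h1 (by
        intro z; simp only [Finset.mem_insert, Finset.mem_singleton]; rintro (rfl | rfl); exacts [Or.inl rfl, Or.inr hy]) (by simp)⟩,
       ⟨fun e => hv (e ▸ hy), down h2 (by
        intro z; simp only [Finset.mem_insert, Finset.mem_singleton]; rintro (rfl | rfl); exacts [Or.inl rfl, Or.inr hy]) (by simp)⟩⟩
    have sub2 : ∀ y ∈ σ, ∀ z ∈ σ, y ≠ z → QK K u v y z := by
      intro y hy z hz hyz
      have r1 : RK K u y z := ⟨(sub1 y hy).1.1, (sub1 z hz).1.1, hyz, down h1 (by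
        intro w; simp only [Finset.mem_insert, Finset.mem_singleton]; rintro (rfl | rfl | rfl)
        exacts [Or.inl rfl, Or.inr hy, Or.inr hz]) (by simp)⟩
      have r2 : RK K v y z := ⟨(sub1 y hy).2.1, (sub1 z hz).2.1, hyz, down h2 (by
        intro w; simp only [Finset.mem_insert, Finset.mem_singleton]; rintro (rfl | rfl | rfl)
        exacts [Or.inl rfl, Or.inr hy, Or.inr hz]) (by simp)⟩
      exact h.fill (l1 y (sub1 y hy).1 (sub1 y hy).2) (l1 z (sub1 z hz).1 (sub1 z hz).2) r1 r2
    interval_cases hc : σ.card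
    · obtain rfl := Finset.card_eq_zero.1 hc
      exact huv.2
    · obtain ⟨x, rfl⟩ := Finset.card_eq_one.1 hc
      have := sub1 x (by simp)
      exact (l1 x this.1 this.2).2.2.2
    · obtain ⟨x, y, hxy, rfl⟩ := Finset.card_eq_two.1 hc
      exact (sub2 x (by simp) y (by simp) hxy).2.2.2.2.2.2
    · exfalso
      have hvW : u ∉ insert v σ := by simp [huv.1, hu]
      have hc5 : (insert u (insert v σ)).card = 5 := by
        rw [Finset.card_insert_of_notMem hvW, Finset.card_insert_of_notMem hv, hc]
      have := five hK (insert u (insert v σ)) hc5 (by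
        intro F hF h4
        by_cases huF : u ∈ F
        · by_cases hvF : v ∈ F
          · have hc2 : ((F.erase u).erase v).card = 2 := by
              rw [Finset.card_erase_of_mem (by simp [hvF, huv.1.symm]), Finset.card_erase_of_mem huF, h4]
            obtain ⟨x, y, hxy, he⟩ := Finset.card_eq_two.1 hc2
            have hin : ∀ z ∈ ({x, y} : Finset ℕ), z ∈ σ := by
              intro z hz
              rw [← he] at hz
              simp only [Finset.mem_erase] at hz
              have := hF hz.2.2
              simp only [Finset.mem_insert] at this
              tauto
            have hq := (sub2 x (hin x (by simp)) y (hin y (by simp)) hxy).2.2.2.2.2.2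
            rw [← he, Finset.insert_erase (by simp [hvF, huv.1.symm]), Finset.insert_erase huF] at hq
            exact hq
          · refine down h1 ?_ (Finset.card_pos.1 (by omega))
            intro z hz
            have := hF hz
            simp only [Finset.mem_insert] at this ⊢
            rcases this with e | e | e
            · exact Or.inl e
            · exact absurd (e ▸ hz) hvF
            · exact Or.inr e
        · refine down h2 ?_ (Finset.card_pos.1 (by omega))
          intro z hz
          have := hF hz
          simp only [Finset.mem_insert] at this ⊢
          rcases this with e | e | e
          · exact absurd (e ▸ hz) huF
          · exact Or.inl e
          · exact Or.inr e)
      have := Finset.card_le_card this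
      omega
  let X : Ctr K := ⟨hK, u, v, pv true, huv, hpv true, lcd⟩
  have hA := h.A h6 huv
  obtain ⟨-, -, -, -, h3⟩ := h
  have h4 := h3 X.K1 X.K1_nrm.normal (Or.inr (Or.inl X.contr))
  rw [X.g2_eq] at h4
  change _ ≤ _ + 3 - (((K.vertexSet.filter (RK K u v)).card : ℕ) : ℤ) at h4
  omega

end SComplex

open Topology in
theorem cech {A : Type} [TopologicalSpace A] [ContractibleSpace A] [LocallyPathConnectedSpace A]
    (W : ℕ → Set A) (hW : ∀ i, IsOpen (W i)) (hcov : ∀ x, ∃ i, x ∈ W i) (φ : ℕ → ℕ → Bool)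
    (hφ : ∀ i j k x, x ∈ W i → x ∈ W j → x ∈ W k → xor (φ i j) (φ j k) = φ i k) :
    ∃ c : ℕ → A → Bool, (∀ i, ContinuousOn (c i) (W i)) ∧
      ∀ i j x, x ∈ W i → x ∈ W j → c j x = xor (φ i j) (c i x) := by
  classical
  choose ix hix using hcov
  let Z : FiberBundleCore ℕ A Bool :=
    { baseSet := W
      isOpen_baseSet := hW
      indexAt := ix
      mem_baseSet_at := hix
      coordChange := fun i j _ b => xor (φ i j) b
      coordChange_self := by
        intro i x hx v
        have := hφ i i i x hx hx hx
        cases h : φ i i <;> simp_all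
      continuousOn_coordChange := by
        intro i j
        apply Continuous.continuousOn
        exact (continuous_of_discreteTopology (f := fun b => xor (φ i j) b)).comp continuous_snd
      coordChange_comp := by
        intro i j k x hx v
        rw [← hφ i j k x hx.1.1 hx.1.2 hx.2, ← Bool.xor_assoc, Bool.xor_comm (φ j k)] }
  have hc : IsCoveringMap (Bundle.TotalSpace.proj : Z.TotalSpace → A) := FiberBundle.isCoveringMap
  obtain ⟨a0⟩ : Nonempty A := inferInstance
  obtain ⟨F, ⟨-, hF⟩, -⟩ := hc.existsUnique_continuousMap_lifts (ContinuousMap.id A) a0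
    (⟨a0, true⟩ : Z.TotalSpace) rfl
  have hF' : ∀ x, (F x).proj = x := fun x => congrFun hF x
  refine ⟨fun i x => (Z.localTriv i (F x)).2, ?_, ?_⟩
  · intro i
    have h1 : ContinuousOn (Z.localTriv i) (Z.localTriv i).source := (Z.localTriv i).continuousOn_toFun
    have h2 : ContinuousOn (fun x => Z.localTriv i (F x)) (W i) := by
      refine h1.comp F.continuous.continuousOn ?_
      intro x hx
      rw [Z.mem_localTriv_source]
      change (F x).proj ∈ W i
      rwa [hF']
    exact continuous_snd.comp_continuousOn h2
  · intro i j x hi hj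
    dsimp only; rw [Z.localTriv_apply, Z.localTriv_apply]
    have h3 := hφ (ix (F x).proj) i j x (by rw [hF']; exact hix x) hi hj
    have h4 : ∀ p q r b : Bool, xor p q = r → xor r b = xor q (xor p b) := by decide
    exact h4 _ _ _ _ h3

namespace SComplex

theorem cocycle_trivial (L : SComplex) (T : Finset ℕ) (hT : T ∈ L.faces) (hT3 : T.card = 3)
    (H : ↥(L.realSpace) ≃ₜ ↥(Metric.sphere (0 : EuclideanSpace ℝ (Fin 3)) 1))
    (φ : ℕ → ℕ → Bool)
    (hφ : ∀ i j k, ({i, j, k} : Finset ℕ) ∈ L.faces → xor (φ i j) (φ j k) = φ i k) :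
    ∃ h : ℕ → Bool, ∀ i j, ({i, j} : Finset ℕ) ∈ L.faces → φ i j = xor (h i) (h j) := by
  classical
  -- the puncture
  let pt : L.realSpace := ⟨fun v => if v ∈ T then 1 / 3 else 0, by
    refine ⟨fun v => by dsimp only; split_ifs <;> norm_num, T, hT, ?_, ?_⟩
    · intro v hv
      by_contra h
      simp [h] at hv
    · rw [Finset.sum_ite_mem, Finset.inter_self, Finset.sum_const, hT3]; norm_num⟩
  have hn : ‖(H pt : EuclideanSpace ℝ (Fin 3))‖ = 1 := by simp
  let σ := stereographic hn
  let g : (ℝ ∙ (H pt : EuclideanSpace ℝ (Fin 3)))ᗮ → L.realSpace := fun a => H.symm (σ.symm a)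
  have hg : Continuous g := H.symm.continuous.comp (isOpenEmbedding_stereographic_symm hn).continuous
  let q : L.realSpace → (ℝ ∙ (H pt : EuclideanSpace ℝ (Fin 3)))ᗮ := fun w => σ (H w)
  have hsrc : ∀ w, w ≠ pt → H w ∈ σ.source := by
    intro w hw
    change H w ∈ (stereographic hn).source
    rw [stereographic_source]
    intro h
    apply hw
    apply H.injective
    exact h
  have hgq : ∀ w, w ≠ pt → g (q w) = w := by
    intro w hw
    simp only [g, q]
    rw [σ.left_inv (hsrc w hw), H.symm_apply_apply]
  have hq : ContinuousOn q {w | w ≠ pt} :=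
    σ.continuousOn_toFun.comp H.continuous.continuousOn (fun w hw => hsrc w hw)
  obtain ⟨c, hc1, hc2⟩ := cech (fun i => {a | 0 < (g a).1 i}) (by
      intro i
      exact isOpen_lt continuous_const ((continuous_apply i).comp (continuous_subtype_val.comp hg))) (by
      intro a
      obtain ⟨h0, s, hs, h1, h2⟩ := (g a).2
      by_contra! hne
      have : ∀ v ∈ s, (g a).1 v = 0 := fun v _ => le_antisymm (not_lt.1 (hne v)) (h0 v)
      rw [Finset.sum_eq_zero this] at h2
      norm_num at h2) φ (by
      intro i j k a hi hj hk
      obtain ⟨h0, s, hs, h1, h2⟩ := (g a).2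
      refine hφ i j k (down hs ?_ (by simp))
      intro v hv
      simp only [Finset.mem_insert, Finset.mem_singleton] at hv
      rcases hv with rfl | rfl | rfl
      · exact h1 _ (ne_of_gt hi)
      · exact h1 _ (ne_of_gt hj)
      · exact h1 _ (ne_of_gt hk))
  -- points on edges
  have hmem : ∀ i j, ({i, j} : Finset ℕ) ∈ L.faces → i ≠ j → ∀ s : Set.Icc (0 : ℝ) (1 / 2),
      (fun v => (if v = i then 1 - s.1 else 0) + (if v = j then s.1 else 0) : ℕ → ℝ) ∈ L.realSpace := by
    intro i j hij hne s
    obtain ⟨s, hs0, hs1⟩ := s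
    refine ⟨fun v => ?_, {i, j}, hij, ?_, ?_⟩
    · have : (0 : ℝ) ≤ 1 - s := by linarith
      dsimp only
      split_ifs <;> linarith
    · intro v hv
      by_contra h
      simp only [Finset.mem_insert, Finset.mem_singleton, not_or] at h
      simp [h.1, h.2] at hv
    · rw [Finset.sum_pair hne]
      simp [hne, hne.symm]
  have hpt : ∀ (i j : ℕ) (w : L.realSpace), (∀ v, v ≠ i → v ≠ j → w.1 v = 0) → w ≠ pt := by
    rintro i j w hw rfl
    have : T ⊆ {i, j} := by
      intro v hv
      by_contra h
      simp only [Finset.mem_insert, Finset.mem_singleton, not_or] at h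
      have := hw v h.1 h.2
      simp [pt, hv] at this
    have := Finset.card_le_card this
    have := Finset.card_le_two (a := i) (b := j)
    omega
  -- vertices
  let vt : ℕ → L.realSpace := fun i =>
    if h : (fun v => if v = i then 1 else 0 : ℕ → ℝ) ∈ L.realSpace then ⟨_, h⟩ else pt
  have key : ∀ i j (hij : ({i, j} : Finset ℕ) ∈ L.faces) (hne : i ≠ j),
      c i (q (vt i)) = c i (q ⟨_, hmem i j hij hne ⟨1 / 2, by norm_num, le_refl _⟩⟩) := by
    intro i j hij hne
    let γ : Set.Icc (0 : ℝ) (1 / 2) → L.realSpace := fun s => ⟨_, hmem i j hij hne s⟩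
    have hγ : Continuous γ := by
      refine Continuous.subtype_mk (continuous_pi fun v => ?_) _
      split_ifs <;> fun_prop
    have hγp : ∀ s, γ s ≠ pt := by
      intro s
      refine hpt i j _ fun v h1 h2 => ?_
      simp [γ, h1, h2]
    have hcont : Continuous fun s => c i (q (γ s)) := by
      rw [← continuousOn_univ]
      refine (hc1 i).comp (hq.comp hγ.continuousOn fun s _ => hγp s) ?_
      intro s _
      change 0 < (g (q (γ s))).1 i
      rw [hgq _ (hγp s)]
      have : s.1 ≤ 1 / 2 := s.2.2
      simp only [γ, if_true, hne, if_false]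
      linarith
    have : PreconnectedSpace (Set.Icc (0 : ℝ) (1 / 2)) := Subtype.preconnectedSpace isPreconnected_Icc
    have := PreconnectedSpace.constant (f := fun s => c i (q (γ s))) inferInstance hcont (x := ⟨0, le_refl _, by norm_num⟩)
      (y := ⟨1 / 2, by norm_num, le_refl _⟩)
    have hv : vt i = γ ⟨0, le_refl _, by norm_num⟩ := by
      have e : (fun v => if v = i then 1 else 0 : ℕ → ℝ) = (γ ⟨0, le_refl _, by norm_num⟩).1 := by
        funext v
        simp [γ]
      have hm : (fun v => if v = i then 1 else 0 : ℕ → ℝ) ∈ L.realSpace := by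
        rw [e]; exact (γ _).2
      apply Subtype.ext
      simp only [vt, dif_pos hm]
      exact e
    rw [hv]
    exact this
  refine ⟨fun i => c i (q (vt i)), fun i j hij => ?_⟩
  by_cases hne : i = j
  · subst hne
    have := hφ i i i (by simpa using hij)
    cases h : φ i i <;> simp_all
  · have k1 := key i j hij hne
    have k2 := key j i (by rwa [Finset.pair_comm]) (Ne.symm hne)
    have em : (⟨_, hmem j i (by rwa [Finset.pair_comm]) (Ne.symm hne) ⟨1 / 2, by norm_num, le_refl _⟩⟩ : L.realSpace) =
        ⟨_, hmem i j hij hne ⟨1 / 2, by norm_num, le_refl _⟩⟩ := by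
      apply Subtype.ext
      funext v
      by_cases h1 : v = i
      · subst h1; simp [hne]; norm_num
      · by_cases h2 : v = j
        · subst h2; simp [h1]; norm_num
        · simp [h1, h2]
    rw [em] at k2
    set m : L.realSpace := ⟨_, hmem i j hij hne ⟨1 / 2, by norm_num, le_refl _⟩⟩ with hm
    have hmp : m ≠ pt := hpt i j _ fun v h1 h2 => by simp [hm, h1, h2]
    have := hc2 i j (q m) (by
        change 0 < (g (q m)).1 i
        rw [hgq _ hmp]; simp [hm, hne]; norm_num) (by
        change 0 < (g (q m)).1 j
        rw [hgq _ hmp]; simp [hm, Ne.symm hne])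
    change φ i j = xor (c i (q (vt i))) (c j (q (vt j)))
    rw [k1, k2, this]
    cases φ i j <;> cases c i (q m) <;> rfl

end SComplex

namespace SComplex

theorem mem_lkv {K : SComplex} {x : ℕ} {r : Finset ℕ} :
    r ∈ (K.lk {x}).faces ↔ r.Nonempty ∧ x ∉ r ∧ insert x r ∈ K.faces := by
  rw [mem_lk', Finset.disjoint_singleton_right]
  have e1 : r ∪ {x} = insert x r := by ext; simp
  rw [e1]

/-- the coboundary on edge functions, evaluated on triangles -/
noncomputable def cobd (L : SComplex) : (L.faces → ZMod 2) →ₗ[ZMod 2] (L.faces → ZMod 2) where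
  toFun φ t := if t.1.card = 3 then ∑ e ∈ Finset.univ.filter (fun e : L.faces => e.1.card = 2 ∧ e.1 ⊆ t.1), φ e else 0
  map_add' φ ψ := by
    funext t
    simp only [Pi.add_apply]
    split_ifs
    · rw [Finset.sum_add_distrib]
    · simp
  map_smul' r φ := by
    funext t
    simp only [Pi.smul_apply, smul_eq_mul, RingHom.id_apply]
    split_ifs
    · rw [Finset.mul_sum]
    · simp

/-- pairing with the edges of `A` -/
noncomputable def pair (L : SComplex) (A : Finset ℕ) : (L.faces → ZMod 2) →ₗ[ZMod 2] ZMod 2 where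
  toFun φ := ∑ e ∈ Finset.univ.filter (fun e : L.faces => e.1.card = 2 ∧ e.1 ⊆ A), φ e
  map_add' φ ψ := by
    simp only [Pi.add_apply]
    rw [Finset.sum_add_distrib]
  map_smul' r φ := by
    simp only [Pi.smul_apply, smul_eq_mul, RingHom.id_apply]
    rw [Finset.mul_sum]

theorem sum_three (L : SComplex) (φ : L.faces → ZMod 2) {i j k : ℕ} (hij : i ≠ j) (hik : i ≠ k) (hjk : j ≠ k)
    (h1 : ({i, j} : Finset ℕ) ∈ L.faces) (h2 : ({j, k} : Finset ℕ) ∈ L.faces)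
    (h3 : ({i, k} : Finset ℕ) ∈ L.faces) :
    ∑ e ∈ Finset.univ.filter (fun e : L.faces => e.1.card = 2 ∧ e.1 ⊆ ({i, j, k} : Finset ℕ)), φ e =
      φ ⟨_, h1⟩ + φ ⟨_, h2⟩ + φ ⟨_, h3⟩ := by
  have : Finset.univ.filter (fun e : L.faces => e.1.card = 2 ∧ e.1 ⊆ ({i, j, k} : Finset ℕ)) =
      {⟨_, h1⟩, ⟨_, h2⟩, ⟨_, h3⟩} := by
    ext ⟨e, he⟩
    simp only [Finset.mem_filter, Finset.mem_univ, true_and, Finset.mem_insert, Finset.mem_singleton, Subtype.mk.injEq]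
    constructor
    · rintro ⟨h4, h5⟩
      obtain ⟨p, q, hpq, rfl⟩ := Finset.card_eq_two.1 h4
      have hp : p ∈ ({i, j, k} : Finset ℕ) := h5 (by simp)
      have hq : q ∈ ({i, j, k} : Finset ℕ) := h5 (by simp)
      simp only [Finset.mem_insert, Finset.mem_singleton] at hp hq
      rcases hp with rfl | rfl | rfl <;> rcases hq with rfl | rfl | rfl <;>
        simp_all [Finset.pair_comm]
    · rintro (rfl | rfl | rfl)
      · exact ⟨Finset.card_pair hij, by intro z; simp; tauto⟩
      · exact ⟨Finset.card_pair hjk, by intro z; simp; tauto⟩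
      · exact ⟨Finset.card_pair hik, by intro z; simp; tauto⟩
  have ne1 : ({i, j} : Finset ℕ) ≠ {j, k} := by
    intro h
    have : i ∈ ({j, k} : Finset ℕ) := by rw [← h]; simp
    simp at this; tauto
  have ne2 : ({i, j} : Finset ℕ) ≠ {i, k} := by
    intro h
    have : j ∈ ({i, k} : Finset ℕ) := by rw [← h]; simp
    simp at this; tauto
  have ne3 : ({j, k} : Finset ℕ) ≠ {i, k} := by
    intro h
    have : j ∈ ({i, k} : Finset ℕ) := by rw [← h]; simp
    simp at this; tauto
  rw [this, Finset.sum_insert (by simp [ne1, ne2]), Finset.sum_pair (by simp [ne3]), add_assoc]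

theorem pair_zero (L : SComplex) (T : Finset ℕ) (hT : T ∈ L.faces) (hT3 : T.card = 3)
    (H : ↥(L.realSpace) ≃ₜ ↥(Metric.sphere (0 : EuclideanSpace ℝ (Fin 3)) 1))
    {a b c : ℕ} (hab : a ≠ b) (hac : a ≠ c) (hbc : b ≠ c)
    (h1 : ({a, b} : Finset ℕ) ∈ L.faces) (h2 : ({b, c} : Finset ℕ) ∈ L.faces)
    (h3 : ({a, c} : Finset ℕ) ∈ L.faces) (φ : L.faces → ZMod 2) (hφ : cobd L φ = 0) :
    pair L {a, b, c} φ = 0 := by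
  classical
  let ψ : ℕ → ℕ → Bool := fun i j => if h : i ≠ j ∧ ({i, j} : Finset ℕ) ∈ L.faces then decide (φ ⟨_, h.2⟩ = 1) else false
  have hψ : ∀ i j (h : ({i, j} : Finset ℕ) ∈ L.faces), i ≠ j → ψ i j = decide (φ ⟨_, h⟩ = 1) := by
    intro i j h hne
    simp only [ψ, dif_pos (And.intro hne h)]
  have hself : ∀ i, ψ i i = false := by
    intro i; simp [ψ]
  have hsym : ∀ i j, ψ i j = ψ j i := by
    intro i j
    have he : ({i, j} : Finset ℕ) = {j, i} := Finset.pair_comm _ _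
    by_cases hne : i = j
    · rw [hne]
    by_cases h : ({i, j} : Finset ℕ) ∈ L.faces
    · have h' : ({j, i} : Finset ℕ) ∈ L.faces := he ▸ h
      rw [hψ i j h hne, hψ j i h' (Ne.symm hne)]
      congr 3
      exact Subtype.ext he
    · have h' : ({j, i} : Finset ℕ) ∉ L.faces := he ▸ h
      simp only [ψ]
      rw [dif_neg (fun hh => h hh.2), dif_neg (fun hh => h' hh.2)]
  have hdec : ∀ x y z : ZMod 2, x + y + z = 0 → xor (decide (x = 1)) (decide (y = 1)) = decide (z = 1) := by decide
  obtain ⟨h, hh⟩ := cocycle_trivial L T hT hT3 H ψ (by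
    intro i j k hf
    by_cases hij : i = j
    · subst hij; rw [hself]; simp
    by_cases hjk : j = k
    · subst hjk; rw [hself]; simp
    by_cases hik : i = k
    · subst hik; rw [hself, hsym j i]; simp
    have f1 : ({i, j} : Finset ℕ) ∈ L.faces := down hf (by intro z; simp; tauto) (by simp)
    have f2 : ({j, k} : Finset ℕ) ∈ L.faces := down hf (by intro z; simp; tauto) (by simp)
    have f3 : ({i, k} : Finset ℕ) ∈ L.faces := down hf (by intro z; simp; tauto) (by simp)
    rw [hψ i j f1 hij, hψ j k f2 hjk, hψ i k f3 hik]
    apply hdec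
    have := congrFun hφ ⟨_, hf⟩
    simp only [cobd, LinearMap.coe_mk, AddHom.coe_mk, Pi.zero_apply] at this
    rw [if_pos (Finset.card_eq_three.2 ⟨i, j, k, hij, hik, hjk, rfl⟩), sum_three L φ hij hik hjk f1 f2 f3] at this
    exact this)
  change ∑ e ∈ Finset.univ.filter (fun e : L.faces => e.1.card = 2 ∧ e.1 ⊆ ({a, b, c} : Finset ℕ)), φ e = 0
  rw [sum_three L φ hab hac hbc h1 h2 h3]
  have k1 := hh a b h1
  have k2 := hh b c h2
  have k3 := hh a c h3
  rw [hψ a b h1 hab] at k1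
  rw [hψ b c h2 hbc] at k2
  rw [hψ a c h3 hac] at k3
  have hdec2 : ∀ (x y z : ZMod 2) (p q r : Bool), decide (x = 1) = xor p q → decide (y = 1) = xor q r →
    decide (z = 1) = xor p r → x + y + z = 0 := by decide
  exact hdec2 _ _ _ _ _ _ k1 k2 k3

/-- the 2-colouring of triangles -/
theorem exists_col (L : SComplex) (T : Finset ℕ) (hT : T ∈ L.faces) (hT3 : T.card = 3)
    (H : ↥(L.realSpace) ≃ₜ ↥(Metric.sphere (0 : EuclideanSpace ℝ (Fin 3)) 1))
    {a b c : ℕ} (hab : a ≠ b) (hac : a ≠ c) (hbc : b ≠ c)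
    (h1 : ({a, b} : Finset ℕ) ∈ L.faces) (h2 : ({b, c} : Finset ℕ) ∈ L.faces)
    (h3 : ({a, c} : Finset ℕ) ∈ L.faces) :
    ∃ f : Finset ℕ → ZMod 2, ∀ e ∈ L.faces, e.card = 2 →
      ∑ t ∈ L.faces.filter (fun t => t.card = 3 ∧ e ⊆ t), f t = if e ⊆ {a, b, c} then 1 else 0 := by
  classical
  have hmem : (pair L {a, b, c} : Module.Dual (ZMod 2) (L.faces → ZMod 2)) ∈ (cobd L).dualMap.range := by
    rw [LinearMap.range_dualMap_eq_dualAnnihilator_ker, Submodule.mem_dualAnnihilator]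
    intro φ hφ
    exact pair_zero L T hT hT3 H hab hac hbc h1 h2 h3 φ (LinearMap.mem_ker.1 hφ)
  obtain ⟨γ, hγ⟩ := hmem
  refine ⟨fun t => if h : t ∈ L.faces then γ (Pi.single ⟨t, h⟩ 1) else 0, ?_⟩
  intro e he he2
  have := LinearMap.congr_fun hγ (Pi.single ⟨e, he⟩ 1)
  rw [LinearMap.dualMap_apply] at this
  have hp : pair L {a, b, c} (Pi.single ⟨e, he⟩ 1) = if e ⊆ {a, b, c} then 1 else 0 := by
    change ∑ e' ∈ Finset.univ.filter (fun e' : L.faces => e'.1.card = 2 ∧ e'.1 ⊆ ({a, b, c} : Finset ℕ)),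
      (Pi.single (⟨e, he⟩ : L.faces) (1 : ZMod 2) : L.faces → ZMod 2) e' = _
    simp only [Pi.single_apply, Finset.sum_ite_eq', Finset.mem_filter, Finset.mem_univ, true_and, he2]
  rw [hp] at this
  rw [← this]
  have hc : cobd L (Pi.single ⟨e, he⟩ 1) =
      ∑ t ∈ Finset.univ.filter (fun t : L.faces => t.1.card = 3 ∧ e ⊆ t.1), Pi.single t (1 : ZMod 2) := by
    funext s
    rw [Finset.sum_apply]
    simp only [cobd, LinearMap.coe_mk, AddHom.coe_mk]
    simp only [Pi.single_apply, Finset.sum_ite_eq, Finset.sum_ite_eq', Finset.mem_filter, Finset.mem_univ, true_and, he2]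
    split_ifs <;> tauto
  rw [hc, map_sum]
  refine Finset.sum_bij' (fun t ht => (⟨t, (Finset.mem_filter.1 ht).1⟩ : L.faces)) (fun t _ => t.1) ?_ ?_ ?_ ?_ ?_
  · intro t ht
    rw [Finset.mem_filter] at ht ⊢
    exact ⟨Finset.mem_univ _, ht.2⟩
  · intro t ht
    rw [Finset.mem_filter] at ht ⊢
    exact ⟨t.2, ht.2⟩
  · intros; rfl
  · intros; rfl
  · intro t ht
    rw [dif_pos (Finset.mem_filter.1 ht).1]

theorem InClassR.T {K : SComplex} (h : InClassR K) {x a b c : ℕ} (hx : K.HasSphereLink 3 x)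
    (h1 : RK K x a b) (h2 : RK K x b c) (h3 : RK K x a c) : QK K x a b c := by
  classical
  by_cases habc : ({a, b, c} : Finset ℕ) ∈ K.faces
  · exact h.fill h1 h3 h2 ⟨h1.2.2.1, h3.2.2.1, h2.2.2.1, habc⟩
  exfalso
  have hK := h.1.nrm
  obtain ⟨H⟩ := hx
  obtain ⟨d, d', -, hd⟩ := hK.twoQ h1
  have hQ := (hd d).2 (Or.inl rfl)
  have lke : ∀ {y z}, RK K x y z → ({y, z} : Finset ℕ) ∈ (K.lk {x}).faces := fun {y z} hr =>
    mem_lkv.2 ⟨by simp, by simp [hr.1, hr.2.1], hr.2.2.2⟩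
  obtain ⟨f, hf⟩ := exists_col (K.lk {x}) {a, b, d}
    (mem_lkv.2 ⟨by simp, by simp [hQ.1, hQ.2.1, hQ.2.2.1], hQ.2.2.2.2.2.2⟩)
    (Finset.card_eq_three.2 ⟨a, b, d, hQ.2.2.2.1, hQ.2.2.2.2.1, hQ.2.2.2.2.2.1, rfl⟩) H
    h1.2.2.1 h3.2.2.1 h2.2.2.1 (lke h1) (lke h2) (lke h3)
  obtain ⟨pv, hpv, hpvne⟩ := exists_fresh K
  refine h.noSpl
    { hK := hK, w := x, A := {a, b, c}, f := fun t => decide (f t = 1), pv := pv,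
      hw := down h1.2.2.2 (by simp) (by simp)
      hA3 := Finset.card_eq_three.2 ⟨a, b, c, h1.2.2.1, h3.2.2.1, h2.2.2.1, rfl⟩
      hwA := by simp [h1.1, h1.2.1, h2.2.1]
      hA := ?_
      hAn := habc
      flip := ?_
      fresh := hpv
      pvne := hpvne }
  · intro e he h2e
    obtain ⟨p, q, hpq, rfl⟩ := Finset.card_eq_two.1 h2e
    have hp : p ∈ ({a, b, c} : Finset ℕ) := he (by simp)
    have hq : q ∈ ({a, b, c} : Finset ℕ) := he (by simp)
    simp only [Finset.mem_insert, Finset.mem_singleton] at hp hq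
    rcases hp with rfl | rfl | rfl <;> rcases hq with rfl | rfl | rfl
    · exact absurd rfl hpq
    · exact h1.2.2.2
    · exact h3.2.2.2
    · exact h1.r23.2.2.2
    · exact absurd rfl hpq
    · exact h2.2.2.2
    · exact h3.r23.2.2.2
    · exact h2.r23.2.2.2
    · exact absurd rfl hpq
  · intro e y z he2 hxe hye hze hyx hzx hyz hy hz
    have heK : insert x e ∈ K.faces :=
      down hy (Finset.insert_subset_insert _ (Finset.subset_insert _ _)) (by simp)
    have heL : e ∈ (K.lk {x}).faces := mem_lkv.2 ⟨Finset.card_pos.1 (by omega), hxe, heK⟩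
    have hsum := hf e heL he2
    obtain ⟨p, q, hpq, hall⟩ := hK.two _ heK (by rw [Finset.card_insert_of_notMem hxe, he2])
    have hset : (K.lk {x}).faces.filter (fun t => t.card = 3 ∧ e ⊆ t) = {insert y e, insert z e} := by
      ext t
      rw [Finset.mem_filter, Finset.mem_insert, Finset.mem_singleton, mem_lkv]
      have iny : y = p ∨ y = q := (hall y).1 ⟨by simp [hyx, hye], by rwa [Finset.insert_comm]⟩
      have inz : z = p ∨ z = q := (hall z).1 ⟨by simp [hzx, hze], by rwa [Finset.insert_comm]⟩
      constructor
      · rintro ⟨⟨-, h4, h5⟩, h6, h7⟩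
        obtain ⟨r, hr, rfl⟩ := Spl.split_insert h7 (by omega)
        simp only [Finset.mem_insert, not_or] at h4
        have inr : r = p ∨ r = q := (hall r).1 ⟨by simp [Ne.symm h4.1, hr], by rwa [Finset.insert_comm]⟩
        have : r = y ∨ r = z := by omega
        rcases this with rfl | rfl
        · exact Or.inl rfl
        · exact Or.inr rfl
      · rintro (rfl | rfl)
        · exact ⟨⟨by simp, by simp [Ne.symm hyx, hxe], hy⟩, by rw [Finset.card_insert_of_notMem hye, he2],
            Finset.subset_insert _ _⟩
        · exact ⟨⟨by simp, by simp [Ne.symm hzx, hxe], hz⟩, by rw [Finset.card_insert_of_notMem hze, he2],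
            Finset.subset_insert _ _⟩
    have hne : insert y e ≠ insert z e := by
      intro hh
      have : y ∈ insert z e := hh ▸ Finset.mem_insert_self _ _
      rw [Finset.mem_insert] at this
      exact this.elim hyz hye
    rw [hset, Finset.sum_pair hne] at hsum
    have d1 : ∀ p q : ZMod 2, p + q = 1 → decide (p = 1) = ! decide (q = 1) := by decide
    have d2 : ∀ p q : ZMod 2, p + q = 0 → decide (p = 1) = decide (q = 1) := by decide
    constructor
    · intro hs
      rw [if_pos hs] at hsum
      exact d1 _ _ hsum
    · intro hs
      rw [if_neg hs] at hsum
      exact d2 _ _ hsum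

end SComplex

namespace SComplex

variable {K : SComplex}

theorem fnum0_vertexSet (M : SComplex) : M.fnum 0 = M.vertexSet.card := by
  classical
  rw [fnum0]
  symm
  refine Finset.card_bij (fun y _ => {y}) ?_ ?_ ?_
  · intro y hy
    exact Finset.mem_filter.2 ⟨mem_vertexSet.1 hy, by simp⟩
  · intro a _ b _ h
    exact Finset.singleton_injective h
  · intro s hs
    rw [Finset.mem_filter] at hs
    obtain ⟨y, rfl⟩ := Finset.card_eq_one.1 hs.2
    exact ⟨y, mem_vertexSet.2 hs.1, rfl⟩

open scoped Classical in
theorem sum_deg (M : SComplex) :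
    ∑ y ∈ M.vertexSet, (M.vertexSet.filter (NK M y)).card = 2 * M.fnum 1 := by
  have h1 : ∀ y ∈ M.vertexSet, (M.vertexSet.filter (NK M y)).card =
      ((M.faces.filter fun s => s.card = 2).filter (fun s => y ∈ s)).card := by
    intro y hy
    refine Finset.card_bij (fun z _ => {y, z}) ?_ ?_ ?_
    · intro z hz
      rw [Finset.mem_filter] at hz
      rw [Finset.mem_filter, Finset.mem_filter]
      exact ⟨⟨hz.2.2, Finset.card_pair hz.2.1⟩, by simp⟩
    · intro a ha b hb h
      rw [Finset.mem_filter] at ha hb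
      have h1 : a ∈ ({y, b} : Finset ℕ) := by rw [← h]; simp
      simp only [Finset.mem_insert, Finset.mem_singleton] at h1
      exact h1.resolve_left (Ne.symm ha.2.1)
    · intro s hs
      rw [Finset.mem_filter, Finset.mem_filter] at hs
      obtain ⟨p, q, hpq, rfl⟩ := Finset.card_eq_two.1 hs.1.2
      have := hs.2
      simp only [Finset.mem_insert, Finset.mem_singleton] at this
      rcases this with rfl | rfl
      · have hn : NK M y q := ⟨hpq, hs.1.1⟩
        exact ⟨q, Finset.mem_filter.2 ⟨hn.mem, hn⟩, rfl⟩
      · have hn : NK M p y := ⟨hpq, hs.1.1⟩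
        exact ⟨p, Finset.mem_filter.2 ⟨hn.mem', hn.symm⟩, Finset.pair_comm _ _⟩
  rw [Finset.sum_congr rfl h1]
  have h2 := Finset.sum_card_bipartiteAbove_eq_sum_card_bipartiteBelow
    (s := M.vertexSet) (t := M.faces.filter fun s => s.card = 2) (fun y s => y ∈ s)
  simp only [Finset.bipartiteAbove, Finset.bipartiteBelow] at h2
  rw [h2, fnum1, mul_comm, ← smul_eq_mul, ← Finset.sum_const]
  refine Finset.sum_congr rfl fun s hs => ?_
  rw [Finset.mem_filter] at hs
  have : M.vertexSet.filter (fun y => y ∈ s) = s := by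
    ext y
    rw [Finset.mem_filter]
    exact ⟨fun h => h.2, fun h => ⟨mem_vertexSet.2 (down hs.1 (by simpa using h) (by simp)), h⟩⟩
  rw [this, hs.2]

theorem lk_vertexSet {x y : ℕ} : y ∈ (K.lk {x}).vertexSet ↔ NK K x y := by
  rw [mem_vertexSet, mem_lkv, NK]
  simp

theorem lk_NK {x y z : ℕ} : NK (K.lk {x}) y z ↔ RK K x y z := by
  rw [NK, mem_lkv, RK]
  simp
  tauto

open scoped Classical in
theorem lk_f0 (x : ℕ) : (K.lk {x}).fnum 0 = (K.vertexSet.filter (NK K x)).card := by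
  rw [fnum0_vertexSet]
  congr 1
  ext y
  rw [lk_vertexSet, Finset.mem_filter]
  exact ⟨fun h => ⟨h.mem, h⟩, fun h => h.2⟩

open scoped Classical in
theorem lk_f1 (x : ℕ) :
    ∑ y ∈ K.vertexSet.filter (NK K x), (K.vertexSet.filter (RK K x y)).card
      = 2 * (K.lk {x}).fnum 1 := by
  rw [← sum_deg]
  refine Finset.sum_congr ?_ ?_
  · ext y
    rw [lk_vertexSet, Finset.mem_filter]
    exact ⟨fun h => h.2, fun h => ⟨h.mem, h⟩⟩
  · intro y hy
    congr 1
    ext z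
    rw [Finset.mem_filter, Finset.mem_filter, lk_vertexSet, lk_NK]
    exact ⟨fun h => ⟨h.2.r23.n, h.2⟩, fun h => ⟨h.1.mem, h.2⟩⟩

theorem lk_f2 (hK : Nrm K) (x : ℕ) : 3 * (K.lk {x}).fnum 2 = 2 * (K.lk {x}).fnum 1 := by
  classical
  set L := K.lk {x} with hL
  have h2 := Finset.sum_card_bipartiteAbove_eq_sum_card_bipartiteBelow
    (s := L.faces.filter fun s => s.card = 2) (t := L.faces.filter fun s => s.card = 3)
    (fun e s => e ⊆ s)
  simp only [Finset.bipartiteAbove, Finset.bipartiteBelow] at h2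
  have e1 : ∀ e ∈ L.faces.filter (fun s => s.card = 2),
      ((L.faces.filter fun s => s.card = 3).filter (fun s => e ⊆ s)).card = 2 := by
    intro e he
    rw [Finset.mem_filter, hL, mem_lkv] at he
    obtain ⟨⟨h1, hx, hf⟩, hc⟩ := he
    obtain ⟨a, b, hab, hall⟩ := hK.two _ hf (by rw [Finset.card_insert_of_notMem hx, hc])
    have hkey : ∀ y, (y = a ∨ y = b) → y ≠ x ∧ y ∉ e ∧ insert x (insert y e) ∈ K.faces := by
      intro y hy
      have := (hall y).2 hy
      rw [Finset.mem_insert, not_or] at this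
      exact ⟨this.1.1, this.1.2, by rw [Finset.insert_comm]; exact this.2⟩
    have hset : ((L.faces.filter fun s => s.card = 3).filter (fun s => e ⊆ s))
        = {insert a e, insert b e} := by
      ext s
      rw [Finset.mem_filter, Finset.mem_filter, hL, mem_lkv, Finset.mem_insert, Finset.mem_singleton]
      constructor
      · rintro ⟨⟨⟨g1, g2, g3⟩, g4⟩, g5⟩
        obtain ⟨z, hz, rfl⟩ := Spl.split_insert g5 (by omega)
        rw [Finset.mem_insert, not_or] at g2
        have := (hall z).1 ⟨by rw [Finset.mem_insert, not_or]; exact ⟨Ne.symm g2.1, hz⟩,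
          by rw [Finset.insert_comm]; exact g3⟩
        rcases this with rfl | rfl
        · left; rfl
        · right; rfl
      · intro hs
        obtain ⟨y, hy, rfl⟩ : ∃ y, (y = a ∨ y = b) ∧ s = insert y e := by
          rcases hs with rfl | rfl
          · exact ⟨a, Or.inl rfl, rfl⟩
          · exact ⟨b, Or.inr rfl, rfl⟩
        obtain ⟨k1, k2, k3⟩ := hkey y hy
        refine ⟨⟨⟨by simp, ?_, k3⟩, ?_⟩, Finset.subset_insert _ _⟩
        · rw [Finset.mem_insert, not_or]; exact ⟨Ne.symm k1, hx⟩
        · rw [Finset.card_insert_of_notMem k2, hc]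
    rw [hset, Finset.card_pair]
    intro hne
    have ha := (hkey a (Or.inl rfl)).2.1
    have : a ∈ insert b e := hne ▸ Finset.mem_insert_self a e
    rw [Finset.mem_insert] at this
    exact this.elim hab ha
  have e2 : ∀ s ∈ L.faces.filter (fun s => s.card = 3),
      ((L.faces.filter fun s => s.card = 2).filter (fun e => e ⊆ s)).card = 3 := by
    intro s hs
    rw [Finset.mem_filter] at hs
    have : ((L.faces.filter fun s => s.card = 2).filter (fun e => e ⊆ s)) = s.powersetCard 2 := by
      ext e
      rw [Finset.mem_filter, Finset.mem_filter, Finset.mem_powersetCard]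
      constructor
      · rintro ⟨⟨_, h⟩, h'⟩; exact ⟨h', h⟩
      · rintro ⟨h', h⟩
        exact ⟨⟨down hs.1 h' (Finset.card_pos.1 (by omega)), h⟩, h'⟩
    rw [this, Finset.card_powersetCard, hs.2]
    rfl
  rw [Finset.sum_congr rfl e1, Finset.sum_congr rfl e2, Finset.sum_const, Finset.sum_const,
    smul_eq_mul, smul_eq_mul] at h2
  have f1 : L.fnum 1 = (L.faces.filter fun s => s.card = 2).card := rfl
  have f2 : L.fnum 2 = (L.faces.filter fun s => s.card = 3).card := rfl
  omega

/-- every vertex has at least three neighbours and so on: a tetrahedron through it -/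
theorem Nrm.exN (hK : Nrm K) {x : ℕ} (hx : x ∈ K.vertexSet) : ∃ y, NK K x y := by
  obtain ⟨F, hF, hs, h4⟩ := hK.ext _ (mem_vertexSet.1 hx)
  obtain ⟨T, h1, h2, h3⟩ := Finset.exists_subsuperset_card_eq hs (n := 2)
    (by simp) (by omega)
  obtain ⟨z, hz, rfl⟩ := Spl.split_insert h1 (by rw [h3]; simp)
  rw [Finset.mem_singleton] at hz
  exact ⟨z, Ne.symm hz, down hF (by rw [Finset.pair_comm]; exact h2) (by simp)⟩

theorem six_le (hK : Nrm K) {t : ℕ} (ht : t ∈ K.vertexSet) {h : ℕ} (hh : 1 ≤ h)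
    (hlink : (K.lk {t}).euler = 2 - 2 * (h : ℤ)) : 6 ≤ K.vertexSet.card := by
  classical
  by_contra hlt
  have e1 := lk_f1 (K := K) t
  have e0 := lk_f0 (K := K) t
  have e2 := lk_f2 hK t
  rw [euler] at hlink
  have hnb : ∀ y, (K.vertexSet.filter (RK K t y)).card ≤ 3 := by
    intro y
    by_cases hy : ∃ z, RK K t y z
    · obtain ⟨z, hz⟩ := hy
      have hsub : K.vertexSet.filter (RK K t y) ⊆ (K.vertexSet.erase t).erase y := by
        intro w hw
        rw [Finset.mem_filter] at hw
        rw [Finset.mem_erase, Finset.mem_erase]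
        exact ⟨Ne.symm hw.2.2.2.1, Ne.symm hw.2.2.1, hw.1⟩
      have := Finset.card_le_card hsub
      rw [Finset.card_erase_of_mem (Finset.mem_erase.2 ⟨Ne.symm hz.1, hz.n.mem⟩),
        Finset.card_erase_of_mem ht] at this
      omega
    · rw [Finset.filter_false_of_mem (fun w _ hw => hy ⟨w, hw⟩)]; simp
  have hle := Finset.sum_le_sum (s := K.vertexSet.filter (NK K t)) (fun y _ => hnb y)
  rw [e1, Finset.sum_const, smul_eq_mul] at hle
  have h4 : 4 ≤ (K.vertexSet.filter (NK K t)).card := by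
    obtain ⟨y, hy⟩ := hK.exN ht
    obtain ⟨z, hz⟩ := hK.exR hy
    obtain ⟨a, b, hab, hQ⟩ := hK.twoQ hz
    have qa := (hQ a).2 (Or.inl rfl)
    have qb := (hQ b).2 (Or.inr rfl)
    have : ({y, z, a, b} : Finset ℕ) ⊆ K.vertexSet.filter (NK K t) := by
      intro w hw
      have : NK K t w := by
        simp only [Finset.mem_insert, Finset.mem_singleton] at hw
        rcases hw with rfl | rfl | rfl | rfl
        · exact hy
        · exact hz.r23.n
        · exact qa.q34.r.r23.n
        · exact qb.q34.r.r23.n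
      exact Finset.mem_filter.2 ⟨this.mem, this⟩
    have h2 := Finset.card_le_card this
    have h3 : ({y, z, a, b} : Finset ℕ).card = 4 := by
      obtain ⟨-, -, -, q4, q5, q6, -⟩ := qa
      obtain ⟨-, -, -, -, p5, p6, -⟩ := qb
      rw [Finset.card_insert_of_notMem, Finset.card_insert_of_notMem, Finset.card_pair hab]
      · simp [q6, p6]
      · simp [q4, q5, p5]
    omega
  omega

/-- the discharging data of a member of the class -/
noncomputable def disData (h : InClassR K) (t : ℕ) (h6 : 6 ≤ K.vertexSet.card)
    (ht : ∀ x ∈ K.vertexSet, x ≠ t → K.HasSphereLink 3 x) : DisData where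
  V := K.vertexSet
  N := NK K
  R := RK K
  Q := QK K
  t := t
  Nsymm := NK.symm
  Nne := fun h => h.1
  Nmem := NK.mem
  R12 := RK.r12
  R23 := RK.r23
  RN := RK.n
  Q12 := QK.q12
  Q23 := QK.q23
  Q34 := QK.q34
  QR := QK.r
  two := by
    intro x y z hr
    obtain ⟨a, b, hab, hQ⟩ := h.1.nrm.twoQ hr
    rw [← Finset.card_pair hab]
    congr 1
    ext c
    rw [@Finset.mem_filter _ _ (_), hQ, Finset.mem_insert, Finset.mem_singleton]
    exact ⟨fun h => h.2, fun hc => ⟨((hQ c).2 hc).q34.r.r23.n.mem, hc⟩⟩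
  c1 := by
    intro x S hS a b ha hb hSa
    refine h.1.nrm.lc {x} (by simp) (Or.inr (mem_vertexSet.1 ha.mem')) S ?_ a b ?_ ?_ ?_ ?_ hSa
    · intro p q hp hq hf hSp
      rw [Finset.mem_singleton] at hp hq
      by_cases hpq : p = q
      · exact hpq ▸ hSp
      refine hS p q ⟨Ne.symm hp, Ne.symm hq, hpq, ?_⟩ hSp
      convert hf using 1
      ext w; simp; tauto
    · simpa using Ne.symm ha.1
    · simpa using Ne.symm hb.1
    · exact ha.symm.2
    · exact hb.symm.2
  c2 := by
    intro x y S hS a b ha hb hSa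
    refine h.1.nrm.lc {x, y} Finset.card_le_two (Or.inr ha.n.2) S ?_ a b ?_ ?_ ?_ ?_ hSa
    · intro p q hp hq hf hSp
      simp only [Finset.mem_insert, Finset.mem_singleton, not_or] at hp hq
      by_cases hpq : p = q
      · exact hpq ▸ hSp
      refine hS p q ⟨ha.1, Ne.symm hp.1, Ne.symm hq.1, Ne.symm hp.2, Ne.symm hq.2, hpq, ?_⟩ hSp
      convert hf using 1
      ext w; simp; tauto
    · simpa using ⟨Ne.symm ha.2.1, Ne.symm ha.2.2.1⟩
    · simpa using ⟨Ne.symm hb.2.1, Ne.symm hb.2.2.1⟩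
    · exact ha.r23.r12.2.2.2
    · exact hb.r23.r12.2.2.2
  A := fun hn => h.A h6 hn
  B := fun hn => h.B h6 hn
  T := fun hx h1 h2 h3 => h.T (ht _ h1.n.mem' hx) h1 h2 h3
  div := by
    intro x
    rw [lk_f1, ← lk_f2 h.1.nrm]
    exact Dvd.intro _ rfl
  nbr := fun x hx => h.1.nrm.exN hx


/-- Lemma 4.2: if `K ∈ R₁` and the link of its singular vertex `t` is a closed
connected surface with `h ≥ 1` handles (Euler characteristic `2 − 2h`), then
`f₁(K) ≥ 4 f₀(K) + (6h − 10) + f₀(lk(t))`. -/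
theorem statement14 (K : SComplex) (t : ℕ) (h : ℕ) (hK : InClassR K)
    (hsing : {v | K.IsSingular v} = {t})
    (hh : 1 ≤ h)
    (hlink : (K.lk {t}).euler = 2 - 2 * (h : ℤ)) :
    4 * (K.fnum 0 : ℤ) + (6 * (h : ℤ) - 10) + ((K.lk {t}).fnum 0 : ℤ)
      ≤ (K.fnum 1 : ℤ) := by
  classical
  have hts : K.IsSingular t := by
    have : t ∈ {v | K.IsSingular v} := by rw [hsing]; rfl
    exact this
  have htV : t ∈ K.vertexSet := mem_vertexSet.2 hts.1
  have hsph : ∀ x ∈ K.vertexSet, x ≠ t → K.HasSphereLink 3 x := by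
    intro x hx hxt
    by_contra hn
    have : x ∈ {v | K.IsSingular v} := ⟨mem_vertexSet.1 hx, hn⟩
    rw [hsing] at this
    exact hxt this
  have h6 := six_le hK.1.nrm htV hh hlink
  have hmain := (disData hK t h6 hsph).main
  change 0 ≤ ∑ x ∈ K.vertexSet.erase t, (if NK K t x then
    ((K.vertexSet.filter (NK K x)).card : ℤ) - 1 - ((K.vertexSet.filter (RK K t x)).card : ℤ) - 2
    else ((K.vertexSet.filter (NK K x)).card : ℤ) - 8) at hmain
  have e1 := lk_f1 (K := K) t
  have e0 := lk_f0 (K := K) t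
  have e2 := lk_f2 hK.1.nrm t
  have eV := fnum0_vertexSet K
  have eE := sum_deg K
  rw [euler] at hlink
  have hfil : (K.vertexSet.erase t).filter (NK K t) = K.vertexSet.filter (NK K t) := by
    ext y
    rw [Finset.mem_filter, Finset.mem_filter, Finset.mem_erase]
    exact ⟨fun h => ⟨h.1.2, h.2⟩, fun h => ⟨⟨Ne.symm h.2.1, h.1⟩, h.2⟩⟩
  have hterm : ∀ x ∈ K.vertexSet.erase t, (if NK K t x then
    ((K.vertexSet.filter (NK K x)).card : ℤ) - 1 - ((K.vertexSet.filter (RK K t x)).card : ℤ) - 2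
    else ((K.vertexSet.filter (NK K x)).card : ℤ) - 8) =
    (((K.vertexSet.filter (NK K x)).card : ℤ) - 8) +
      (if NK K t x then 5 - ((K.vertexSet.filter (RK K t x)).card : ℤ) else 0) := by
    intro x _
    split_ifs <;> ring
  rw [Finset.sum_congr rfl hterm, Finset.sum_add_distrib, ← Finset.sum_filter, hfil,
    Finset.sum_sub_distrib, Finset.sum_sub_distrib, Finset.sum_const, Finset.sum_const,
    Finset.card_erase_of_mem htV, ← Nat.cast_sum, ← Nat.cast_sum, e1] at hmain
  rw [← Finset.add_sum_erase _ _ htV] at eE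
  simp only [nsmul_eq_mul] at hmain
  rw [Nat.cast_sub (by omega)] at hmain
  push_cast at hmain
  have eE' : ((K.vertexSet.filter (NK K t)).card : ℤ) +
      ∑ x ∈ K.vertexSet.erase t, ((K.vertexSet.filter (NK K x)).card : ℤ) = 2 * (K.fnum 1 : ℤ) := by
    exact_mod_cast eE
  omega

end SComplex
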